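/- Let d ≥ 1, P ∈ ℝ^d and k > 0. Let H satisfy Assumptions A1 and A2. Suppose (m, u) : [0, ∞) × ℝ^d → ℝ × ℝ is C¹ in t, with m(t,·) ℤ^d-periodic, C¹ in x and strictly positive, u(t,·) ℤ^d-periodic and C² in x, solving the entropy-penalized Hessian Riemannian flow, and ∫_{[0,1]^d} m(0,·) dx = 1, ∫_{[0,1]^d} u(0,·) dx = 0. Let (m*, u*, H̄*) be a smooth ℤ^d-periodic solution of the entropy-penalized stationary system with m* > 0, ∫_{[0,1]^d} m* dx = 1 and ∫_{[0,1]^d} u* dx = 0. Then there exists a sequence t_i → ∞ such that ∫_{[0,1]^d} (|u(t_i,·) − u*|² + |D_x u(t_i,·) − D_x u*|²) dx → 0 as i → ∞; moreover ∫_{[0,1]^d} |u(t,·) − u*|² dx → 0 and ∫_{[0,1]^d} |m(t,·) − m*| dx → 0 as t → ∞. -/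

import Mathlib

open MeasureTheory Filter

/-- The spatial gradient `(D_x f)(x)`, computed componentwise via `fderiv`. -/
noncomputable def pgrad {d : ℕ} (f : (Fin d → ℝ) → ℝ) (x : Fin d → ℝ) : Fin d → ℝ :=
  fun i => fderiv ℝ f x (Pi.single i 1)

/-- The divergence of a vector field `V` at `x`. -/
noncomputable def pdiv {d : ℕ} (V : (Fin d → ℝ) → (Fin d → ℝ)) (x : Fin d → ℝ) : ℝ :=
  ∑ i, fderiv ℝ (fun y => V y i) x (Pi.single i 1)

/-- `ℤ^d`-periodicity of a function on `ℝ^d`. -/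
def ZPeriodic {d : ℕ} (f : (Fin d → ℝ) → ℝ) : Prop :=
  ∀ (z : Fin d → ℤ) (x : Fin d → ℝ), f (x + fun i => (z i : ℝ)) = f x

section partB

noncomputable def muQ (d : ℕ) : Measure (Fin d → ℝ) :=
  volume.restrict (Set.Icc (0 : Fin d → ℝ) 1)

instance muQ_prob (d : ℕ) : IsProbabilityMeasure (muQ d) := by
  constructor
  rw [muQ, Measure.restrict_apply_univ, Real.volume_Icc_pi]
  simp

def nsq {d : ℕ} (q : Fin d → ℝ) : ℝ := ∑ i, q i ^ 2

def dot {d : ℕ} (p q : Fin d → ℝ) : ℝ := ∑ i, p i * q i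

lemma nsq_nonneg {d : ℕ} (q : Fin d → ℝ) : 0 ≤ nsq q :=
  Finset.sum_nonneg fun i _ => sq_nonneg _

lemma dot_self {d : ℕ} (q : Fin d → ℝ) : dot q q = nsq q := by
  simp [dot, nsq, sq]

lemma dot_comm {d : ℕ} (p q : Fin d → ℝ) : dot p q = dot q p := by
  simp [dot, mul_comm]

lemma dot_add {d : ℕ} (p q r : Fin d → ℝ) : dot p (q + r) = dot p q + dot p r := by
  simp [dot, mul_add, Finset.sum_add_distrib]

lemma dot_sub {d : ℕ} (p q r : Fin d → ℝ) : dot p (q - r) = dot p q - dot p r := by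
  simp [dot, mul_sub, Finset.sum_sub_distrib]

lemma dot_smul {d : ℕ} (c : ℝ) (p q : Fin d → ℝ) : dot p (c • q) = c * dot p q := by
  simp only [dot, Finset.mul_sum]
  refine Finset.sum_congr rfl fun i _ => ?_
  simp only [Pi.smul_apply, smul_eq_mul]; ring

lemma smul_dot {d : ℕ} (c : ℝ) (p q : Fin d → ℝ) : dot (c • p) q = c * dot p q := by
  rw [dot_comm, dot_smul, dot_comm]

lemma nsq_smul {d : ℕ} (c : ℝ) (q : Fin d → ℝ) : nsq (c • q) = c ^ 2 * nsq q := by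
  simp only [nsq, Finset.mul_sum]
  refine Finset.sum_congr rfl fun i _ => ?_
  simp only [Pi.smul_apply, smul_eq_mul]; ring

lemma dot_sq_le {d : ℕ} (p q : Fin d → ℝ) : dot p q ^ 2 ≤ nsq p * nsq q :=
  Finset.sum_mul_sq_le_sq_mul_sq _ _ _

lemma dot_le_half {d : ℕ} (p q : Fin d → ℝ) : |dot p q| ≤ (nsq p + nsq q) / 2 := by
  have h : |dot p q| ≤ ∑ i, |p i * q i| := Finset.abs_sum_le_sum_abs _ _
  refine h.trans ?_
  rw [nsq, nsq, ← Finset.sum_add_distrib, Finset.sum_div]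
  refine Finset.sum_le_sum fun i _ => ?_
  rw [abs_mul]
  nlinarith [sq_nonneg (|p i| - |q i|), sq_abs (p i), sq_abs (q i)]

lemma nsq_add_le {d : ℕ} (p q : Fin d → ℝ) : nsq (p + q) ≤ 2 * nsq p + 2 * nsq q := by
  rw [nsq, nsq, nsq, Finset.mul_sum, Finset.mul_sum, ← Finset.sum_add_distrib]
  refine Finset.sum_le_sum fun i _ => ?_
  simp only [Pi.add_apply]
  nlinarith [sq_nonneg (p i - q i)]

lemma nsq_neg {d : ℕ} (p : Fin d → ℝ) : nsq (-p) = nsq p := by simp [nsq]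

lemma nsq_sub_le {d : ℕ} (p q : Fin d → ℝ) : nsq (p - q) ≤ 2 * nsq p + 2 * nsq q := by
  have := nsq_add_le p (-q)
  rwa [nsq_neg, ← sub_eq_add_neg] at this

lemma norm_sq_le_nsq {d : ℕ} (p : Fin d → ℝ) : ‖p‖ ^ 2 ≤ nsq p := by
  have h : ‖p‖ ≤ Real.sqrt (nsq p) := by
    refine (pi_norm_le_iff_of_nonneg (Real.sqrt_nonneg _)).2 fun i => ?_
    refine Real.le_sqrt_of_sq_le ?_
    rw [Real.norm_eq_abs, sq_abs]
    exact Finset.single_le_sum (f := fun i => p i ^ 2) (fun i _ => sq_nonneg _) (Finset.mem_univ i)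
  calc ‖p‖ ^ 2 ≤ Real.sqrt (nsq p) ^ 2 := by gcongr
    _ = nsq p := Real.sq_sqrt (nsq_nonneg p)

lemma nsq_le_norm_sq {d : ℕ} (p : Fin d → ℝ) : nsq p ≤ d * ‖p‖ ^ 2 := by
  have : ∀ i ∈ Finset.univ, p i ^ 2 ≤ ‖p‖ ^ 2 := fun i _ => by
    rw [← sq_abs]
    have := norm_le_pi_norm p i
    rw [Real.norm_eq_abs] at this
    gcongr
  refine (Finset.sum_le_sum this).trans ?_
  simp

@[fun_prop]
lemma continuous_nsq {d : ℕ} : Continuous (nsq : (Fin d → ℝ) → ℝ) := by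
  unfold nsq; fun_prop

@[fun_prop]
lemma Continuous.dot' {X : Type*} [TopologicalSpace X] {d : ℕ} {f g : X → Fin d → ℝ}
    (hf : Continuous f) (hg : Continuous g) : Continuous (fun x => dot (f x) (g x)) := by
  unfold dot; fun_prop

@[fun_prop]
lemma Continuous.nsq' {X : Type*} [TopologicalSpace X] {d : ℕ} {f : X → Fin d → ℝ}
    (hf : Continuous f) : Continuous (fun x => nsq (f x)) := by
  unfold nsq; fun_prop

lemma fderiv_eq_dot {d : ℕ} (f : (Fin d → ℝ) → ℝ) (x z : Fin d → ℝ) :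
    fderiv ℝ f x z = dot (pgrad f x) z := by
  conv_lhs => rw [pi_eq_sum_univ' z]
  simp only [map_sum, dot, pgrad]
  refine Finset.sum_congr rfl fun i _ => ?_
  rw [map_smul, smul_eq_mul, mul_comm]

lemma per_exists_cube {d : ℕ} (x : Fin d → ℝ) :
    ∃ z : Fin d → ℤ, (x + fun i => (z i : ℝ)) ∈ Set.Icc (0 : Fin d → ℝ) 1 := by
  refine ⟨fun i => -⌊x i⌋, fun i => ?_, fun i => ?_⟩
  · simp [Int.floor_le]
  · have := Int.lt_floor_add_one (x i)
    simp; linarith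

lemma per_bdd {d : ℕ} {f : (Fin d → ℝ) → ℝ} (hf : ZPeriodic f) (hc : Continuous f) :
    ∃ C, ∀ x, |f x| ≤ C := by
  obtain ⟨C, hC⟩ := (isCompact_Icc (a := (0 : Fin d → ℝ)) (b := 1)).exists_bound_of_continuousOn
    hc.continuousOn
  refine ⟨C, fun x => ?_⟩
  obtain ⟨z, hz⟩ := per_exists_cube x
  have := hC _ hz
  rwa [hf z x] at this

lemma per_pos {d : ℕ} {f : (Fin d → ℝ) → ℝ} (hf : ZPeriodic f) (hc : Continuous f)
    (hp : ∀ x, 0 < f x) : ∃ c, 0 < c ∧ ∀ x, c ≤ f x := by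
  obtain ⟨x0, -, hx0⟩ := (isCompact_Icc (a := (0 : Fin d → ℝ)) (b := 1)).exists_isMinOn
    ⟨0, by simp⟩ hc.continuousOn
  refine ⟨f x0, hp _, fun x => ?_⟩
  obtain ⟨z, hz⟩ := per_exists_cube x
  have := hx0 hz
  simpa [hf z x] using this

lemma per_pgrad {d : ℕ} {f : (Fin d → ℝ) → ℝ} (hf : ZPeriodic f) (z : Fin d → ℤ)
    (x : Fin d → ℝ) : pgrad f (x + fun i => (z i : ℝ)) = pgrad f x := by
  have h : (fun y => f (y + fun i => (z i : ℝ))) = f := funext fun y => hf z y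
  have h2 := fderiv_comp_add_right (𝕜 := ℝ) (f := f) (x := x) (fun i => (z i : ℝ))
  rw [h] at h2
  ext i
  simp [pgrad, h2]

open scoped Pointwise in
lemma muQ_translate {d : ℕ} {f : (Fin d → ℝ) → ℝ} (hf : ZPeriodic f) (z : Fin d → ℝ) :
    ∫ x, f (x + z) ∂muQ d = ∫ x, f x ∂muQ d := by
  set D : Set (Fin d → ℝ) := Set.pi Set.univ fun _ => Set.Ico (0 : ℝ) 1 with hD
  have hQ : ∀ g : (Fin d → ℝ) → ℝ, ∫ x, g x ∂muQ d = ∫ x in D, g x := by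
    intro g
    rw [muQ]
    refine (setIntegral_congr_set ?_).symm
    exact Measure.univ_pi_Ico_ae_eq_Icc (μ := fun _ : Fin d => (volume : Measure ℝ))
  rw [hQ, hQ]
  have hfd := ZSpan.isAddFundamentalDomain (Pi.basisFun ℝ (Fin d)) (volume : Measure (Fin d → ℝ))
  rw [ZSpan.fundamentalDomain_pi_basisFun, ← hD] at hfd
  have hfd2 : IsAddFundamentalDomain (Submodule.span ℤ (Set.range (Pi.basisFun ℝ (Fin d))))
      (z +ᵥ D) (volume : Measure (Fin d → ℝ)) := hfd.vadd_of_comm z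
  have : VAddInvariantMeasure (Submodule.span ℤ (Set.range (Pi.basisFun ℝ (Fin d))))
      (Fin d → ℝ) volume :=
    inferInstanceAs <| VAddInvariantMeasure
      (Submodule.span ℤ (Set.range (Pi.basisFun ℝ (Fin d)))).toAddSubgroup _ _
  have hinv : ∀ (g : Submodule.span ℤ (Set.range (Pi.basisFun ℝ (Fin d)))) (x : Fin d → ℝ),
      f (g +ᵥ x) = f x := by
    rintro ⟨g, hg⟩ x
    rw [(Pi.basisFun ℝ (Fin d)).mem_span_iff_repr_mem ℤ] at hg
    choose w hw using hg
    have : g = fun i => (w i : ℝ) := by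
      ext i
      have := hw i
      simp at this
      exact this.symm
    change f (g + x) = f x
    rw [this, add_comm]
    exact hf w x
  have key := hfd.setIntegral_eq hfd2 hinv
  rw [key]
  have h3 : (z +ᵥ D) = (fun x => x + z) '' D := by
    ext y
    simp only [Set.mem_vadd_set, vadd_eq_add, Set.mem_image, add_comm z]
  rw [h3]
  exact ((measurePreserving_add_right volume z).setIntegral_image_emb
    (measurableEmbedding_addRight z) f D).symm

lemma cont_int {d : ℕ} {f : (Fin d → ℝ) → ℝ} (hf : Continuous f) : Integrable f (muQ d) :=
  hf.continuousOn.integrableOn_compact isCompact_Icc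

lemma cont_pgrad {d : ℕ} {f : (Fin d → ℝ) → ℝ} (hf : ContDiff ℝ 1 f) :
    Continuous (pgrad f) := by
  refine continuous_pi fun i => ?_
  exact (hf.continuous_fderiv (by norm_num)).clm_apply continuous_const

lemma line_ftc {d : ℕ} {f : (Fin d → ℝ) → ℝ} (hf : ContDiff ℝ 1 f) (x z : Fin d → ℝ) :
    f (x + z) - f x = ∫ s in (0 : ℝ)..1, dot (pgrad f (x + s • z)) z := by
  have h1 : ∀ s ∈ Set.uIcc (0 : ℝ) 1, HasDerivAt (fun s : ℝ => f (x + s • z))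
      (dot (pgrad f (x + s • z)) z) s := by
    intro s _
    rw [← fderiv_eq_dot]
    have hd := (hf.differentiable (by norm_num) (x + s • z)).hasFDerivAt
    have hl : HasDerivAt (fun s : ℝ => x + s • z) z s := by
      simpa using ((hasDerivAt_id s).smul_const z).const_add x
    exact hd.comp_hasDerivAt s hl
  have hc : Continuous (fun s : ℝ => dot (pgrad f (x + s • z)) z) :=
    ((cont_pgrad hf).comp (by fun_prop)).dot' continuous_const
  rw [intervalIntegral.integral_eq_sub_of_hasDerivAt h1 (hc.intervalIntegrable _ _)]
  simp

lemma prod_int_of_bdd {d : ℕ} {g : ℝ → (Fin d → ℝ) → ℝ} (hg : Continuous (Function.uncurry g))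
    (a b : ℝ) : Integrable (Function.uncurry g) ((volume.restrict (Set.Icc a b)).prod (muQ d)) := by
  rw [muQ, Measure.prod_restrict]
  exact hg.continuousOn.integrableOn_compact (isCompact_Icc.prod isCompact_Icc)

lemma int_line_swap {d : ℕ} {g : ℝ → (Fin d → ℝ) → ℝ} (hg : Continuous (Function.uncurry g)) :
    ∫ x, (∫ s in (0 : ℝ)..1, g s x) ∂muQ d = ∫ s in (0 : ℝ)..1, (∫ x, g s x ∂muQ d) := by
  simp only [intervalIntegral.integral_of_le zero_le_one, ← integral_Icc_eq_integral_Ioc]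
  exact (integral_integral_swap (prod_int_of_bdd hg 0 1)).symm

lemma per_comp_dot {d : ℕ} {f : (Fin d → ℝ) → ℝ} (hf : ZPeriodic f) (z : Fin d → ℝ) :
    ZPeriodic (fun x => dot (pgrad f x) z) := by
  intro w x
  simp only [per_pgrad hf]

lemma int_grad_dot_zero {d : ℕ} {f : (Fin d → ℝ) → ℝ} (hf : ZPeriodic f) (hc : ContDiff ℝ 1 f)
    (z : Fin d → ℝ) : ∫ x, dot (pgrad f x) z ∂muQ d = 0 := by
  have h0 : ∫ x, (f (x + z) - f x) ∂muQ d = 0 := by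
    have hz : Continuous fun x => f (x + z) := hc.continuous.comp (continuous_add_const z)
    rw [integral_sub (cont_int hz) (cont_int hc.continuous)]
    rw [muQ_translate hf, sub_self]
  simp only [line_ftc hc] at h0
  rw [int_line_swap (g := fun s x => dot (pgrad f (x + s • z)) z)] at h0
  · simp only [muQ_translate (per_comp_dot hf z) (_ • z)] at h0
    simpa using h0
  · have : Continuous fun p : ℝ × (Fin d → ℝ) => pgrad f (p.2 + p.1 • z) :=
      (cont_pgrad hc).comp (by fun_prop)
    exact this.dot' continuous_const

lemma int_pgrad_zero {d : ℕ} {f : (Fin d → ℝ) → ℝ} (hf : ZPeriodic f) (hc : ContDiff ℝ 1 f)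
    (i : Fin d) : ∫ x, pgrad f x i ∂muQ d = 0 := by
  have := int_grad_dot_zero hf hc (Pi.single i 1)
  simp only [← fderiv_eq_dot] at this
  exact this

lemma ibp {d : ℕ} {v : (Fin d → ℝ) → ℝ} {F : (Fin d → ℝ) → Fin d → ℝ}
    (hv : ZPeriodic v) (hvc : ContDiff ℝ 1 v)
    (hF : ∀ (z : Fin d → ℤ) (x : Fin d → ℝ), F (x + fun i => (z i : ℝ)) = F x)
    (hFc : ContDiff ℝ 1 F) :
    ∫ x, v x * pdiv F x ∂muQ d = - ∫ x, dot (F x) (pgrad v x) ∂muQ d := by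
  have hFi : ∀ i, ContDiff ℝ 1 (fun y => F y i) := fun i => contDiff_pi.1 hFc i
  have hper : ∀ i, ZPeriodic (fun x => v x * F x i) := fun i z x => by simp only [hF, hv z x]
  have h := fun i => int_pgrad_zero (hper i) (hvc.mul (hFi i)) i
  have hpt : ∀ i x, pgrad (fun x => v x * F x i) x i =
      v x * fderiv ℝ (fun y => F y i) x (Pi.single i 1) + F x i * pgrad v x i := by
    intro i x
    simp only [pgrad]
    rw [fderiv_fun_mul (hvc.differentiable (by norm_num) x)
      ((hFi i).differentiable (by norm_num) x)]
    simp [smul_eq_mul]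
  have hci : ∀ i, Continuous fun x => v x * fderiv ℝ (fun y => F y i) x (Pi.single i 1) :=
    fun i => hvc.continuous.mul
      (((hFi i).continuous_fderiv (by norm_num)).clm_apply continuous_const)
  have hci2 : ∀ i, Continuous fun x => F x i * pgrad v x i :=
    fun i => (hFi i).continuous.mul ((continuous_apply i).comp (cont_pgrad hvc))
  have hsum : ∫ x, v x * pdiv F x ∂muQ d + ∫ x, dot (F x) (pgrad v x) ∂muQ d = 0 := by
    simp only [pdiv, dot, Finset.mul_sum]
    rw [integral_finsetSum _ fun i _ => cont_int (hci i),
      integral_finsetSum _ fun i _ => cont_int (hci2 i), ← Finset.sum_add_distrib]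
    refine Finset.sum_eq_zero fun i _ => ?_
    rw [← integral_add (cont_int (hci i)) (cont_int (hci2 i)), ← h i]
    exact integral_congr_ae (Eventually.of_forall fun x => (hpt i x).symm)
  linarith

lemma cont_pdiv {d : ℕ} {F : (Fin d → ℝ) → Fin d → ℝ} (hFc : ContDiff ℝ 1 F) :
    Continuous (pdiv F) := by
  have hFi : ∀ i, ContDiff ℝ 1 (fun y => F y i) := fun i => contDiff_pi.1 hFc i
  unfold pdiv
  exact continuous_finsetSum _ fun i _ =>
    ((hFi i).continuous_fderiv (by norm_num)).clm_apply continuous_const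

lemma sq_intervalIntegral_le {g : ℝ → ℝ} (hg : Continuous g) :
    (∫ s in (0 : ℝ)..1, g s) ^ 2 ≤ ∫ s in (0 : ℝ)..1, g s ^ 2 := by
  set c := ∫ s in (0 : ℝ)..1, g s with hc
  have h : 0 ≤ ∫ s in (0 : ℝ)..1, (g s - c) ^ 2 :=
    intervalIntegral.integral_nonneg zero_le_one fun s _ => sq_nonneg _
  have he : ∫ s in (0 : ℝ)..1, (g s - c) ^ 2
      = (∫ s in (0 : ℝ)..1, g s ^ 2) - 2 * c * c + c ^ 2 := by
    have : ∀ s, (g s - c) ^ 2 = g s ^ 2 - 2 * c * g s + c ^ 2 := fun s => by ring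
    simp only [this]
    rw [intervalIntegral.integral_add, intervalIntegral.integral_sub,
      intervalIntegral.integral_const_mul, ← hc]
    · simp
    all_goals exact Continuous.intervalIntegrable (by fun_prop) _ _
  nlinarith

lemma translate_sq_le {d : ℕ} {f : (Fin d → ℝ) → ℝ} (hf : ZPeriodic f) (hc : ContDiff ℝ 1 f)
    (z : Fin d → ℝ) :
    ∫ x, (f (x + z) - f x) ^ 2 ∂muQ d ≤ nsq z * ∫ x, nsq (pgrad f x) ∂muQ d := by
  have hcz : Continuous fun p : ℝ × (Fin d → ℝ) => pgrad f (p.2 + p.1 • z) :=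
      (cont_pgrad hc).comp (by fun_prop)
  have h1 : ∀ x, (f (x + z) - f x) ^ 2 ≤ ∫ s in (0 : ℝ)..1, nsq z * nsq (pgrad f (x + s • z)) := by
    intro x
    rw [line_ftc hc]
    have c1 : Continuous fun s : ℝ => pgrad f (x + s • z) := (cont_pgrad hc).comp (by fun_prop)
    refine (sq_intervalIntegral_le (c1.dot' continuous_const)).trans ?_
    refine intervalIntegral.integral_mono_on zero_le_one
      (Continuous.intervalIntegrable (by fun_prop) _ _)
      (Continuous.intervalIntegrable (by fun_prop) _ _) fun s _ => ?_
    have := dot_sq_le (pgrad f (x + s • z)) z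
    linarith
  have hcont : Continuous (Function.uncurry fun (s : ℝ) (x : Fin d → ℝ) =>
      nsq z * nsq (pgrad f (x + s • z))) := continuous_const.mul hcz.nsq'
  calc ∫ x, (f (x + z) - f x) ^ 2 ∂muQ d
      ≤ ∫ x, (∫ s in (0 : ℝ)..1, nsq z * nsq (pgrad f (x + s • z))) ∂muQ d := by
        refine integral_mono (cont_int ?_) ?_ h1
        · have := hc.continuous; fun_prop
        · have := (prod_int_of_bdd hcont 0 1).integral_prod_right
          simpa only [Function.uncurry, intervalIntegral.integral_of_le zero_le_one,
            ← integral_Icc_eq_integral_Ioc] using this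
    _ = ∫ s in (0 : ℝ)..1, (∫ x, nsq z * nsq (pgrad f (x + s • z)) ∂muQ d) :=
        int_line_swap hcont
    _ = nsq z * ∫ x, nsq (pgrad f x) ∂muQ d := by
        have hp : ZPeriodic fun x => nsq z * nsq (pgrad f x) := fun w x => by
          simp only [per_pgrad hf]
        simp only [muQ_translate hp (_ • z)]
        rw [intervalIntegral.integral_const, integral_const_mul]; simp

lemma poincare {d : ℕ} {f : (Fin d → ℝ) → ℝ} (hf : ZPeriodic f) (hc : ContDiff ℝ 1 f)
    (h0 : ∫ x, f x ∂muQ d = 0) :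
    ∫ x, f x ^ 2 ∂muQ d ≤ d * ∫ x, nsq (pgrad f x) ∂muQ d := by
  have hcf := hc.continuous
  set A := ∫ x, f x ^ 2 ∂muQ d with hA
  set B := ∫ x, nsq (pgrad f x) ∂muQ d with hB
  have hB0 : 0 ≤ B := integral_nonneg fun x => nsq_nonneg _
  have hexp : ∀ z, ∫ x, (f (x + z) - f x) ^ 2 ∂muQ d
      = 2 * A - 2 * ∫ x, f (x + z) * f x ∂muQ d := by
    intro z
    have : ∀ x, (f (x + z) - f x) ^ 2 = f (x + z) ^ 2 + f x ^ 2 - 2 * (f (x + z) * f x) :=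
      fun x => by ring
    simp only [this]
    rw [integral_sub, integral_add, integral_const_mul,
      muQ_translate (f := fun x => f x ^ 2) (fun w x => by simp only [hf w x]), ← hA]
    · ring
    all_goals exact cont_int (by fun_prop)
  have hle : ∀ z ∈ Set.Icc (0 : Fin d → ℝ) 1,
      2 * A - 2 * ∫ x, f (x + z) * f x ∂muQ d ≤ d * B := by
    intro z hz
    rw [← hexp]
    refine (translate_sq_le hf hc z).trans ?_
    refine mul_le_mul_of_nonneg_right ?_ hB0
    have : ∀ i ∈ Finset.univ, z i ^ 2 ≤ 1 := fun i _ => by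
      have h1 := hz.1 i
      have h2 := hz.2 i
      simp at h1 h2
      nlinarith
    refine (Finset.sum_le_sum this).trans (by simp)
  have hcontp : Continuous (Function.uncurry fun (z x : Fin d → ℝ) => f (x + z) * f x) := by
    simp only [Function.uncurry_def]; fun_prop
  have hintg : Integrable (Function.uncurry fun (z x : Fin d → ℝ) => f (x + z) * f x)
      ((muQ d).prod (muQ d)) := by
    rw [muQ, Measure.prod_restrict]
    exact hcontp.continuousOn.integrableOn_compact (isCompact_Icc.prod isCompact_Icc)
  have hswap : ∫ z, ∫ x, f (x + z) * f x ∂muQ d ∂muQ d = 0 := by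
    rw [integral_integral_swap hintg]
    have : ∀ x, ∫ z, f (x + z) * f x ∂muQ d = 0 := fun x => by
      rw [integral_mul_const]
      have := muQ_translate hf x
      simp only [add_comm x, this, h0, zero_mul]
    simp [this]
  have hil : Integrable (fun z => ∫ x, f (x + z) * f x ∂muQ d) (muQ d) := hintg.integral_prod_left
  have hfin : ∫ z, (2 * A - 2 * ∫ x, f (x + z) * f x ∂muQ d) ∂muQ d ≤ ∫ _z, d * B ∂muQ d := by
    refine integral_mono_ae ((integrable_const _).sub (hil.const_mul 2))
      (integrable_const _) ?_
    exact (ae_restrict_iff' measurableSet_Icc).2 (Eventually.of_forall hle)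
  rw [integral_sub (integrable_const _) (hil.const_mul 2),
    integral_const_mul 2 (fun z => ∫ x, f (x + z) * f x ∂muQ d), hswap] at hfin
  simp at hfin
  have hA0 : 0 ≤ A := integral_nonneg fun x => sq_nonneg _
  linarith

end partB

section partC1

def gapA (Z : Set ℝ) (s t : ℝ) : Set ℝ :=
  {a | a ∈ Z ∧ s ≤ a ∧ ∃ b ∈ Z, a < b ∧ b ≤ t ∧ ∀ z ∈ Z, ¬ (a < z ∧ z < b)}

noncomputable def gapB (Z : Set ℝ) (a : ℝ) : ℝ := sInf (Z ∩ Set.Ioi a)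

lemma gapB_eq {Z : Set ℝ} {a b : ℝ} (hb : b ∈ Z) (hab : a < b)
    (h : ∀ z ∈ Z, ¬ (a < z ∧ z < b)) : gapB Z a = b := by
  have : IsLeast (Z ∩ Set.Ioi a) b :=
    ⟨⟨hb, hab⟩, fun z hz => not_lt.1 fun hlt => h z hz.1 ⟨hz.2, hlt⟩⟩
  exact this.csInf_eq

lemma gapB_spec {Z : Set ℝ} {s t a : ℝ} (ha : a ∈ gapA Z s t) :
    gapB Z a ∈ Z ∧ a < gapB Z a ∧ gapB Z a ≤ t ∧ ∀ z ∈ Z, ¬ (a < z ∧ z < gapB Z a) := by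
  obtain ⟨_, _, b, hb, hab, hbt, h⟩ := ha
  rw [gapB_eq hb hab h]
  exact ⟨hb, hab, hbt, h⟩

lemma gap_disjoint (Z : Set ℝ) (s t : ℝ) :
    Pairwise (Function.onFun Disjoint fun a : gapA Z s t => Set.Ioo (a : ℝ) (gapB Z a)) := by
  have key : ∀ a a' : gapA Z s t, (a : ℝ) < a' →
      Disjoint (Set.Ioo (a : ℝ) (gapB Z a)) (Set.Ioo (a' : ℝ) (gapB Z a')) := by
    intro a a' h
    have h1 : gapB Z a ≤ a' := by
      by_contra hc
      exact (gapB_spec a.2).2.2.2 a' a'.2.1 ⟨h, not_le.1 hc⟩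
    rw [Set.disjoint_left]
    intro x hx hx'
    exact absurd (hx.2.trans_le h1) (not_lt.2 hx'.1.le)
  intro a a' hne
  rcases lt_or_gt_of_ne (fun h => hne (Subtype.ext h)) with h | h
  · exact key a a' h
  · exact (key a' a h).symm

lemma gapA_countable (Z : Set ℝ) (s t : ℝ) : (gapA Z s t).Countable := by
  refine Set.PairwiseDisjoint.countable_of_Ioo (y := gapB Z) ?_ fun a ha => (gapB_spec ha).2.1
  intro a ha a' ha' hne
  exact gap_disjoint Z s t (i := ⟨a, ha⟩) (j := ⟨a', ha'⟩) (fun h => hne (congrArg Subtype.val h))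

lemma gap_cover {Z : Set ℝ} (hZ : IsClosed Z) {s t : ℝ} (hs : s ∈ Z) (ht : t ∈ Z)
    {τ : ℝ} (hτ : τ ∈ Set.Icc s t) (hn : τ ∉ Z) :
    ∃ a ∈ gapA Z s t, τ ∈ Set.Ioo a (gapB Z a) := by
  obtain ⟨a, ha⟩ := ((isCompact_Icc (a := s) (b := τ)).inter_left hZ).exists_isGreatest
    ⟨s, hs, le_rfl, hτ.1⟩
  obtain ⟨b, hb⟩ := ((isCompact_Icc (a := τ) (b := t)).inter_left hZ).exists_isLeast
    ⟨t, ht, hτ.2, le_rfl⟩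
  have haτ : a < τ := lt_of_le_of_ne ha.1.2.2 fun h => hn (h ▸ ha.1.1)
  have hbτ : τ < b := lt_of_le_of_ne hb.1.2.1 fun h => hn (h ▸ hb.1.1)
  have hno : ∀ z ∈ Z, ¬ (a < z ∧ z < b) := by
    rintro z hz ⟨h1, h2⟩
    rcases le_total z τ with h | h
    · exact absurd (ha.2 ⟨hz, ha.1.2.1.trans h1.le, h⟩) (not_le.2 h1)
    · exact absurd (hb.2 ⟨hz, h, h2.le.trans hb.1.2.2⟩) (not_le.2 h2)
  refine ⟨a, ⟨ha.1.1, ha.1.2.1, b, hb.1.1, haτ.trans hbτ, hb.1.2.2, hno⟩, haτ, ?_⟩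
  rwa [gapB_eq hb.1.1 (haτ.trans hbτ) hno]

lemma gap_union {Z : Set ℝ} (hZ : IsClosed Z) {s t : ℝ} (hs : s ∈ Z) (ht : t ∈ Z) :
    Set.Icc s t \ Z = ⋃ a : gapA Z s t, Set.Ioo (a : ℝ) (gapB Z a) := by
  ext τ
  simp only [Set.mem_sdiff, Set.mem_iUnion]
  constructor
  · rintro ⟨h1, h2⟩
    obtain ⟨a, ha, h⟩ := gap_cover hZ hs ht h1 h2
    exact ⟨⟨a, ha⟩, h⟩
  · rintro ⟨a, h⟩
    have hb := gapB_spec a.2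
    exact ⟨⟨a.2.2.1.trans h.1.le, h.2.le.trans hb.2.2.1⟩, fun hc => hb.2.2.2 τ hc h⟩

lemma gap_summable {Z : Set ℝ} (hZ : IsClosed Z) {s t : ℝ} (hs : s ∈ Z) (ht : t ∈ Z) :
    Summable fun a : gapA Z s t => gapB Z a - (a : ℝ) := by
  have := (gapA_countable Z s t).to_subtype
  have hi : IntegrableOn (fun _ : ℝ => (1 : ℝ)) (⋃ a : gapA Z s t, Set.Ioo (a : ℝ) (gapB Z a)) := by
    rw [← gap_union hZ hs ht]
    exact (integrableOn_const (by simp) (by simp)).mono_set Set.sdiff_subset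
  have h := (hasSum_integral_iUnion (fun a => measurableSet_Ioo) (gap_disjoint Z s t) hi).summable
  refine h.congr fun a => ?_
  have hb := (gapB_spec a.2).2.1
  simp [Measure.real, ENNReal.toReal_ofReal (sub_nonneg.2 hb.le)]

lemma gap_integral {Z : Set ℝ} (hZ : IsClosed Z) {s t : ℝ} (hs : s ∈ Z) (ht : t ∈ Z)
    {φ : ℝ → ℝ} (hφ : IntegrableOn φ (Set.Icc s t)) :
    HasSum (fun a : gapA Z s t => ∫ τ in Set.Ioo (a : ℝ) (gapB Z a), φ τ)
      ((∫ τ in Set.Icc s t, φ τ) - ∫ τ in Z ∩ Set.Icc s t, φ τ) := by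
  have := (gapA_countable Z s t).to_subtype
  have hi : IntegrableOn φ (⋃ a : gapA Z s t, Set.Ioo (a : ℝ) (gapB Z a)) := by
    rw [← gap_union hZ hs ht]
    exact hφ.mono_set Set.sdiff_subset
  have h := hasSum_integral_iUnion (fun a => measurableSet_Ioo) (gap_disjoint Z s t) hi
  rw [← gap_union hZ hs ht] at h
  have h2 := integral_inter_add_sdiff (s := Set.Icc s t) hZ.measurableSet hφ
  have h3 : (∫ τ in Set.Icc s t, φ τ) - ∫ τ in Z ∩ Set.Icc s t, φ τ
      = ∫ τ in Set.Icc s t \ Z, φ τ := by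
    rw [Set.inter_comm, ← h2]; ring
  rw [h3]; exact h

noncomputable def interpα (Z : Set ℝ) (s τ : ℝ) : ℝ := sSup (Z ∩ Set.Icc s τ)

noncomputable def interpF (Z : Set ℝ) (s : ℝ) (f : ℝ → ℝ) (τ : ℝ) : ℝ :=
  f (interpα Z s τ) + (f (gapB Z (interpα Z s τ)) - f (interpα Z s τ)) /
    (gapB Z (interpα Z s τ) - interpα Z s τ) * (τ - interpα Z s τ)

lemma interpα_mem {Z : Set ℝ} {s τ : ℝ} (h : τ ∈ Z) (hs : s ≤ τ) : interpα Z s τ = τ := by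
  have : IsGreatest (Z ∩ Set.Icc s τ) τ := ⟨⟨h, hs, le_rfl⟩, fun z hz => hz.2.2⟩
  exact this.csSup_eq

lemma interpα_gap {Z : Set ℝ} {s t a τ : ℝ} (ha : a ∈ gapA Z s t) (h : τ ∈ Set.Ico a (gapB Z a)) :
    interpα Z s τ = a := by
  have : IsGreatest (Z ∩ Set.Icc s τ) a := ⟨⟨ha.1, ha.2.1, h.1⟩, fun z hz => by
    by_contra hc
    exact (gapB_spec ha).2.2.2 z hz.1 ⟨not_le.1 hc, hz.2.2.trans_lt h.2⟩⟩
  exact this.csSup_eq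

lemma interpF_mem {Z : Set ℝ} {s τ : ℝ} (f : ℝ → ℝ) (h : τ ∈ Z) (hs : s ≤ τ) :
    interpF Z s f τ = f τ := by
  simp [interpF, interpα_mem h hs]

lemma interpF_gap {Z : Set ℝ} {s t a τ : ℝ} (f : ℝ → ℝ) (ha : a ∈ gapA Z s t)
    (h : τ ∈ Set.Icc a (gapB Z a)) :
    interpF Z s f τ = f a + (f (gapB Z a) - f a) / (gapB Z a - a) * (τ - a) := by
  have hb := gapB_spec ha
  rcases h.2.lt_or_eq with h2 | h2
  · rw [interpF, interpα_gap ha ⟨h.1, h2⟩]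
  · rw [h2, interpF_mem f hb.1 (ha.2.1.trans hb.2.1.le)]
    have : gapB Z a - a ≠ 0 := (sub_pos.2 hb.2.1).ne'
    field_simp
    ring

/-- value of the interpolation as a convex combination of values at points of `Z`. -/
lemma interpF_comb {Z : Set ℝ} (hZ : IsClosed Z) {s t : ℝ} (hs : s ∈ Z) (ht : t ∈ Z)
    (f : ℝ → ℝ) {σ : ℝ} (hσ : σ ∈ Set.Icc s t) :
    ∃ α ∈ Z, ∃ β ∈ Z, ∃ l : ℝ, 0 ≤ l ∧ l ≤ 1 ∧ α ≤ σ ∧ σ ≤ β ∧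
      (∀ z ∈ Z, z ≤ σ → z ≤ α) ∧ (∀ z ∈ Z, σ ≤ z → β ≤ z) ∧
      σ = (1 - l) * α + l * β ∧ interpF Z s f σ = (1 - l) * f α + l * f β := by
  by_cases h : σ ∈ Z
  · exact ⟨σ, h, σ, h, 0, le_rfl, zero_le_one, le_rfl, le_rfl, fun z _ h => h, fun z _ h => h,
      by ring, by rw [interpF_mem f h hσ.1]; ring⟩
  · obtain ⟨a, ha, hσa⟩ := gap_cover hZ hs ht hσ h
    have hb := gapB_spec ha
    have hpos : 0 < gapB Z a - a := sub_pos.2 hb.2.1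
    refine ⟨a, ha.1, gapB Z a, hb.1, (σ - a) / (gapB Z a - a),
      div_nonneg (sub_nonneg.2 hσa.1.le) hpos.le,
      (div_le_one hpos).2 (by linarith [hσa.2]), hσa.1.le, hσa.2.le, ?_, ?_, ?_, ?_⟩
    · intro z hz hzσ
      by_contra hc
      exact hb.2.2.2 z hz ⟨not_le.1 hc, hzσ.trans_lt hσa.2⟩
    · intro z hz hzσ
      by_contra hc
      exact hb.2.2.2 z hz ⟨hσa.1.trans_le hzσ, not_le.1 hc⟩
    · field_simp; ring
    · rw [interpF_gap f ha ⟨hσa.1.le, hσa.2.le⟩]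
      field_simp; ring

/-- right derivative of the interpolation. -/
lemma interpF_deriv_gap {Z : Set ℝ} {s t a τ : ℝ} (f : ℝ → ℝ) (ha : a ∈ gapA Z s t)
    (h : τ ∈ Set.Ico a (gapB Z a)) :
    HasDerivWithinAt (interpF Z s f) ((f (gapB Z a) - f a) / (gapB Z a - a)) (Set.Ioi τ) τ := by
  have h1 : HasDerivWithinAt (fun τ => f a + (f (gapB Z a) - f a) / (gapB Z a - a) * (τ - a))
      ((f (gapB Z a) - f a) / (gapB Z a - a)) (Set.Ioi τ) τ := by
    have := (((hasDerivAt_id τ).sub_const a).const_mul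
      ((f (gapB Z a) - f a) / (gapB Z a - a))).const_add (f a)
    simpa using this.hasDerivWithinAt
  refine h1.congr_of_eventuallyEq ?_ (interpF_gap f ha ⟨h.1, h.2.le⟩)
  filter_upwards [Ioo_mem_nhdsGT h.2] with σ hσ
  exact interpF_gap f ha ⟨h.1.trans hσ.1.le, hσ.2.le⟩

lemma interpF_deriv_lim {Z : Set ℝ} (hZ : IsClosed Z) {s t τ : ℝ} (hs : s ∈ Z) (ht : t ∈ Z)
    (f : ℝ → ℝ) {g : ℝ} (hτ : τ ∈ Z) (hτs : τ ∈ Set.Ico s t) (hA : τ ∉ gapA Z s t)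
    (hf : HasDerivWithinAt f g (Set.Ioi τ) τ) :
    HasDerivWithinAt (interpF Z s f) g (Set.Ioi τ) τ := by
  rw [hasDerivWithinAt_iff_isLittleO, Asymptotics.isLittleO_iff] at hf ⊢
  intro ε hε
  have h1 := hf hε
  rw [eventually_nhdsWithin_iff, Metric.eventually_nhds_iff] at h1
  obtain ⟨δ, hδ, h1⟩ := h1
  -- a point of Z in (τ, τ+δ)
  obtain ⟨z, hz, hzτ, hzδ, hzt⟩ : ∃ z ∈ Z, τ < z ∧ z < τ + δ ∧ z ≤ t := by
    by_contra hcon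
    push Not at hcon
    obtain ⟨b, hb⟩ := ((isCompact_Icc (a := min t (τ + δ)) (b := t)).inter_left hZ).exists_isLeast
      ⟨t, ht, min_le_left _ _, le_rfl⟩
    refine hA ⟨hτ, hτs.1, b, hb.1.1, ?_, hb.1.2.2, ?_⟩
    · exact (lt_min hτs.2 (by linarith)).trans_le hb.1.2.1
    · rintro z hz ⟨h2, h3⟩
      have hzt : z < t := h3.trans_le hb.1.2.2
      have : τ + δ ≤ z := by
        by_contra hc
        exact absurd (hcon z hz h2 (not_le.1 hc)) (not_lt.2 hzt.le)
      exact absurd (hb.2 ⟨hz, (min_le_right _ _).trans this, hzt.le⟩) (not_le.2 h3)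
  filter_upwards [Ioo_mem_nhdsGT hzτ] with σ hσ
  obtain ⟨α, hα, β, hβ, l, hl0, hl1, hασ, hσβ, hmax, hmin, heq, hval⟩ :=
    interpF_comb hZ hs ht f (σ := σ) ⟨hτs.1.trans hσ.1.le, hσ.2.le.trans hzt⟩
  have hτα : τ ≤ α := hmax τ hτ hσ.1.le
  have hβz : β ≤ z := hmin z hz hσ.2.le
  have hb : ∀ y, τ ≤ y → y ≤ z → |f y - f τ - (y - τ) * g| ≤ ε * (y - τ) := by
    intro y hy hyz
    rcases hy.eq_or_lt with rfl | hy
    · simp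
    · have := h1 (y := y) (by rw [Real.dist_eq, abs_of_pos (sub_pos.2 hy)]; linarith) hy
      simpa [Real.norm_eq_abs, abs_of_pos (sub_pos.2 hy)] using this
  have e1 := hb α hτα (hασ.trans (hσβ.trans hβz))
  have e2 := hb β (hτα.trans (hασ.trans hσβ)) hβz
  rw [hval, interpF_mem f hτ hτs.1, Real.norm_eq_abs, Real.norm_eq_abs,
    abs_of_pos (sub_pos.2 hσ.1), smul_eq_mul]
  have : (1 - l) * f α + l * f β - f τ - (σ - τ) * g
      = (1 - l) * (f α - f τ - (α - τ) * g) + l * (f β - f τ - (β - τ) * g) := by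
    rw [heq]; ring
  rw [this]
  calc _ ≤ |(1 - l) * (f α - f τ - (α - τ) * g)| + |l * (f β - f τ - (β - τ) * g)| := abs_add_le _ _
    _ = (1 - l) * |f α - f τ - (α - τ) * g| + l * |f β - f τ - (β - τ) * g| := by
        rw [abs_mul, abs_mul, abs_of_nonneg hl0, abs_of_nonneg (sub_nonneg.2 hl1)]
    _ ≤ (1 - l) * (ε * (α - τ)) + l * (ε * (β - τ)) := by
        have := sub_nonneg.2 hl1
        gcongr
    _ = ε * (σ - τ) := by rw [heq]; ring

lemma interpF_cont_left {Z : Set ℝ} (hZ : IsClosed Z) {s t τ : ℝ} (hs : s ∈ Z) (ht : t ∈ Z)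
    {f : ℝ → ℝ} (hf : Continuous f) (hτ : τ ∈ Set.Ioc s t) :
    ContinuousWithinAt (interpF Z s f) (Set.Iic τ) τ := by
  by_cases hA : ∃ a ∈ gapA Z s t, τ ∈ Set.Ioc a (gapB Z a)
  · obtain ⟨a, ha, h⟩ := hA
    have h1 : ContinuousWithinAt (fun τ => f a + (f (gapB Z a) - f a) / (gapB Z a - a) * (τ - a))
        (Set.Iic τ) τ := Continuous.continuousWithinAt (by fun_prop)
    refine h1.congr_of_eventuallyEq ?_ (interpF_gap f ha ⟨h.1.le, h.2⟩)
    filter_upwards [Ioc_mem_nhdsLE h.1] with σ hσ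
    exact interpF_gap f ha ⟨hσ.1.le, hσ.2.trans h.2⟩
  · push Not at hA
    have hτZ : τ ∈ Z := by
      by_contra hc
      obtain ⟨a, ha, h⟩ := gap_cover hZ hs ht ⟨hτ.1.le, hτ.2⟩ hc
      exact hA a ha ⟨h.1, h.2.le⟩
    rw [Metric.continuousWithinAt_iff]
    intro ε hε
    obtain ⟨δ, hδ, h1⟩ := Metric.continuousAt_iff.1 hf.continuousAt (ε / 2) (half_pos hε)
    obtain ⟨z, hz, hzτ, hzδ, hzs⟩ : ∃ z ∈ Z, z < τ ∧ τ - δ < z ∧ s ≤ z := by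
      by_contra hcon
      push Not at hcon
      obtain ⟨a, ha⟩ := ((isCompact_Icc (a := s) (b := max s (τ - δ))).inter_left
        hZ).exists_isGreatest ⟨s, hs, le_rfl, le_max_left _ _⟩
      have haτ : a < τ := ha.1.2.2.trans_lt (max_lt hτ.1 (by linarith))
      have hno : ∀ z ∈ Z, ¬ (a < z ∧ z < τ) := by
        rintro z hz ⟨h2, h3⟩
        have hzs : s ≤ z := ha.1.2.1.trans h2.le
        have : z ≤ τ - δ := by
          by_contra hc
          exact absurd (hcon z hz h3 (not_le.1 hc)) (not_lt.2 hzs)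
        exact absurd (ha.2 ⟨hz, hzs, this.trans (le_max_right _ _)⟩) (not_le.2 h2)
      refine hA a ⟨ha.1.1, ha.1.2.1, τ, hτZ, haτ, hτ.2, hno⟩ ⟨haτ, ?_⟩
      rw [gapB_eq hτZ haτ hno]
    refine ⟨τ - z, sub_pos.2 hzτ, fun σ hσ hd => ?_⟩
    have hσ' : σ ≤ τ := hσ
    rw [Real.dist_eq, abs_sub_comm, abs_of_nonneg (sub_nonneg.2 hσ')] at hd
    obtain ⟨α, hα, β, hβ, l, hl0, hl1, hασ, hσβ, hmax, hmin, heq, hval⟩ :=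
      interpF_comb hZ hs ht f (σ := σ) ⟨by linarith, hσ'.trans hτ.2⟩
    have hzα : z ≤ α := hmax z hz (by linarith)
    have hβτ : β ≤ τ := hmin τ hτZ hσ'
    have hb : ∀ y, z ≤ y → y ≤ τ → |f y - f τ| ≤ ε / 2 := by
      intro y h2 h3
      have := h1 (x := y) (by rw [Real.dist_eq, abs_sub_comm, abs_of_nonneg (sub_nonneg.2 h3)]
                              linarith)
      rw [Real.dist_eq] at this
      exact this.le
    have e1 := hb α hzα (by linarith)
    have e2 := hb β (by linarith) hβτ
    rw [Real.dist_eq, hval, interpF_mem f hτZ hτ.1.le]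
    have : (1 - l) * f α + l * f β - f τ = (1 - l) * (f α - f τ) + l * (f β - f τ) := by ring
    rw [this]
    calc _ ≤ |(1 - l) * (f α - f τ)| + |l * (f β - f τ)| := abs_add_le _ _
      _ = (1 - l) * |f α - f τ| + l * |f β - f τ| := by
          rw [abs_mul, abs_mul, abs_of_nonneg hl0, abs_of_nonneg (sub_nonneg.2 hl1)]
      _ ≤ (1 - l) * (ε / 2) + l * (ε / 2) := by
          have := sub_nonneg.2 hl1
          gcongr
      _ < ε := by linarith

/-- one-dimensional Looman-Menchoff type lemma. -/
lemma LM1 {Z : Set ℝ} (hZ : IsClosed Z) {s t : ℝ} (hs : s ∈ Z) (ht : t ∈ Z) (hst : s ≤ t)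
    {f g : ℝ → ℝ} (hf : Continuous f)
    (hd : ∀ τ ∈ Z, τ ∈ Set.Ico s t → HasDerivWithinAt f (g τ) (Set.Ioi τ) τ)
    (hg : IntegrableOn g (Z ∩ Set.Icc s t))
    (hsum : Summable fun a : gapA Z s t => f (gapB Z a) - f a) :
    f t - f s = (∫ τ in Z ∩ Set.Icc s t, g τ) + ∑' a : gapA Z s t, (f (gapB Z a) - f a) := by
  classical
  have hcount := (gapA_countable Z s t).to_subtype
  let G : ℝ → ℝ := fun τ => if τ ∈ Z ∧ τ ∉ gapA Z s t then g τ else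
    (f (gapB Z (interpα Z s τ)) - f (interpα Z s τ)) / (gapB Z (interpα Z s τ) - interpα Z s τ)
  have hder : ∀ τ ∈ Set.Ico s t, HasDerivWithinAt (interpF Z s f) (G τ) (Set.Ioi τ) τ := by
    intro τ hτ
    by_cases h : τ ∈ Z
    · by_cases hA : τ ∈ gapA Z s t
      · have hm : τ ∈ Set.Ico τ (gapB Z τ) := ⟨le_rfl, (gapB_spec hA).2.1⟩
        have := interpF_deriv_gap f hA hm
        simpa [G, hA, interpα_gap hA hm] using this
      · have := interpF_deriv_lim hZ hs ht f h hτ hA (hd τ h hτ)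
        simpa [G, h, hA] using this
    · obtain ⟨a, ha, hm⟩ := gap_cover hZ hs ht ⟨hτ.1, hτ.2.le⟩ h
      have hm' : τ ∈ Set.Ico a (gapB Z a) := ⟨hm.1.le, hm.2⟩
      have := interpF_deriv_gap f ha hm'
      simpa [G, h, interpα_gap ha hm'] using this
  have hcont : ContinuousOn (interpF Z s f) (Set.Icc s t) := by
    intro τ hτ
    have hsub : Set.Icc s t ⊆ Set.Icc s τ ∪ Set.Icc τ t := by
      rw [Set.Icc_union_Icc_eq_Icc hτ.1 hτ.2]
    refine ContinuousWithinAt.mono (ContinuousWithinAt.union ?_ ?_) hsub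
    · rcases hτ.1.eq_or_lt with h | h
      · subst h; rw [Set.Icc_self]; exact continuousWithinAt_singleton
      · exact (interpF_cont_left hZ hs ht hf ⟨h, hτ.2⟩).mono fun x hx => hx.2
    · rcases hτ.2.eq_or_lt with h | h
      · subst h; rw [Set.Icc_self]; exact continuousWithinAt_singleton
      · have h1 := (hder τ ⟨hτ.1, h⟩).continuousWithinAt
        exact (continuousWithinAt_Ioi_iff_Ici.1 h1).mono fun x hx => hx.1
  have hGgap : ∀ a : gapA Z s t, ∀ τ ∈ Set.Ioo (a : ℝ) (gapB Z a), G τ =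
      (f (gapB Z a) - f a) / (gapB Z a - a) := by
    intro a τ hτ
    have hnZ : τ ∉ Z := fun hc => (gapB_spec a.2).2.2.2 τ hc hτ
    simp [G, hnZ, interpα_gap a.2 ⟨hτ.1.le, hτ.2⟩]
  have hGint : ∀ a : gapA Z s t, ∫ τ in Set.Ioo (a : ℝ) (gapB Z a), G τ = f (gapB Z a) - f a := by
    intro a
    rw [setIntegral_congr_fun measurableSet_Ioo (hGgap a)]
    have hb := sub_pos.2 (gapB_spec a.2).2.1
    simp [Measure.real, ENNReal.toReal_ofReal hb.le]
    field_simp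
  have hGZ : ∀ᵐ τ ∂(volume.restrict (Z ∩ Set.Icc s t)), g τ = G τ := by
    rw [ae_restrict_iff' (hZ.measurableSet.inter measurableSet_Icc)]
    have h0 : ∀ᵐ τ : ℝ, τ ∉ gapA Z s t := (gapA_countable Z s t).ae_notMem _
    filter_upwards [h0] with τ hτ hm
    simp [G, hm.1, hτ]
  have hGiZ : IntegrableOn G (Z ∩ Set.Icc s t) := Integrable.congr hg hGZ
  have hGiU : IntegrableOn G (⋃ a : gapA Z s t, Set.Ioo (a : ℝ) (gapB Z a)) := by
    refine integrableOn_iUnion_of_summable_integral_norm (fun a => ?_) ?_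
    · refine IntegrableOn.congr_fun (integrableOn_const (by simp) (by simp))
        (fun τ hτ => (hGgap a τ hτ).symm) measurableSet_Ioo
    · refine hsum.abs.congr fun a => ?_
      rw [setIntegral_congr_fun (g := fun _ => |(f (gapB Z a) - f a) / (gapB Z a - a)|)
        measurableSet_Ioo fun τ hτ => by simp only [hGgap a τ hτ, Real.norm_eq_abs]]
      have hb := sub_pos.2 (gapB_spec a.2).2.1
      simp [Measure.real, ENNReal.toReal_ofReal hb.le, abs_div, abs_of_pos hb]
      field_simp
  have hGi : IntegrableOn G (Set.Icc s t) := by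
    rw [← gap_union hZ hs ht] at hGiU
    have := hGiZ.union hGiU
    rwa [Set.inter_comm, Set.inter_union_sdiff] at this
  have hftc := intervalIntegral.integral_eq_sub_of_hasDeriv_right_of_le hst hcont
    (fun τ hτ => hder τ ⟨hτ.1.le, hτ.2⟩)
    ((intervalIntegrable_iff_integrableOn_Icc_of_le hst).2 hGi)
  rw [interpF_mem f ht hst, interpF_mem f hs le_rfl] at hftc
  have hsplit := gap_integral hZ hs ht hGi
  simp only [hGint] at hsplit
  rw [hsplit.tsum_eq, ← hftc, integral_congr_ae hGZ, intervalIntegral.integral_of_le hst,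
    integral_Icc_eq_integral_Ioc]
  ring

end partC1

section partC2

lemma ae_summable_of_integral {X ι : Type*} [MeasurableSpace X] {μ : Measure X} [Countable ι]
    {F : ι → X → ℝ} (hF : ∀ i, Integrable (F i) μ) (hs : Summable fun i => ∫ x, |F i x| ∂μ) :
    ∀ᵐ x ∂μ, Summable fun i => F i x := by
  have h1 : ∑' i, ∫⁻ x, ‖F i x‖ₑ ∂μ ≠ ⊤ := by
    have : ∀ i, ∫⁻ x, ‖F i x‖ₑ ∂μ = ENNReal.ofReal (∫ x, |F i x| ∂μ) := fun i => by
      rw [ofReal_integral_eq_lintegral_ofReal (hF i).abs (Eventually.of_forall fun x => abs_nonneg _)]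
      refine lintegral_congr fun x => ?_
      rw [Real.enorm_eq_ofReal_abs]
    simp only [this]
    exact hs.tsum_ofReal_ne_top
  rw [← lintegral_tsum fun i => (hF i).1.enorm] at h1
  have h2 := ae_lt_top' (AEMeasurable.tsum fun i => (hF i).1.enorm) h1
  filter_upwards [h2] with x hx
  have := (ENNReal.summable_toReal hx.ne)
  refine Summable.of_norm ?_
  simpa using this

lemma LM {d : ℕ} {Z : Set ℝ} (hZ : IsClosed Z) {s t : ℝ} (hs : s ∈ Z) (ht : t ∈ Z) (hst : s ≤ t)
    {G g : ℝ → (Fin d → ℝ) → ℝ} {Qf : ℝ → ℝ}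
    (hc : ∀ x, Continuous fun τ => G τ x)
    (hGi : ∀ τ ∈ Z, τ ∈ Set.Icc s t → Integrable (G τ) (muQ d))
    (hd : ∀ τ ∈ Z, τ ∈ Set.Ico s t → ∀ x,
      HasDerivWithinAt (fun τ => G τ x) (g τ x) (Set.Ioi τ) τ)
    (hg : Integrable (Function.uncurry g) ((volume.restrict (Z ∩ Set.Icc s t)).prod (muQ d)))
    (C : ℝ) (hgap : ∀ a ∈ gapA Z s t, ∫ x, |G (gapB Z a) x - G a x| ∂muQ d ≤ C * (gapB Z a - a))
    (hQi : IntervalIntegrable Qf volume s t)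
    (hQZ : ∀ τ ∈ Z, τ ∈ Set.Icc s t → ∫ x, g τ x ∂muQ d = Qf τ)
    (hQgap : ∀ a ∈ gapA Z s t, ∫ x, (G (gapB Z a) x - G a x) ∂muQ d
      = ∫ τ in a..gapB Z a, Qf τ) :
    (∫ x, G t x ∂muQ d) - (∫ x, G s x ∂muQ d) = ∫ τ in s..t, Qf τ := by
  have hcount := (gapA_countable Z s t).to_subtype
  have hintg : ∀ a : gapA Z s t, Integrable (fun x => G (gapB Z a) x - G a x) (muQ d) := by
    intro a
    have hb := gapB_spec a.2
    exact (hGi _ hb.1 ⟨a.2.2.1.trans hb.2.1.le, hb.2.2.1⟩).sub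
      (hGi _ a.2.1 ⟨a.2.2.1, hb.2.1.le.trans hb.2.2.1⟩)
  have hsum : Summable fun a : gapA Z s t => ∫ x, |G (gapB Z a) x - G a x| ∂muQ d :=
    Summable.of_nonneg_of_le (fun a => integral_nonneg fun x => abs_nonneg _)
      (fun a => hgap a a.2) ((gap_summable hZ hs ht).mul_left C)
  have hae := ae_summable_of_integral hintg hsum
  have hae2 : ∀ᵐ x ∂muQ d, IntegrableOn (fun τ => g τ x) (Z ∩ Set.Icc s t) :=
    hg.prod_left_ae
  have hpt : ∀ᵐ x ∂muQ d, G t x - G s x = (∫ τ in Z ∩ Set.Icc s t, g τ x)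
      + ∑' a : gapA Z s t, (G (gapB Z a) x - G a x) := by
    filter_upwards [hae, hae2] with x h1 h2
    exact LM1 hZ hs ht hst (hc x) (fun τ hτ hτ' => hd τ hτ hτ' x) h2 h1
  have hsumI := hasSum_integral_of_summable_integral_norm hintg hsum
  have hint2 : Integrable (fun x => ∫ τ in Z ∩ Set.Icc s t, g τ x) (muQ d) := hg.integral_prod_right
  have hst' : s ∈ Set.Icc s t ∧ t ∈ Set.Icc s t := ⟨⟨le_rfl, hst⟩, ⟨hst, le_rfl⟩⟩
  have hIt := hGi t ht hst'.2
  have hIs := hGi s hs hst'.1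
  have hint3 : Integrable (fun x => ∑' a : gapA Z s t, (G (gapB Z a) x - G a x)) (muQ d) := by
    refine ((hIt.sub hIs).sub hint2).congr ?_
    filter_upwards [hpt] with x hx
    simp only [Pi.sub_apply, hx]; ring
  rw [← integral_sub hIt hIs, integral_congr_ae hpt, integral_add hint2 hint3,
    ← hsumI.tsum_eq]
  have hswap : ∫ x, (∫ τ in Z ∩ Set.Icc s t, g τ x) ∂muQ d
      = ∫ τ in Z ∩ Set.Icc s t, Qf τ := by
    rw [← integral_integral_swap hg]
    exact setIntegral_congr_fun (hZ.measurableSet.inter measurableSet_Icc)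
      fun τ hτ => hQZ τ hτ.1 hτ.2
  have hQI := (intervalIntegrable_iff_integrableOn_Icc_of_le hst).1 hQi
  have hdec := gap_integral hZ hs ht hQI
  have heq : ∀ a : gapA Z s t, ∫ x, (G (gapB Z a) x - G a x) ∂muQ d
      = ∫ τ in Set.Ioo (a : ℝ) (gapB Z a), Qf τ := fun a => by
    rw [hQgap a a.2, intervalIntegral.integral_of_le (gapB_spec a.2).2.1.le,
      integral_Ioc_eq_integral_Ioo]
  simp only [heq]
  rw [hdec.tsum_eq, hswap, intervalIntegral.integral_of_le hst, integral_Icc_eq_integral_Ioc]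
  ring

lemma LM_full {d : ℕ} {s t : ℝ} (hst : s ≤ t)
    {G g : ℝ → (Fin d → ℝ) → ℝ}
    (hc : ∀ x, Continuous fun τ => G τ x)
    (hGi : ∀ τ ∈ Set.Icc s t, Integrable (G τ) (muQ d))
    (hd : ∀ τ ∈ Set.Ico s t, ∀ x,
      HasDerivWithinAt (fun τ => G τ x) (g τ x) (Set.Ioi τ) τ)
    (hg : Integrable (Function.uncurry g) ((volume.restrict (Set.Icc s t)).prod (muQ d))) :
    (∫ x, G t x ∂muQ d) - (∫ x, G s x ∂muQ d) = ∫ τ in s..t, (∫ x, g τ x ∂muQ d) := by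
  have hA : ∀ a, a ∉ gapA (Set.Icc s t) s t := by
    rintro a ⟨ha, _, b, hb, hab, _, h⟩
    obtain ⟨z, h1, h2⟩ := exists_between hab
    exact h z ⟨ha.1.trans h1.le, h2.le.trans hb.2⟩ ⟨h1, h2⟩
  refine LM (Z := Set.Icc s t) isClosed_Icc ⟨le_rfl, hst⟩ ⟨hst, le_rfl⟩ hst hc
    (fun τ h _ => hGi τ h) (fun τ _ h => hd τ h) (by rwa [Set.inter_self]) 0
    (fun a ha => absurd ha (hA a)) ?_ (fun τ _ _ => rfl) (fun a ha => absurd ha (hA a))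
  rw [intervalIntegrable_iff_integrableOn_Icc_of_le hst]
  exact hg.integral_prod_left

/-- integrability of a right derivative which is bounded above by an integrable function. -/
lemma int_of_deriv_le {a b : ℝ} (hab : a ≤ b) {f f' ψ : ℝ → ℝ} (hf : ContinuousOn f (Set.Icc a b))
    (hd : ∀ x ∈ Set.Ioo a b, HasDerivWithinAt f (f' x) (Set.Ioi x) x)
    (hm : AEStronglyMeasurable f' (volume.restrict (Set.Icc a b)))
    (hψ : IntegrableOn ψ (Set.Icc a b)) (hle : ∀ x ∈ Set.Ioo a b, f' x ≤ ψ x) :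
    IntegrableOn f' (Set.Icc a b) := by
  set ν := volume.restrict (Set.Icc a b) with hν
  set B := (∫ y in a..b, ψ y) - (f b - f a) with hB
  have hwm : AEStronglyMeasurable (fun x => ψ x - f' x) ν := hψ.1.sub hm
  have hIoo : ∀ᵐ x ∂ν, x ∈ Set.Ioo a b := by
    rw [hν, Measure.restrict_congr_set Ioo_ae_eq_Icc.symm]
    exact ae_restrict_mem measurableSet_Ioo
  have hmin_int : ∀ n : ℕ, Integrable (fun x => min (ψ x - f' x) n) ν := by
    intro n
    refine Integrable.of_bound (C := (n : ℝ)) (hwm.inf aestronglyMeasurable_const) ?_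
    filter_upwards [hIoo] with x hx
    have : 0 ≤ ψ x - f' x := sub_nonneg.2 (hle x hx)
    rw [Real.norm_eq_abs, abs_of_nonneg (le_min this (Nat.cast_nonneg n))]
    exact min_le_right _ _
  have hbound : ∀ n : ℕ, ∫ x, min (ψ x - f' x) n ∂ν ≤ B := by
    intro n
    have h1 := intervalIntegral.sub_le_integral_of_hasDeriv_right_of_le hab hf hd
      (φ := fun x => ψ x - min (ψ x - f' x) n) (Integrable.sub hψ (hmin_int n)) (fun x _ => by
        have := min_le_left (ψ x - f' x) n
        linarith)
    rw [intervalIntegral.integral_of_le hab, ← integral_Icc_eq_integral_Ioc,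
      integral_sub hψ (hmin_int n)] at h1
    rw [hB, intervalIntegral.integral_of_le hab, ← integral_Icc_eq_integral_Ioc]
    linarith
  have hw : Integrable (fun x => ψ x - f' x) ν := by
    refine integrable_of_tendsto (G := fun n x => min (ψ x - f' x) n) ?_ ?_ ?_
    · refine Eventually.of_forall fun x => ?_
      refine tendsto_const_nhds.congr' ?_
      filter_upwards [eventually_ge_atTop ⌈ψ x - f' x⌉₊] with n hn
      rw [min_eq_left]
      exact (Nat.le_ceil _).trans (Nat.cast_le.2 hn)
    · exact fun n => (hmin_int n).1
    · refine ne_top_of_le_ne_top (b := ENNReal.ofReal B) ENNReal.ofReal_ne_top ?_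
      refine liminf_le_of_le (by isBoundedDefault) fun c hc => ?_
      obtain ⟨n, hn⟩ := hc.exists
      refine hn.trans ?_
      have h2 : ∫⁻ x, ‖min (ψ x - f' x) n‖ₑ ∂ν = ENNReal.ofReal (∫ x, min (ψ x - f' x) n ∂ν) := by
        rw [ofReal_integral_eq_lintegral_ofReal (hmin_int n)]
        · refine lintegral_congr_ae ?_
          filter_upwards [hIoo] with x hx
          have : 0 ≤ ψ x - f' x := sub_nonneg.2 (hle x hx)
          rw [Real.enorm_eq_ofReal (le_min this (Nat.cast_nonneg n))]
        · filter_upwards [hIoo] with x hx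
          have : 0 ≤ ψ x - f' x := sub_nonneg.2 (hle x hx)
          exact le_min this (Nat.cast_nonneg n)
      rw [h2]
      exact ENNReal.ofReal_le_ofReal (hbound n)
  have := Integrable.sub hψ hw
  refine this.congr (Eventually.of_forall fun x => ?_)
  simp

lemma klog {x θ : ℝ} (hx : 0 < x) (hθ : 0 < θ) (hθ1 : θ ≤ 1) :
    |x - 1| ≤ θ + 2 / θ * (x - 1 - Real.log x) := by
  set r := Real.sqrt x - 1 with hr
  have hsx : 0 < Real.sqrt x := Real.sqrt_pos.2 hx
  have hlog : Real.log x ≤ 2 * r := by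
    have h1 := Real.log_le_sub_one_of_pos hsx
    rw [Real.log_sqrt hx.le] at h1
    linarith
  have hxr : x = (r + 1) ^ 2 := by rw [hr]; simp [Real.sq_sqrt hx.le]
  have hφ : r ^ 2 ≤ x - 1 - Real.log x := by nlinarith
  have hd : (2 / θ) * r ^ 2 ≤ 2 / θ * (x - 1 - Real.log x) := by gcongr
  have h1 : |x - 1| ≤ 2 * |r| + r ^ 2 := by
    rw [hxr]
    have : (r + 1) ^ 2 - 1 = 2 * r + r ^ 2 := by ring
    rw [this]
    refine (abs_add_le _ _).trans ?_
    rw [abs_mul, abs_of_nonneg (sq_nonneg r)]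
    norm_num
  have h2 : 2 * |r| ≤ θ + r ^ 2 / θ := by
    rw [← sub_nonneg]
    have : θ + r ^ 2 / θ - 2 * |r| = (θ - |r|) ^ 2 / θ := by
      field_simp
      rw [← sq_abs r]; ring
    rw [this]; positivity
  have h3 : r ^ 2 ≤ r ^ 2 / θ := by
    rw [le_div_iff₀ hθ]; nlinarith [sq_nonneg r]
  have h4 : (2 / θ) * r ^ 2 = r ^ 2 / θ + r ^ 2 / θ := by ring
  linarith

/-- pointwise relative entropy integrand. -/
noncomputable def breg (m M : ℝ) : ℝ := m - M + M * (Real.log M - Real.log m)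

lemma breg_eq {m M : ℝ} (hm : 0 < m) (hM : 0 < M) :
    breg m M = M * (m / M - 1 - Real.log (m / M)) := by
  rw [Real.log_div hm.ne' hM.ne', breg]; field_simp; ring

lemma breg_nonneg {m M : ℝ} (hm : 0 < m) (hM : 0 < M) : 0 ≤ breg m M := by
  rw [breg_eq hm hM]
  have := Real.log_le_sub_one_of_pos (div_pos hm hM)
  exact mul_nonneg hM.le (by linarith)

lemma breg_le {m M : ℝ} (hm : 0 < m) (hM : 0 < M) :
    breg m M ≤ (m - M) * (Real.log m - Real.log M) := by
  have h := Real.log_le_sub_one_of_pos (div_pos hM hm)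
  rw [Real.log_div hM.ne' hm.ne'] at h
  have h2 : m * (Real.log M - Real.log m) ≤ M - m := by
    have := mul_le_mul_of_nonneg_left h hm.le
    have e : m * (M / m - 1) = M - m := by field_simp
    linarith
  unfold breg
  nlinarith

lemma abs_sub_le_breg {m M θ : ℝ} (hm : 0 < m) (hM : 0 < M) (hθ : 0 < θ) (hθ1 : θ ≤ 1) :
    |m - M| ≤ θ * M + 2 / θ * breg m M := by
  have h := klog (div_pos hm hM) hθ hθ1
  have h2 := mul_le_mul_of_nonneg_left h hM.le
  have e : M * |m / M - 1| = |m - M| := by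
    rw [← abs_of_pos hM, ← abs_mul, abs_of_pos hM]
    congr 1; field_simp
  rw [e] at h2
  rw [breg_eq hm hM]
  linarith

lemma tendsto_L1_of_L2 {d : ℕ} {ι : Type*} {l : Filter ι} [l.IsCountablyGenerated]
    {w : ι → (Fin d → ℝ) → ℝ} (hw : ∀ i, Continuous (w i)) (C : ℝ)
    (hC : ∀ᶠ i in l, ∫ x, w i x ^ 2 ∂muQ d ≤ C) (hlim : ∀ x, Tendsto (fun i => w i x) l (nhds 0)) :
    Tendsto (fun i => ∫ x, |w i x| ∂muQ d) l (nhds 0) := by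
  rw [Metric.tendsto_nhds]
  intro ε hε
  set K : ℝ := 2 * (|C| + 1) / ε with hK
  have hKpos : 0 < K := by positivity
  have h1 : Tendsto (fun i => ∫ x, min |w i x| K ∂muQ d) l (nhds (∫ _x, (0 : ℝ) ∂muQ d)) := by
    refine tendsto_integral_filter_of_norm_le_const ?_ ?_ ?_
    · exact Eventually.of_forall fun i => Continuous.aestronglyMeasurable (by have := hw i; fun_prop)
    · refine ⟨K, Eventually.of_forall fun i => Eventually.of_forall fun x => ?_⟩
      rw [Real.norm_eq_abs, abs_of_nonneg (le_min (abs_nonneg _) hKpos.le)]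
      exact min_le_right _ _
    · refine Eventually.of_forall fun x => ?_
      have h2 := ((hlim x).abs).min (tendsto_const_nhds (x := K))
      simpa [hKpos.le] using h2
  simp only [integral_zero] at h1
  rw [Metric.tendsto_nhds] at h1
  filter_upwards [h1 (ε / 2) (half_pos hε), hC] with i hi hCi
  rw [Real.dist_eq, sub_zero] at hi ⊢
  rw [abs_of_nonneg (integral_nonneg fun x => abs_nonneg _)]
  have hwi := hw i
  have hle : ∫ x, |w i x| ∂muQ d ≤ ∫ x, (min |w i x| K + w i x ^ 2 / K) ∂muQ d := by
    refine integral_mono (cont_int (by fun_prop)) (cont_int (by fun_prop)) fun x => ?_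
    rcases le_total |w i x| K with h | h
    · simp only [min_eq_left h]
      have : 0 ≤ w i x ^ 2 / K := by positivity
      linarith
    · simp only [min_eq_right h]
      have : |w i x| ≤ w i x ^ 2 / K := by
        rw [le_div_iff₀ hKpos, ← sq_abs, sq]
        exact mul_le_mul_of_nonneg_left h (abs_nonneg _)
      linarith
  rw [integral_add (cont_int (by fun_prop)) (cont_int (by fun_prop)), integral_div] at hle
  have h3 : (∫ x, w i x ^ 2 ∂muQ d) / K < ε / 2 := by
    rw [div_lt_iff₀ hKpos]
    have : ε / 2 * K = |C| + 1 := by rw [hK]; field_simp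
    rw [this]
    linarith [le_abs_self C]
  have h4 := (le_abs_self _).trans_lt hi
  linarith

end partC2

section partD

/-- abstract form of the flow. -/
structure Sys (d : ℕ) where
  κ : ℝ
  hκ : 0 < κ
  ρ : ℝ
  hρ : 0 < ρ
  h : (Fin d → ℝ) → (Fin d → ℝ) → ℝ
  b : (Fin d → ℝ) → (Fin d → ℝ) → (Fin d → ℝ)
  m : ℝ → (Fin d → ℝ) → ℝ
  u : ℝ → (Fin d → ℝ) → ℝ
  hb : ℝ → ℝ
  h_cont : Continuous (Function.uncurry h)
  b_C1 : ContDiff ℝ 1 (Function.uncurry b)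
  h_per : ∀ (z : Fin d → ℤ) (x q : Fin d → ℝ), h (x + fun i => (z i : ℝ)) q = h x q
  b_per : ∀ (z : Fin d → ℤ) (x q : Fin d → ℝ), b (x + fun i => (z i : ℝ)) q = b x q
  conv : ∀ x p q, h x p + dot (b x p) (q - p) + ρ / 2 * nsq (q - p) ≤ h x q
  c : ℝ
  hc : 0 < c
  K : ℝ
  hK : 0 ≤ K
  h_low : ∀ x q, c * nsq q - K ≤ h x q
  h_up : ∀ x q, h x q ≤ K * (1 + nsq q)
  b_up : ∀ x q, nsq (b x q) ≤ K * (1 + nsq q)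
  m_reg : ∀ t, ContDiff ℝ 1 (m t)
  m_per : ∀ t, ZPeriodic (m t)
  m_pos : ∀ t x, 0 < m t x
  u_reg : ∀ t, ContDiff ℝ 2 (u t)
  u_per : ∀ t, ZPeriodic (u t)
  m_tcont : ∀ x, Continuous fun t => m t x
  u_tcont : ∀ x, Continuous fun t => u t x
  m_der : ∀ t, 0 ≤ t → ∀ x, HasDerivWithinAt (fun s => m s x)
    (m t x * (h x (pgrad (u t) x) - hb t - κ * Real.log (m t x))) (Set.Ioi t) t
  u_der : ∀ t, 0 ≤ t → ∀ x, HasDerivWithinAt (fun s => u s x)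
    (pdiv (fun y => m t y • b y (pgrad (u t) y)) x) (Set.Ioi t) t
  hb_eq : ∀ t, hb t = (∫ y, m t y * (h y (pgrad (u t) y) - κ * Real.log (m t y)) ∂muQ d)
    / ∫ y, m t y ∂muQ d

namespace Sys

variable {d : ℕ} (S : Sys d)

noncomputable def l (t : ℝ) (x : Fin d → ℝ) : ℝ := Real.log (S.m t x)
noncomputable def Du (t : ℝ) (x : Fin d → ℝ) : Fin d → ℝ := pgrad (S.u t) x
noncomputable def hh (t : ℝ) (x : Fin d → ℝ) : ℝ := S.h x (S.Du t x)
noncomputable def F (t : ℝ) (x : Fin d → ℝ) : Fin d → ℝ := S.m t x • S.b x (S.Du t x)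
noncomputable def g (t : ℝ) (x : Fin d → ℝ) : ℝ := S.hh t x - S.hb t - S.κ * S.l t x

lemma u_C1 (t : ℝ) : ContDiff ℝ 1 (S.u t) := (S.u_reg t).of_le (by norm_num)
lemma m_cont (t : ℝ) : Continuous (S.m t) := (S.m_reg t).continuous
lemma u_cont (t : ℝ) : Continuous (S.u t) := (S.u_C1 t).continuous
lemma l_cont (t : ℝ) : Continuous (S.l t) :=
  (S.m_cont t).log fun x => (S.m_pos t x).ne'
lemma l_tcont (x : Fin d → ℝ) : Continuous fun t => S.l t x :=
  (S.m_tcont x).log fun t => (S.m_pos t x).ne'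
lemma Du_C1 (t : ℝ) : ContDiff ℝ 1 (S.Du t) := by
  refine contDiff_pi.2 fun i => ?_
  have : ContDiff ℝ 1 (fderiv ℝ (S.u t)) := (S.u_reg t).fderiv_right (by norm_num)
  exact this.clm_apply contDiff_const
lemma Du_cont (t : ℝ) : Continuous (S.Du t) := (S.Du_C1 t).continuous
lemma Du_per (t : ℝ) (z : Fin d → ℤ) (x : Fin d → ℝ) :
    S.Du t (x + fun i => (z i : ℝ)) = S.Du t x := per_pgrad (S.u_per t) z x
lemma hh_cont (t : ℝ) : Continuous (S.hh t) :=
  S.h_cont.comp (continuous_id.prodMk (S.Du_cont t))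
lemma F_C1 (t : ℝ) : ContDiff ℝ 1 (S.F t) :=
  (S.m_reg t).smul (S.b_C1.comp (contDiff_id.prodMk (S.Du_C1 t)))
lemma F_cont (t : ℝ) : Continuous (S.F t) := (S.F_C1 t).continuous
lemma F_per (t : ℝ) (z : Fin d → ℤ) (x : Fin d → ℝ) :
    S.F t (x + fun i => (z i : ℝ)) = S.F t x := by
  simp only [F, S.m_per t z x, S.Du_per, S.b_per]
lemma l_per (t : ℝ) : ZPeriodic (S.l t) := fun z x => by simp only [l, S.m_per t z x]
lemma hh_per (t : ℝ) : ZPeriodic (S.hh t) := fun z x => by simp only [hh, S.Du_per, S.h_per]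

lemma l_der {t : ℝ} (ht : 0 ≤ t) (x : Fin d → ℝ) :
    HasDerivWithinAt (fun s => S.l s x) (S.g t x) (Set.Ioi t) t := by
  have h := (S.m_der t ht x).log (S.m_pos t x).ne'
  have e : S.m t x * (S.h x (pgrad (S.u t) x) - S.hb t - S.κ * Real.log (S.m t x)) / S.m t x
      = S.g t x := by
    have := (S.m_pos t x).ne'
    rw [mul_div_cancel_left₀ _ this]; rfl
  rwa [e] at h

lemma u_der' {t : ℝ} (ht : 0 ≤ t) (x : Fin d → ℝ) :
    HasDerivWithinAt (fun s => S.u s x) (pdiv (S.F t) x) (Set.Ioi t) t := S.u_der t ht x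

/-! measurability -/

lemma meas_u : Measurable (Function.uncurry S.u) :=
  measurable_uncurry_of_continuous_of_measurable (u := S.u) S.u_tcont
    (fun t => (S.u_cont t).measurable)

lemma meas_m : Measurable (Function.uncurry S.m) :=
  measurable_uncurry_of_continuous_of_measurable (u := S.m) S.m_tcont
    (fun t => (S.m_cont t).measurable)

lemma meas_l : Measurable (Function.uncurry S.l) :=
  measurable_uncurry_of_continuous_of_measurable (u := S.l) S.l_tcont
    (fun t => (S.l_cont t).measurable)

lemma meas_Dui (i : Fin d) : Measurable fun p : ℝ × (Fin d → ℝ) => S.Du p.1 p.2 i := by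
  have hlim : ∀ p : ℝ × (Fin d → ℝ), Tendsto (fun n : ℕ => ((n : ℝ) + 1) •
      (S.u p.1 (p.2 + ((n : ℝ) + 1)⁻¹ • Pi.single i (1 : ℝ)) - S.u p.1 p.2)) atTop
      (nhds (S.Du p.1 p.2 i)) := by
    rintro ⟨t, x⟩
    have hd : HasFDerivAt (S.u t) (fderiv ℝ (S.u t) x) x :=
      ((S.u_C1 t).differentiable (by norm_num) x).hasFDerivAt
    have hn : Tendsto (fun n : ℕ => ‖(n : ℝ) + 1‖) atTop atTop :=
      tendsto_norm_atTop_atTop.comp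
        (tendsto_atTop_add_const_right _ _ tendsto_natCast_atTop_atTop)
    have := hd.lim (Pi.single i (1 : ℝ)) hn
    simpa only [Du, pgrad] using this
  refine measurable_of_tendsto_metrizable (fun n => ?_) (tendsto_pi_nhds.2 hlim)
  have h1 : Measurable fun p : ℝ × (Fin d → ℝ) =>
      S.u p.1 (p.2 + ((n : ℝ) + 1)⁻¹ • Pi.single i (1 : ℝ)) :=
    S.meas_u.comp (measurable_fst.prodMk (measurable_snd.add_const _))
  exact (h1.sub S.meas_u).const_smul ((n : ℝ) + 1)

lemma meas_Du : Measurable (Function.uncurry S.Du) :=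
  measurable_pi_lambda _ fun i => S.meas_Dui i

lemma meas_hh : Measurable (Function.uncurry S.hh) :=
  S.h_cont.measurable.comp (measurable_snd.prodMk S.meas_Du)

lemma meas_F : Measurable (Function.uncurry S.F) :=
  S.meas_m.smul (S.b_C1.continuous.measurable.comp (measurable_snd.prodMk S.meas_Du))

lemma meas_hb : Measurable S.hb := by
  have e : S.hb = fun t => (∫ y, S.m t y * (S.hh t y - S.κ * S.l t y) ∂muQ d)
    / ∫ y, S.m t y ∂muQ d := funext S.hb_eq
  rw [e]
  have h1 : Measurable (Function.uncurry fun t y => S.m t y * (S.hh t y - S.κ * S.l t y)) :=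
    S.meas_m.mul (S.meas_hh.sub (S.meas_l.const_mul _))
  exact (h1.stronglyMeasurable.integral_prod_right (ν := muQ d)).measurable.div
    (S.meas_m.stronglyMeasurable.integral_prod_right (ν := muQ d)).measurable

lemma meas_g : Measurable (Function.uncurry S.g) :=
  (S.meas_hh.sub (S.meas_hb.comp measurable_fst)).sub (S.meas_l.const_mul _)

lemma meas_nsqDu : Measurable (Function.uncurry fun t x => nsq (S.Du t x)) :=
  continuous_nsq.measurable.comp S.meas_Du

lemma meas_nsqF : Measurable (Function.uncurry fun t x => nsq (S.F t x)) :=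
  continuous_nsq.measurable.comp S.meas_F

lemma mass_pos (t : ℝ) : 0 < ∫ y, S.m t y ∂muQ d := by
  rw [integral_pos_iff_support_of_nonneg (fun y => (S.m_pos t y).le) (cont_int (S.m_cont t))]
  have : Function.support (S.m t) = Set.univ := Set.eq_univ_of_forall fun y => (S.m_pos t y).ne'
  rw [this]; simp

/-- the defining property of the multiplier. -/
lemma int_mg (t : ℝ) : ∫ y, S.m t y * S.g t y ∂muQ d = 0 := by
  have e : ∀ y, S.m t y * S.g t y
      = S.m t y * (S.hh t y - S.κ * S.l t y) - S.hb t * S.m t y := fun y => by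
    simp only [g]; ring
  have hm := S.m_cont t
  have hl := S.l_cont t
  have hhc := S.hh_cont t
  simp only [e]
  rw [integral_sub (cont_int (by fun_prop)) (cont_int (by fun_prop)), integral_const_mul,
    S.hb_eq t, div_mul_cancel₀ _ (S.mass_pos t).ne']
  exact sub_self _

end Sys

end partD

section partD2

namespace Sys

variable {d : ℕ} (S : Sys d)

lemma hh_low (t : ℝ) (x : Fin d → ℝ) : -S.K ≤ S.hh t x := by
  have := S.h_low x (S.Du t x)
  have h2 := mul_nonneg S.hc.le (nsq_nonneg (S.Du t x))
  simp only [hh]; linarith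

lemma hh_abs (t : ℝ) (x : Fin d → ℝ) : |S.hh t x| ≤ S.K * (1 + nsq (S.Du t x)) := by
  rw [abs_le]
  refine ⟨?_, S.h_up x (S.Du t x)⟩
  have := S.hh_low t x
  have h2 := mul_nonneg S.hK (nsq_nonneg (S.Du t x))
  linarith

lemma hb_ge {t A : ℝ} (hA : ∀ x, A ≤ S.hh t x - S.κ * S.l t x) : A ≤ S.hb t := by
  have e : S.hb t = (∫ y, S.m t y * (S.hh t y - S.κ * S.l t y) ∂muQ d)
    / ∫ y, S.m t y ∂muQ d := S.hb_eq t
  have hm := S.m_cont t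
  have hl := S.l_cont t
  have hhc := S.hh_cont t
  rw [e, le_div_iff₀ (S.mass_pos t), ← integral_const_mul]
  refine integral_mono (cont_int (by fun_prop)) (cont_int (by fun_prop)) fun x => ?_
  have := mul_le_mul_of_nonneg_left (hA x) (S.m_pos t x).le
  simp only
  linarith

lemma exp_le_exp_of (κ : ℝ) (hκ : 0 < κ) {t b : ℝ} (h : t ≤ b) :
    Real.exp (κ * t) ≤ Real.exp (κ * b) := Real.exp_le_exp.2 (by nlinarith)

lemma one_le_exp_of (κ : ℝ) (hκ : 0 < κ) {t : ℝ} (h : 0 ≤ t) :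
    1 ≤ Real.exp (κ * t) := Real.one_le_exp (by positivity)

lemma exp_l_der {t : ℝ} (ht : 0 ≤ t) (x : Fin d → ℝ) :
    HasDerivWithinAt (fun s => Real.exp (S.κ * s) * S.l s x)
      (Real.exp (S.κ * t) * (S.hh t x - S.hb t)) (Set.Ioi t) t := by
  have h1 : HasDerivWithinAt (fun s => Real.exp (S.κ * s)) (Real.exp (S.κ * t) * S.κ)
      (Set.Ioi t) t := by
    have := (((hasDerivAt_id t).const_mul S.κ).exp).hasDerivWithinAt (s := Set.Ioi t)
    simpa using this
  have h2 := h1.mul (S.l_der ht x)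
  refine h2.congr_deriv ?_
  simp only [g]; ring

lemma exp_l_cont (x : Fin d → ℝ) : Continuous fun s => Real.exp (S.κ * s) * S.l s x := by
  have := S.l_tcont x
  fun_prop

lemma G1a {a b : ℝ} (ha : 0 ≤ a) (hab : a ≤ b) (x0 : Fin d → ℝ)
    (hI : IntegrableOn (fun t => nsq (S.Du t x0)) (Set.Icc a b)) :
    IntegrableOn S.hb (Set.Icc a b) := by
  obtain ⟨M, hM⟩ := per_bdd (S.l_per b) (S.l_cont b)
  obtain ⟨M', hM'⟩ := (isCompact_Icc (a := a) (b := b)).exists_bound_of_continuousOn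
    (S.l_tcont x0).continuousOn
  set ψ : ℝ → ℝ := fun t => Real.exp (S.κ * b) * (2 * S.K + S.K * nsq (S.Du t x0)) with hψ
  have hψi : IntegrableOn ψ (Set.Icc a b) := by
    have h1 : IntegrableOn (fun _ : ℝ => 2 * S.K) (Set.Icc a b) := continuous_const.integrableOn_Icc
    exact (h1.add (hI.const_mul S.K)).const_mul _
  have hK := S.hK
  have hκ := S.hκ
  have hψ0 : ∀ t, 0 ≤ ψ t := fun t => by
    have := nsq_nonneg (S.Du t x0)
    simp only [hψ]; positivity
  set I := ∫ t in a..b, ψ t with hIdef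
  have hI0 : 0 ≤ I := intervalIntegral.integral_nonneg hab fun t _ => hψ0 t
  have hM0 : 0 ≤ M := (abs_nonneg _).trans (hM x0)
  set N := M' + (Real.exp (S.κ * b) * (2 * M) + I) with hN
  have hl : ∀ t ∈ Set.Icc a b, ∀ x, S.l t x ≤ N := by
    intro t ht x
    have ht0 : 0 ≤ t := ha.trans ht.1
    have key := intervalIntegral.integral_le_sub_of_hasDeriv_right_of_le (a := t) (b := b)
      (g := fun s => Real.exp (S.κ * s) * S.l s x - Real.exp (S.κ * s) * S.l s x0)
      (g' := fun s => Real.exp (S.κ * s) * (S.hh s x - S.hb s)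
        - Real.exp (S.κ * s) * (S.hh s x0 - S.hb s))
      (φ := fun s => - ψ s) ht.2
      ((S.exp_l_cont x).sub (S.exp_l_cont x0)).continuousOn
      (fun s hs => (S.exp_l_der (ht0.trans hs.1.le) x).sub (S.exp_l_der (ht0.trans hs.1.le) x0))
      ((hψi.mono_set (Set.Icc_subset_Icc_left ht.1)).neg) ?_
    · rw [intervalIntegral.integral_neg] at key
      have h1 : ∫ s in t..b, ψ s ≤ I := by
        refine intervalIntegral.integral_mono_interval ht.1 ht.2 le_rfl
          (Eventually.of_forall hψ0) ?_
        exact (intervalIntegrable_iff_integrableOn_Icc_of_le hab).2 hψi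
      have h2 := abs_le.1 (hM x)
      have h3 := abs_le.1 (hM x0)
      have h4 := abs_le.1 (hM' t ht)
      have eb := Real.exp_pos (S.κ * b)
      have h5 : Real.exp (S.κ * t) * (S.l t x - S.l t x0)
          ≤ Real.exp (S.κ * b) * (2 * M) + I := by nlinarith
      have h6 := one_le_exp_of S.κ hκ ht0
      have h7 : S.l t x - S.l t x0 ≤ Real.exp (S.κ * b) * (2 * M) + I := by
        by_cases hneg : S.l t x - S.l t x0 ≤ 0
        · have : 0 ≤ Real.exp (S.κ * b) * (2 * M) + I := by positivity
          linarith
        · nlinarith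
      linarith
    · intro s hs
      have e1 := exp_le_exp_of S.κ hκ hs.2.le
      have e2 := Real.exp_pos (S.κ * s)
      have l1 := S.hh_low s x
      have l2 := (abs_le.1 (S.hh_abs s x0)).2
      have l3 := nsq_nonneg (S.Du s x0)
      have l4 : 0 ≤ 2 * S.K + S.K * nsq (S.Du s x0) := by positivity
      have l5 : -(2 * S.K + S.K * nsq (S.Du s x0)) ≤ S.hh s x - S.hh s x0 := by linarith
      simp only [hψ]
      have := mul_le_mul_of_nonneg_right e1 l4
      have := mul_le_mul_of_nonneg_left l5 e2.le
      linarith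
  have hbl : ∀ t ∈ Set.Icc a b, -S.K - S.κ * N ≤ S.hb t := fun t ht => by
    refine S.hb_ge fun x => ?_
    have := S.hh_low t x
    have := mul_le_mul_of_nonneg_left (hl t ht x) hκ.le
    linarith
  have hmx : ∀ {f : ℝ → (Fin d → ℝ) → ℝ}, Measurable (Function.uncurry f) →
      Measurable fun t => f t x0 := fun hf => hf.comp measurable_prodMk_right
  have hhi : IntegrableOn (fun t => S.hh t x0) (Set.Icc a b) := by
    have h1 : IntegrableOn (fun t : ℝ => S.K * (1 + nsq (S.Du t x0))) (Set.Icc a b) := by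
      have h1 : IntegrableOn (fun _ : ℝ => (1 : ℝ)) (Set.Icc a b) := continuous_const.integrableOn_Icc
      exact (h1.add hI).const_mul _
    refine h1.mono' (hmx S.meas_hh).aestronglyMeasurable ?_
    exact Eventually.of_forall fun t => S.hh_abs t x0
  have hli : IntegrableOn (fun t => S.l t x0) (Set.Icc a b) :=
    (S.l_tcont x0).integrableOn_Icc
  have hg : IntegrableOn (fun t => S.g t x0) (Set.Icc a b) := by
    refine int_of_deriv_le hab (f := fun t => S.l t x0)
      (ψ := fun t => S.hh t x0 - S.κ * S.l t x0 + (S.K + S.κ * N))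
      (S.l_tcont x0).continuousOn (fun t ht => S.l_der (ha.trans ht.1.le) x0)
      (hmx S.meas_g).aestronglyMeasurable ?_ ?_
    · have h1 : IntegrableOn (fun _ : ℝ => S.K + S.κ * N) (Set.Icc a b) := continuous_const.integrableOn_Icc
      exact (hhi.sub (hli.const_mul _)).add h1
    · intro t ht
      have := hbl t ⟨ht.1.le, ht.2.le⟩
      simp only [g]; linarith
  have : S.hb = fun t => S.hh t x0 - S.κ * S.l t x0 - S.g t x0 := by
    funext t; simp only [g]; ring
  rw [this]
  exact (hhi.sub (hli.const_mul _)).sub hg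

lemma G1b {a b : ℝ} (ha : 0 ≤ a) (hab : a ≤ b) (hI : IntegrableOn S.hb (Set.Icc a b)) :
    ∃ N, 0 ≤ N ∧ (∀ t ∈ Set.Icc a b, ∀ x, |S.l t x| ≤ N) ∧
      ∀ x, IntegrableOn (fun t => nsq (S.Du t x)) (Set.Icc a b) ∧
        ∫ t in Set.Icc a b, nsq (S.Du t x) ≤ N := by
  obtain ⟨M1, hM1⟩ := per_bdd (S.l_per a) (S.l_cont a)
  obtain ⟨M2, hM2⟩ := per_bdd (S.l_per b) (S.l_cont b)
  have hK := S.hK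
  have hκ := S.hκ
  have hc := S.hc
  set E := Real.exp (S.κ * b) with hE
  have hE0 : 0 < E := Real.exp_pos _
  set ψ : ℝ → ℝ := fun t => E * (S.K + |S.hb t|) with hψ
  have hψi : IntegrableOn ψ (Set.Icc a b) := by
    have h1 : IntegrableOn (fun _ : ℝ => S.K) (Set.Icc a b) := continuous_const.integrableOn_Icc
    exact (h1.add hI.abs).const_mul _
  have hψ0 : ∀ t, 0 ≤ ψ t := fun t => by simp only [hψ]; positivity
  set I := ∫ t in a..b, ψ t with hIdef
  have hI0 : 0 ≤ I := intervalIntegral.integral_nonneg hab fun t _ => hψ0 t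
  have hψii : IntervalIntegrable ψ volume a b :=
    (intervalIntegrable_iff_integrableOn_Icc_of_le hab).2 hψi
  have h10 : 0 ≤ M1 := (abs_nonneg _).trans (hM1 0)
  have h20 : 0 ≤ M2 := (abs_nonneg _).trans (hM2 0)
  have hder : ∀ t ∈ Set.Icc a b, ∀ x,
      c S * nsq (S.Du t x) ≤ Real.exp (S.κ * t) * (S.hh t x - S.hb t) + ψ t := by
    intro t ht x
    have ht0 : 0 ≤ t := ha.trans ht.1
    have e1 : Real.exp (S.κ * t) ≤ E := exp_le_exp_of S.κ hκ ht.2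
    have e2 := one_le_exp_of S.κ hκ ht0
    have l1 : S.c * nsq (S.Du t x) - S.K ≤ S.hh t x := S.h_low x _
    have l2 : 0 ≤ S.c * nsq (S.Du t x) := mul_nonneg hc.le (nsq_nonneg _)
    have l3 := le_abs_self (S.hb t)
    have l4 : 0 ≤ S.K + |S.hb t| := by positivity
    have a1 := mul_le_mul_of_nonneg_right e1 l4
    have a2 := mul_le_mul_of_nonneg_right e2 l2
    have a3 : Real.exp (S.κ * t) * (S.c * nsq (S.Du t x)) ≤
      Real.exp (S.κ * t) * (S.hh t x - S.hb t + (S.K + |S.hb t|)) :=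
      mul_le_mul_of_nonneg_left (by linarith) (by positivity)
    simp only [hψ]
    linarith
  have hmono : ∀ s ∈ Set.Icc a b, ∀ t ∈ Set.Icc a b, s ≤ t → ∀ x,
      -I ≤ Real.exp (S.κ * t) * S.l t x - Real.exp (S.κ * s) * S.l s x := by
    intro s hs t ht hst x
    have hs0 : 0 ≤ s := ha.trans hs.1
    have key := intervalIntegral.integral_le_sub_of_hasDeriv_right_of_le (a := s) (b := t)
      (g := fun s => Real.exp (S.κ * s) * S.l s x)
      (g' := fun s => Real.exp (S.κ * s) * (S.hh s x - S.hb s))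
      (φ := fun s => - ψ s) hst
      (S.exp_l_cont x).continuousOn
      (fun r hr => S.exp_l_der (hs0.trans hr.1.le) x)
      ((hψi.mono_set (Set.Icc_subset_Icc hs.1 ht.2)).neg)
      (fun r hr => by
        have := hder r ⟨hs.1.trans hr.1.le, hr.2.le.trans ht.2⟩ x
        have := mul_nonneg hc.le (nsq_nonneg (S.Du r x))
        linarith)
    rw [intervalIntegral.integral_neg] at key
    have h1 : ∫ r in s..t, ψ r ≤ I :=
      intervalIntegral.integral_mono_interval hs.1 hst ht.2 (Eventually.of_forall hψ0) hψii
    linarith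
  set A := E * M1 + E * M2 + I with hA
  have hA0 : 0 ≤ A := by positivity
  have hexpab : Real.exp (S.κ * a) ≤ E := exp_le_exp_of S.κ hκ hab
  have hya : ∀ x, |Real.exp (S.κ * a) * S.l a x| ≤ E * M1 := fun x => by
    rw [abs_mul, abs_of_pos (Real.exp_pos _)]
    exact mul_le_mul hexpab (hM1 x) (abs_nonneg _) hE0.le
  have hyb : ∀ x, |E * S.l b x| ≤ E * M2 := fun x => by
    rw [abs_mul, abs_of_pos hE0]
    exact mul_le_mul_of_nonneg_left (hM2 x) hE0.le
  have p1 : 0 ≤ E * M1 := by positivity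
  have p2 : 0 ≤ E * M2 := by positivity
  have hy : ∀ t ∈ Set.Icc a b, ∀ x, |Real.exp (S.κ * t) * S.l t x| ≤ A := by
    intro t ht x
    have h1 := hmono a ⟨le_rfl, hab⟩ t ht ht.1 x
    have h2 := hmono t ht b ⟨hab, le_rfl⟩ ht.2 x
    have h3 := abs_le.1 (hya x)
    have h4 := abs_le.1 (hyb x)
    rw [abs_le]
    constructor <;> linarith
  have hl : ∀ t ∈ Set.Icc a b, ∀ x, |S.l t x| ≤ A := by
    intro t ht x
    have h1 := hy t ht x
    have h2 := one_le_exp_of S.κ hκ (ha.trans ht.1)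
    rw [abs_mul, abs_of_pos (Real.exp_pos _)] at h1
    nlinarith [abs_nonneg (S.l t x)]
  refine ⟨A + (2 * A + I) / S.c, by positivity, fun t ht x => (hl t ht x).trans ?_, fun x => ?_⟩
  · have : 0 ≤ (2 * A + I) / S.c := by positivity
    linarith
  have hmx : ∀ {f : ℝ → (Fin d → ℝ) → ℝ}, Measurable (Function.uncurry f) →
      Measurable fun t => f t x := fun hf => hf.comp measurable_prodMk_right
  have hmy : Measurable fun t => Real.exp (S.κ * t) * (S.hh t x - S.hb t) := by
    have h1 := hmx S.meas_hh
    have h2 := S.meas_hb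
    fun_prop
  have hyi : IntegrableOn (fun t => -(Real.exp (S.κ * t) * (S.hh t x - S.hb t)))
      (Set.Icc a b) := by
    refine int_of_deriv_le hab (f := fun t => -(Real.exp (S.κ * t) * S.l t x)) (ψ := ψ)
      (S.exp_l_cont x).neg.continuousOn
      (fun t ht => (S.exp_l_der (ha.trans ht.1.le) x).neg)
      hmy.neg.aestronglyMeasurable hψi fun t ht => ?_
    have := hder t ⟨ht.1.le, ht.2.le⟩ x
    have := mul_nonneg hc.le (nsq_nonneg (S.Du t x))
    linarith
  have hyi' : IntegrableOn (fun t => Real.exp (S.κ * t) * (S.hh t x - S.hb t))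
      (Set.Icc a b) := by simpa using hyi.neg
  have hni : IntegrableOn (fun t => S.c * nsq (S.Du t x)) (Set.Icc a b) := by
    refine (hyi'.add hψi).mono' ((hmx S.meas_nsqDu).const_mul _).aestronglyMeasurable ?_
    refine (ae_restrict_iff' measurableSet_Icc).2 (Eventually.of_forall fun t ht => ?_)
    rw [Real.norm_eq_abs, abs_of_nonneg (mul_nonneg hc.le (nsq_nonneg (S.Du t x)))]
    exact hder t ht x
  have hni' : IntegrableOn (fun t => nsq (S.Du t x)) (Set.Icc a b) := by
    have := hni.const_mul (S.c)⁻¹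
    refine this.congr (Eventually.of_forall fun t => ?_)
    simp only
    field_simp
  refine ⟨hni', ?_⟩
  have k1 : S.c * ∫ t in Set.Icc a b, nsq (S.Du t x)
      ≤ (∫ t in Set.Icc a b, Real.exp (S.κ * t) * (S.hh t x - S.hb t))
        + ∫ t in Set.Icc a b, ψ t := by
    rw [← integral_const_mul, ← integral_add hyi' hψi]
    exact setIntegral_mono_on hni (hyi'.add hψi) measurableSet_Icc fun t ht => hder t ht x
  have k2 := intervalIntegral.integral_le_sub_of_hasDeriv_right_of_le (a := a) (b := b)
      (g := fun s => Real.exp (S.κ * s) * S.l s x)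
      (g' := fun s => Real.exp (S.κ * s) * (S.hh s x - S.hb s))
      (φ := fun s => Real.exp (S.κ * s) * (S.hh s x - S.hb s)) hab
      (S.exp_l_cont x).continuousOn
      (fun r hr => S.exp_l_der (ha.trans hr.1.le) x) hyi' (fun r _ => le_rfl)
  rw [intervalIntegral.integral_of_le hab, ← integral_Icc_eq_integral_Ioc] at k2
  rw [hIdef, intervalIntegral.integral_of_le hab, ← integral_Icc_eq_integral_Ioc] at *
  have k3 := abs_le.1 (hy a ⟨le_rfl, hab⟩ x)
  have k4 := abs_le.1 (hy b ⟨hab, le_rfl⟩ x)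
  have k5 : ∫ t in Set.Icc a b, nsq (S.Du t x) ≤ (2 * A + ∫ t in Set.Icc a b, ψ t) / S.c := by
    rw [le_div_iff₀ hc]
    linarith
  linarith

end Sys

end partD2

section partD3

namespace Sys

variable {d : ℕ} (S : Sys d)

/-- the product measure over a time interval. -/
noncomputable def pm (d : ℕ) (a b : ℝ) : Measure (ℝ × (Fin d → ℝ)) :=
  (volume.restrict (Set.Icc a b)).prod (muQ d)

instance pm_finite (a b : ℝ) : IsFiniteMeasure (pm d a b) := by unfold pm; infer_instance

lemma ae_pm (a b : ℝ) : ∀ᵐ p ∂(pm d a b), p.1 ∈ Set.Icc a b :=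
  Measure.quasiMeasurePreserving_fst.ae (ae_restrict_mem measurableSet_Icc)

lemma pm_nsqDu {a b : ℝ} (ha : 0 ≤ a) (hab : a ≤ b) (hI : IntegrableOn S.hb (Set.Icc a b)) :
    Integrable (Function.uncurry fun t x => nsq (S.Du t x)) (pm d a b) := by
  obtain ⟨N, hN0, -, hN⟩ := S.G1b ha hab hI
  refine (MeasureTheory.integrable_prod_iff' S.meas_nsqDu.aestronglyMeasurable).2 ⟨?_, ?_⟩
  · exact Eventually.of_forall fun x => (hN x).1
  · refine Integrable.of_bound (C := N) ?_ (Eventually.of_forall fun x => ?_)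
    · have : StronglyMeasurable (Function.uncurry fun (x : Fin d → ℝ) (t : ℝ) =>
          ‖nsq (S.Du t x)‖) :=
        (S.meas_nsqDu.norm.comp measurable_swap).stronglyMeasurable
      exact (this.integral_prod_right (ν := volume.restrict (Set.Icc a b))).aestronglyMeasurable
    · rw [Real.norm_of_nonneg (integral_nonneg fun t => norm_nonneg _)]
      simp only [Function.uncurry, Real.norm_of_nonneg (nsq_nonneg _)]
      exact (hN x).2

lemma pm_time {a b : ℝ} {f : ℝ → ℝ} (hf : IntegrableOn f (Set.Icc a b)) :
    Integrable (fun p : ℝ × (Fin d → ℝ) => f p.1) (pm d a b) :=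
  Integrable.comp_fst hf (muQ d)

lemma pm_u2 {a b : ℝ} (C : ℝ) (hC : ∀ t ∈ Set.Icc a b, ∫ x, S.u t x ^ 2 ∂muQ d ≤ C) :
    Integrable (Function.uncurry fun t x => S.u t x ^ 2) (pm d a b) := by
  have hm : Measurable (Function.uncurry fun t x => S.u t x ^ 2) := S.meas_u.pow_const 2
  refine (MeasureTheory.integrable_prod_iff hm.aestronglyMeasurable).2 ⟨?_, ?_⟩
  · exact Eventually.of_forall fun t => cont_int ((S.u_cont t).pow 2)
  · refine Integrable.of_bound (C := C) ?_ ?_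
    · exact (hm.norm.stronglyMeasurable.integral_prod_right (ν := muQ d)).aestronglyMeasurable
    · refine (ae_restrict_iff' measurableSet_Icc).2 (Eventually.of_forall fun t ht => ?_)
      rw [Real.norm_of_nonneg (integral_nonneg fun t => norm_nonneg _)]
      simp only [Function.uncurry, Real.norm_of_nonneg (sq_nonneg _)]
      exact hC t ht

/-- domination by the energy density. -/
lemma pm_dom {a b : ℝ} (ha : 0 ≤ a) (hab : a ≤ b) (hI : IntegrableOn S.hb (Set.Icc a b))
    {f : ℝ → (Fin d → ℝ) → ℝ} (hf : Measurable (Function.uncurry f)) (A : ℝ)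
    (hA : ∀ t ∈ Set.Icc a b, ∀ x, |f t x| ≤ A * (1 + |S.hb t| + nsq (S.Du t x))) :
    Integrable (Function.uncurry f) (pm d a b) := by
  have h1 : Integrable (fun p : ℝ × (Fin d → ℝ) => A * (1 + |S.hb p.1| + nsq (S.Du p.1 p.2)))
      (pm d a b) :=
    (((integrable_const 1).add (pm_time hI.abs)).add (S.pm_nsqDu ha hab hI)).const_mul A
  refine h1.mono' hf.aestronglyMeasurable ?_
  filter_upwards [ae_pm a b] with p hp
  exact hA p.1 hp p.2

lemma pm_dom' {a b : ℝ} (ha : 0 ≤ a) (hab : a ≤ b) (hI : IntegrableOn S.hb (Set.Icc a b))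
    (C : ℝ) (hC : ∀ t ∈ Set.Icc a b, ∫ x, S.u t x ^ 2 ∂muQ d ≤ C)
    {f : ℝ → (Fin d → ℝ) → ℝ} (hf : Measurable (Function.uncurry f)) (A : ℝ)
    (hA : ∀ t ∈ Set.Icc a b, ∀ x, |f t x| ≤ A * (1 + nsq (S.Du t x) + S.u t x ^ 2)) :
    Integrable (Function.uncurry f) (pm d a b) := by
  have h1 : Integrable (fun p : ℝ × (Fin d → ℝ) => A * (1 + nsq (S.Du p.1 p.2)
      + S.u p.1 p.2 ^ 2)) (pm d a b) :=
    (((integrable_const 1).add (S.pm_nsqDu ha hab hI)).add (S.pm_u2 C hC)).const_mul A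
  refine h1.mono' hf.aestronglyMeasurable ?_
  filter_upwards [ae_pm a b] with p hp
  exact hA p.1 hp p.2

lemma m_eq (t : ℝ) (x : Fin d → ℝ) : S.m t x = Real.exp (S.l t x) :=
  (Real.exp_log (S.m_pos t x)).symm

lemma nsqF_le {N t : ℝ} {x : Fin d → ℝ} (h : |S.l t x| ≤ N) :
    nsq (S.F t x) ≤ Real.exp (2 * N) * S.K * (1 + nsq (S.Du t x)) := by
  simp only [F, nsq_smul]
  have h1 : S.m t x ^ 2 ≤ Real.exp (2 * N) := by
    rw [S.m_eq, ← Real.exp_nat_mul]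
    refine Real.exp_le_exp.2 ?_
    have := (abs_le.1 h).2
    push_cast; linarith
  have h2 := S.b_up x (S.Du t x)
  have := mul_le_mul h1 h2 (nsq_nonneg _) (Real.exp_pos _).le
  linarith

lemma pm_nsqF {a b : ℝ} (ha : 0 ≤ a) (hab : a ≤ b) (hI : IntegrableOn S.hb (Set.Icc a b)) :
    Integrable (Function.uncurry fun t x => nsq (S.F t x)) (pm d a b) := by
  obtain ⟨N, hN0, hN, -⟩ := S.G1b ha hab hI
  refine S.pm_dom ha hab hI S.meas_nsqF (Real.exp (2 * N) * S.K) fun t ht x => ?_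
  rw [abs_of_nonneg (nsq_nonneg _)]
  refine (S.nsqF_le (hN t ht x)).trans ?_
  have := S.hK
  gcongr
  have := abs_nonneg (S.hb t)
  linarith

lemma pm_g {a b : ℝ} (ha : 0 ≤ a) (hab : a ≤ b) (hI : IntegrableOn S.hb (Set.Icc a b)) :
    Integrable (Function.uncurry S.g) (pm d a b) := by
  obtain ⟨N, hN0, hN, -⟩ := S.G1b ha hab hI
  refine S.pm_dom ha hab hI S.meas_g (S.K + 1 + S.κ * N) fun t ht x => ?_
  have h1 := S.hh_abs t x
  have h2 := hN t ht x
  have hκ := S.hκ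
  have hK := S.hK
  have h3 := nsq_nonneg (S.Du t x)
  have h4 := abs_nonneg (S.hb t)
  have h5 : |S.g t x| ≤ |S.hh t x| + |S.hb t| + S.κ * |S.l t x| := by
    have e : S.κ * |S.l t x| = |S.κ * S.l t x| := by rw [abs_mul, abs_of_pos hκ]
    rw [e]
    simp only [g]
    exact (abs_sub _ _).trans (by gcongr; exact abs_sub _ _)
  have h6 : S.κ * |S.l t x| ≤ S.κ * N := by gcongr
  have h7 : 0 ≤ S.κ * N := by positivity
  nlinarith [mul_nonneg hK h4, mul_nonneg h7 h4, mul_nonneg h7 h3]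

/-- identity for the logarithm against a fixed weight. -/
lemma int_l {s t : ℝ} (hs : 0 ≤ s) (hst : s ≤ t) (hI : IntegrableOn S.hb (Set.Icc s t))
    {w : (Fin d → ℝ) → ℝ} (hw : Continuous w) (hwp : ZPeriodic w) :
    (∫ x, w x * S.l t x ∂muQ d) - (∫ x, w x * S.l s x ∂muQ d)
      = ∫ τ in s..t, ∫ x, w x * S.g τ x ∂muQ d := by
  obtain ⟨W, hW⟩ := per_bdd hwp hw
  refine LM_full hst (G := fun τ x => w x * S.l τ x) (g := fun τ x => w x * S.g τ x)
    (fun x => (S.l_tcont x).const_mul _) (fun τ _ => cont_int (hw.mul (S.l_cont τ)))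
    (fun τ hτ x => (S.l_der (hs.trans hτ.1) x).const_mul _) ?_
  refine ((S.pm_g hs hst hI).bdd_mul (f := fun p : ℝ × (Fin d → ℝ) => w p.2) (c := W) ?_ ?_)
  · exact (hw.measurable.comp measurable_snd).aestronglyMeasurable
  · exact Eventually.of_forall fun p => hW p.2

lemma mass_const {s t : ℝ} (hs : 0 ≤ s) (hst : s ≤ t) (hI : IntegrableOn S.hb (Set.Icc s t)) :
    ∫ x, S.m t x ∂muQ d = ∫ x, S.m s x ∂muQ d := by
  obtain ⟨N, hN0, hN, -⟩ := S.G1b hs hst hI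
  have h := LM_full hst (G := S.m) (g := fun τ x => S.m τ x * S.g τ x)
    S.m_tcont (fun τ _ => cont_int (S.m_cont τ)) (fun τ hτ x => ?_) ?_
  · simp only [S.int_mg, intervalIntegral.integral_zero] at h
    linarith
  · exact S.m_der τ (hs.trans hτ.1) x
  · refine ((S.pm_g hs hst hI).bdd_mul (f := fun p : ℝ × (Fin d → ℝ) => S.m p.1 p.2)
      (c := Real.exp N) ?_ ?_)
    · exact S.meas_m.aestronglyMeasurable
    · filter_upwards [ae_pm s t] with p hp
      rw [Real.norm_of_nonneg (S.m_pos _ _).le, S.m_eq]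
      exact Real.exp_le_exp.2 (abs_le.1 (hN p.1 hp p.2)).2

/-- the flux tested against the gradient of `2χu + φ`. -/
noncomputable def q (χ φ : (Fin d → ℝ) → ℝ) (τ : ℝ) (x : Fin d → ℝ) : ℝ :=
  dot (S.F τ x) ((2 * χ x) • S.Du τ x + (2 * S.u τ x) • pgrad χ x + pgrad φ x)

/-- admissible test functions -/
def Tst (χ : (Fin d → ℝ) → ℝ) : Prop := ContDiff ℝ 1 χ ∧ ZPeriodic χ

def Idn (s t : ℝ) (χ φ : (Fin d → ℝ) → ℝ) : Prop :=
    (∫ x, (χ x * S.u t x ^ 2 + φ x * S.u t x) ∂muQ d)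
      - (∫ x, (χ x * S.u s x ^ 2 + φ x * S.u s x) ∂muQ d)
      = - ∫ τ in s..t, ∫ x, S.q χ φ τ x ∂muQ d

def Id (s t : ℝ) : Prop :=
  IntegrableOn S.hb (Set.Icc s t) ∧ (∃ C, ∀ τ ∈ Set.Icc s t, ∫ x, S.u τ x ^ 2 ∂muQ d ≤ C) ∧
    ∀ χ φ : (Fin d → ℝ) → ℝ, Tst χ → Tst φ → S.Idn s t χ φ

lemma measurable_dot {X : Type*} [MeasurableSpace X] {p q : X → Fin d → ℝ}
    (hp : Measurable p) (hq : Measurable q) : Measurable fun x => dot (p x) (q x) := by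
  unfold dot
  exact Finset.measurable_sum _ fun i _ =>
    ((measurable_pi_iff.1 hp) i).mul ((measurable_pi_iff.1 hq) i)

lemma meas_q {χ φ : (Fin d → ℝ) → ℝ} (hχ : Tst χ) (hφ : Tst φ) :
    Measurable (Function.uncurry (S.q χ φ)) := by
  refine measurable_dot S.meas_F ?_
  have h1 : Measurable fun p : ℝ × (Fin d → ℝ) => (2 * χ p.2) :=
    (hχ.1.continuous.measurable.comp measurable_snd).const_mul 2
  have h2 : Measurable fun p : ℝ × (Fin d → ℝ) => (2 * S.u p.1 p.2) := S.meas_u.const_mul 2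
  have h3 : Measurable fun p : ℝ × (Fin d → ℝ) => pgrad χ p.2 :=
    (cont_pgrad hχ.1).measurable.comp measurable_snd
  have h4 : Measurable fun p : ℝ × (Fin d → ℝ) => pgrad φ p.2 :=
    (cont_pgrad hφ.1).measurable.comp measurable_snd
  exact ((h1.smul S.meas_Du).add (h2.smul h3)).add h4

lemma Tst.bdd {χ : (Fin d → ℝ) → ℝ} (hχ : Tst χ) :
    ∃ A, 0 ≤ A ∧ (∀ x, |χ x| ≤ A) ∧ ∀ x, nsq (pgrad χ x) ≤ A := by
  obtain ⟨A, hA⟩ := per_bdd hχ.2 hχ.1.continuous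
  obtain ⟨B, hB⟩ := per_bdd (f := fun x => nsq (pgrad χ x))
    (fun z x => by simp only [per_pgrad hχ.2]) (continuous_nsq.comp (cont_pgrad hχ.1))
  have hA0 := (abs_nonneg _).trans (hA 0)
  have hB0 := (abs_nonneg _).trans (hB 0)
  refine ⟨A + B, by positivity, fun x => (hA x).trans (by linarith), fun x => ?_⟩
  have := (le_abs_self _).trans (hB x)
  linarith

lemma pm_q {a b : ℝ} (ha : 0 ≤ a) (hab : a ≤ b) (hI : IntegrableOn S.hb (Set.Icc a b))
    (C : ℝ) (hC : ∀ t ∈ Set.Icc a b, ∫ x, S.u t x ^ 2 ∂muQ d ≤ C)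
    {χ φ : (Fin d → ℝ) → ℝ} (hχ : Tst χ) (hφ : Tst φ) :
    Integrable (Function.uncurry (S.q χ φ)) (pm d a b) := by
  obtain ⟨N, hN0, hN, -⟩ := S.G1b ha hab hI
  obtain ⟨A, hA0, hA1, hA2⟩ := hχ.bdd
  obtain ⟨B, hB0, hB1, hB2⟩ := hφ.bdd
  refine S.pm_dom' ha hab hI C hC (S.meas_q hχ hφ)
    (Real.exp (2 * N) * S.K + 8 * A ^ 2 + 8 * A + B) fun t ht x => ?_
  have h1 := dot_le_half (S.F t x) ((2 * χ x) • S.Du t x + (2 * S.u t x) • pgrad χ x + pgrad φ x)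
  have h2 := nsq_add_le ((2 * χ x) • S.Du t x + (2 * S.u t x) • pgrad χ x) (pgrad φ x)
  have h3 := nsq_add_le ((2 * χ x) • S.Du t x) ((2 * S.u t x) • pgrad χ x)
  rw [nsq_smul, nsq_smul] at h3
  have h4 := S.nsqF_le (hN t ht x)
  have h5 : χ x ^ 2 ≤ A ^ 2 := by
    rw [← sq_abs]; have := hA1 x; gcongr
  have n1 := nsq_nonneg (S.Du t x)
  have n2 := sq_nonneg (S.u t x)
  have h6 : (2 * χ x) ^ 2 * nsq (S.Du t x) ≤ 4 * A ^ 2 * nsq (S.Du t x) := by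
    have : (2 * χ x) ^ 2 ≤ 4 * A ^ 2 := by nlinarith
    gcongr
  have h7 : (2 * S.u t x) ^ 2 * nsq (pgrad χ x) ≤ 4 * S.u t x ^ 2 * A := by
    have : (2 * S.u t x) ^ 2 = 4 * S.u t x ^ 2 := by ring
    rw [this]
    have := hA2 x
    gcongr
  have h8 := hB2 x
  have hK := S.hK
  set E := Real.exp (2 * N) * S.K with hE
  have hE0 : 0 ≤ E := by positivity
  have hq : |S.q χ φ t x| ≤ (nsq (S.F t x) + (2 * (2 * (4 * A ^ 2 * nsq (S.Du t x))
    + 2 * (4 * S.u t x ^ 2 * A)) + 2 * B)) / 2 := by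
    unfold q
    linarith
  refine hq.trans ?_
  nlinarith [mul_nonneg hE0 n2, mul_nonneg hA0 n1, mul_nonneg hA0 n2, mul_nonneg hB0 n1,
    mul_nonneg hB0 n2, mul_nonneg (sq_nonneg A) n1, mul_nonneg (sq_nonneg A) n2,
    mul_nonneg hE0 n1, sq_nonneg A]

/-- time integrability of the tested flux -/
lemma int_q {a b : ℝ} (ha : 0 ≤ a) (hab : a ≤ b) (hI : IntegrableOn S.hb (Set.Icc a b))
    (hC : ∃ C, ∀ t ∈ Set.Icc a b, ∫ x, S.u t x ^ 2 ∂muQ d ≤ C)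
    {χ φ : (Fin d → ℝ) → ℝ} (hχ : Tst χ) (hφ : Tst φ) :
    IntervalIntegrable (fun τ => ∫ x, S.q χ φ τ x ∂muQ d) volume a b := by
  obtain ⟨C, hC⟩ := hC
  exact (intervalIntegrable_iff_integrableOn_Icc_of_le hab).2
    (S.pm_q ha hab hI C hC hχ hφ).integral_prod_left

lemma Id.concat {r s t : ℝ} (hr : 0 ≤ r) (hrs : r ≤ s) (hst : s ≤ t) (h1 : S.Id r s)
    (h2 : S.Id s t) : S.Id r t := by
  obtain ⟨a1, ⟨C1, b1⟩, c1⟩ := h1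
  obtain ⟨a2, ⟨C2, b2⟩, c2⟩ := h2
  refine ⟨?_, ⟨max C1 C2, ?_⟩, ?_⟩
  · rw [← Set.Icc_union_Icc_eq_Icc hrs hst]
    exact a1.union a2
  · intro τ hτ
    rcases le_total τ s with h | h
    · exact (b1 τ ⟨hτ.1, h⟩).trans (le_max_left _ _)
    · exact (b2 τ ⟨h, hτ.2⟩).trans (le_max_right _ _)
  · intro χ φ hχ hφ
    have e1 := c1 χ φ hχ hφ
    have e2 := c2 χ φ hχ hφ
    unfold Idn at *
    rw [← intervalIntegral.integral_add_adjacent_intervals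
      (S.int_q hr hrs a1 ⟨C1, b1⟩ hχ hφ) (S.int_q (hr.trans hrs) hst a2 ⟨C2, b2⟩ hχ hφ)]
    linarith

end Sys

end partD3

section partE1

namespace Sys

variable {d : ℕ} (S : Sys d)

lemma Tst.const (c : ℝ) : Tst (fun _ : Fin d → ℝ => c) := ⟨contDiff_const, fun _ _ => rfl⟩

lemma tst_u (t : ℝ) : Tst (S.u t) := ⟨S.u_C1 t, S.u_per t⟩

lemma Tst.sub {f g : (Fin d → ℝ) → ℝ} (hf : Tst f) (hg : Tst g) : Tst fun x => f x - g x :=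
  ⟨hf.1.sub hg.1, fun z x => by simp only [hf.2 z x, hg.2 z x]⟩

lemma Tst.neg {f : (Fin d → ℝ) → ℝ} (hf : Tst f) : Tst fun x => - f x :=
  ⟨hf.1.neg, fun z x => by simp only [hf.2 z x]⟩

lemma pgrad_const (c : ℝ) (x : Fin d → ℝ) : pgrad (fun _ => c) x = 0 := by
  ext i; simp [pgrad]

lemma pgrad_sub {f g : (Fin d → ℝ) → ℝ} (hf : ContDiff ℝ 1 f) (hg : ContDiff ℝ 1 g)
    (x : Fin d → ℝ) : pgrad (fun x => f x - g x) x = pgrad f x - pgrad g x := by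
  ext i
  simp only [pgrad, Pi.sub_apply]
  rw [fderiv_fun_sub (hf.differentiable (by norm_num) x) (hg.differentiable (by norm_num) x)]
  rfl

lemma pgrad_neg {f : (Fin d → ℝ) → ℝ} (x : Fin d → ℝ) :
    pgrad (fun x => - f x) x = - pgrad f x := by
  ext i
  simp only [pgrad, Pi.neg_apply, fderiv_fun_neg]
  rfl

lemma pgrad_sq {f : (Fin d → ℝ) → ℝ} (hf : ContDiff ℝ 1 f) (x : Fin d → ℝ) :
    pgrad (fun x => f x ^ 2) x = (2 * f x) • pgrad f x := by
  ext i
  simp only [pgrad, Pi.smul_apply]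
  rw [fderiv_fun_pow 2 (hf.differentiable (by norm_num) x)]
  simp

/-- a periodic cutoff localised near a point modulo the lattice. -/
lemma cutoff (x1 : Fin d → ℝ) {r : ℝ} (hr : 0 < r) :
    ∃ φ : (Fin d → ℝ) → ℝ, Tst φ ∧ φ x1 ≠ 0 ∧
      ∀ x, φ x ≠ 0 → ∃ z : Fin d → ℤ, (x + fun i => (z i : ℝ)) ∈ Metric.ball x1 r := by
  refine ⟨fun x => expNegInvGlue (8 * r ^ 2 - ∑ i, (1 - Real.cos (2 * Real.pi * (x i - x1 i)))),
    ⟨?_, ?_⟩, ?_, ?_⟩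
  · refine (expNegInvGlue.contDiff (n := 1)).comp ?_
    refine contDiff_const.sub (ContDiff.sum fun i _ => ?_)
    refine contDiff_const.sub (Real.contDiff_cos.comp ?_)
    exact contDiff_const.mul ((contDiff_apply ℝ ℝ i).sub contDiff_const)
  · intro z x
    simp only
    congr 2
    refine Finset.sum_congr rfl fun i _ => ?_
    congr 1
    have : 2 * Real.pi * ((x + fun i => (z i : ℝ)) i - x1 i)
        = 2 * Real.pi * (x i - x1 i) + (z i : ℝ) * (2 * Real.pi) := by
      simp only [Pi.add_apply]; ring
    rw [this, Real.cos_add_int_mul_two_pi]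
  · simp only [sub_self, mul_zero, Real.cos_zero, Finset.sum_const_zero, sub_zero]
    exact (expNegInvGlue.pos_of_pos (by positivity)).ne'
  · intro x hx
    have h0 : 0 < 8 * r ^ 2 - ∑ i, (1 - Real.cos (2 * Real.pi * (x i - x1 i))) := by
      by_contra h
      exact hx (expNegInvGlue.zero_of_nonpos (not_lt.1 h))
    refine ⟨fun i => - round (x i - x1 i), ?_⟩
    rw [Metric.mem_ball, dist_pi_lt_iff hr]
    intro i
    have h1 : 1 - Real.cos (2 * Real.pi * (x i - x1 i)) < 8 * r ^ 2 := by
      have := Finset.single_le_sum (f := fun i => 1 - Real.cos (2 * Real.pi * (x i - x1 i)))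
        (fun j _ => by have := Real.cos_le_one (2 * Real.pi * (x j - x1 j)); linarith)
        (Finset.mem_univ i)
      linarith
    set s := x i - x1 i - round (x i - x1 i) with hs
    have hs2 : |s| ≤ 1 / 2 := abs_sub_round _
    have e : Real.cos (2 * Real.pi * (x i - x1 i)) = Real.cos (2 * Real.pi * s) := by
      have : 2 * Real.pi * (x i - x1 i) = 2 * Real.pi * s
        + (round (x i - x1 i) : ℝ) * (2 * Real.pi) := by rw [hs]; ring
      rw [this, Real.cos_add_int_mul_two_pi]
    have hpi := Real.pi_pos
    have h2 := Real.cos_le_one_sub_mul_cos_sq (x := 2 * Real.pi * s) (by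
      rw [abs_mul, abs_of_pos (by positivity)]
      nlinarith)
    have e2 : 2 / Real.pi ^ 2 * (2 * Real.pi * s) ^ 2 = 8 * s ^ 2 := by
      field_simp; ring
    rw [e2, ← e] at h2
    have h3 : s ^ 2 < r ^ 2 := by linarith
    have h4 : |s| < r := abs_lt_of_sq_lt_sq h3 hr.le
    rw [Real.dist_eq]
    have : (x + fun i => ((- round (x i - x1 i) : ℤ) : ℝ)) i - x1 i = s := by
      simp only [Pi.add_apply, hs]; push_cast; ring
    rw [this]; exact h4

lemma dot_b_low (x q : Fin d → ℝ) : S.c * nsq q - 2 * S.K ≤ dot (S.b x q) q := by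
  have h1 := S.conv x q 0
  have h2 := S.h_up x 0
  have h3 := S.h_low x q
  have e : dot (S.b x q) (0 - q) = - dot (S.b x q) q := by
    simp [dot, Finset.sum_neg_distrib]
  have e2 : nsq (0 : Fin d → ℝ) = 0 := by simp [nsq]
  have h4 := nsq_nonneg (0 - q)
  have := S.hρ
  rw [e] at h1
  rw [e2] at h2
  nlinarith

/-- pointwise Caccioppoli inequality -/
lemma cacc_point {N A t : ℝ} {x : Fin d → ℝ} {φ : (Fin d → ℝ) → ℝ} (hφ : ContDiff ℝ 1 φ)
    (hl : |S.l t x| ≤ N) (hu : |S.u t x| ≤ N) (hA1 : |φ x| ≤ A) (hA2 : nsq (pgrad φ x) ≤ A) :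
    Real.exp (-N) * S.c * (φ x ^ 2 * nsq (S.Du t x)) ≤ S.q (fun x => φ x ^ 2) (fun _ => 0) t x
      + Real.exp N * ((4 * S.K + S.c / 2) * A ^ 2 + 8 * N ^ 2 * (S.K + 1) / S.c * A) := by
  have hK := S.hK
  have hc := S.hc
  have hA0 : 0 ≤ A := (abs_nonneg _).trans hA1
  set β := S.b x (S.Du t x) with hβ
  have eq : S.q (fun x => φ x ^ 2) (fun _ => 0) t x
      = S.m t x * (2 * φ x ^ 2 * dot β (S.Du t x) + 4 * S.u t x * φ x * dot β (pgrad φ x)) := by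
    unfold q
    rw [pgrad_const, add_zero, pgrad_sq hφ, dot_add, dot_smul, dot_smul, dot_smul, F, smul_dot,
      smul_dot]
    ring
  have h1 := S.dot_b_low x (S.Du t x)
  have h2 := S.b_up x (S.Du t x)
  have hφ2 : φ x ^ 2 ≤ A ^ 2 := by rw [← sq_abs]; gcongr
  have hu2 : S.u t x ^ 2 ≤ N ^ 2 := by rw [← sq_abs]; gcongr
  have n1 := nsq_nonneg (S.Du t x)
  have n2 := nsq_nonneg (pgrad φ x)
  have n3 := nsq_nonneg β
  set ε := S.c / (S.K + 1) with hε
  have hε0 : 0 < ε := by positivity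
  have hεK : ε * S.K ≤ S.c := by
    rw [hε, div_mul_eq_mul_div, div_le_iff₀ (by positivity)]; nlinarith
  have hcross : -(ε / 2 * φ x ^ 2 * nsq β + 8 * S.u t x ^ 2 / ε * nsq (pgrad φ x))
      ≤ 4 * S.u t x * φ x * dot β (pgrad φ x) := by
    have := dot_le_half (φ x • β) ((4 * S.u t x / ε) • pgrad φ x)
    rw [smul_dot, dot_smul, nsq_smul, nsq_smul] at this
    have h := (abs_le.1 this).1
    have h' := mul_le_mul_of_nonneg_left h hε0.le
    have e1 : ε * (φ x * (4 * S.u t x / ε * dot β (pgrad φ x)))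
      = 4 * S.u t x * φ x * dot β (pgrad φ x) := by field_simp
    have e2 : ε * -((φ x ^ 2 * nsq β + (4 * S.u t x / ε) ^ 2 * nsq (pgrad φ x)) / 2)
      = -(ε / 2 * φ x ^ 2 * nsq β + 8 * S.u t x ^ 2 / ε * nsq (pgrad φ x)) := by
      field_simp; ring
    linarith
  have hb1 : ε / 2 * φ x ^ 2 * nsq β ≤ S.c / 2 * φ x ^ 2 * (1 + nsq (S.Du t x)) := by
    have : ε * nsq β ≤ S.c * (1 + nsq (S.Du t x)) := by
      calc ε * nsq β ≤ ε * (S.K * (1 + nsq (S.Du t x))) := by gcongr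
        _ = ε * S.K * (1 + nsq (S.Du t x)) := by ring
        _ ≤ _ := by gcongr
    have := mul_le_mul_of_nonneg_left this (sq_nonneg (φ x))
    linarith
  have hb2 : 8 * S.u t x ^ 2 / ε * nsq (pgrad φ x) ≤ 8 * N ^ 2 * (S.K + 1) / S.c * A := by
    have : 8 * N ^ 2 * (S.K + 1) / S.c = 8 * N ^ 2 / ε := by rw [hε]; field_simp
    rw [this]
    gcongr
  have hmain : S.c * (φ x ^ 2 * nsq (S.Du t x)) ≤
      (2 * φ x ^ 2 * dot β (S.Du t x) + 4 * S.u t x * φ x * dot β (pgrad φ x))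
      + ((4 * S.K + S.c / 2) * A ^ 2 + 8 * N ^ 2 * (S.K + 1) / S.c * A) := by
    have a1 := mul_le_mul_of_nonneg_left h1 (sq_nonneg (φ x))
    have a2 : (4 * S.K + S.c / 2) * φ x ^ 2 ≤ (4 * S.K + S.c / 2) * A ^ 2 := by gcongr
    have a3 : 0 ≤ S.c / 2 * (φ x ^ 2 * nsq (S.Du t x)) := by positivity
    linarith
  set B := (4 * S.K + S.c / 2) * A ^ 2 + 8 * N ^ 2 * (S.K + 1) / S.c * A with hB
  have hB0 : 0 ≤ B := by positivity
  rw [eq]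
  have hm1 : Real.exp (-N) ≤ S.m t x := by
    rw [S.m_eq]; exact Real.exp_le_exp.2 (abs_le.1 hl).1
  have hm2 : S.m t x ≤ Real.exp N := by
    rw [S.m_eq]; exact Real.exp_le_exp.2 (abs_le.1 hl).2
  have c1 := mul_le_mul_of_nonneg_left hmain (S.m_pos t x).le
  have c2 : Real.exp (-N) * (S.c * (φ x ^ 2 * nsq (S.Du t x)))
    ≤ S.m t x * (S.c * (φ x ^ 2 * nsq (S.Du t x))) := by gcongr
  have c3 : S.m t x * B ≤ Real.exp N * B := by gcongr
  linarith

end Sys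

end partE1

section partE2

namespace Sys

variable {d : ℕ} (S : Sys d)

lemma cacc_time {a b N A : ℝ} {φ : (Fin d → ℝ) → ℝ} (hφ : Tst φ)
    (hb : ∀ x, φ x ≠ 0 → ∀ τ ∈ Set.Icc a b, |S.l τ x| ≤ N ∧ |S.u τ x| ≤ N)
    (hA1 : ∀ x, |φ x| ≤ A) (hA2 : ∀ x, nsq (pgrad φ x) ≤ A) {s t : ℝ} (hs0 : 0 ≤ s)
    (hs : a ≤ s) (hst : s ≤ t) (ht : t ≤ b) (h : S.Id s t) :
    IntegrableOn (fun τ => ∫ x, φ x ^ 2 * nsq (S.Du τ x) ∂muQ d) (Set.Icc s t) ∧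
    Real.exp (-N) * S.c * ∫ τ in s..t, ∫ x, φ x ^ 2 * nsq (S.Du τ x) ∂muQ d ≤
      A ^ 2 * N ^ 2 + Real.exp N * ((4 * S.K + S.c / 2) * A ^ 2
        + 8 * N ^ 2 * (S.K + 1) / S.c * A) * (b - a) := by
  obtain ⟨hI, hC, hid⟩ := h
  have hK := S.hK
  have hc := S.hc
  have hA0 : 0 ≤ A := (abs_nonneg _).trans (hA1 0)
  have hφc := hφ.1.continuous
  set B := Real.exp N * ((4 * S.K + S.c / 2) * A ^ 2 + 8 * N ^ 2 * (S.K + 1) / S.c * A) with hB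
  have hB0 : 0 ≤ B := by positivity
  have hφ2 : Tst fun x => φ x ^ 2 := ⟨hφ.1.pow 2, fun z x => by simp only [hφ.2 z x]⟩
  have hpt : ∀ τ ∈ Set.Icc s t, ∀ x, Real.exp (-N) * S.c * (φ x ^ 2 * nsq (S.Du τ x)) ≤
      S.q (fun x => φ x ^ 2) (fun _ => 0) τ x + B := by
    intro τ hτ x
    by_cases h0 : φ x = 0
    · have : S.q (fun x => φ x ^ 2) (fun _ => 0) τ x = 0 := by
        unfold q
        rw [pgrad_const, pgrad_sq hφ.1, h0]
        simp [dot, h0]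
      rw [this, h0]; simpa using hB0
    · have := hb x h0 τ ⟨hs.trans hτ.1, hτ.2.trans ht⟩
      exact S.cacc_point hφ.1 this.1 this.2 (hA1 x) (hA2 x)
  have hi : IntegrableOn (fun τ => ∫ x, φ x ^ 2 * nsq (S.Du τ x) ∂muQ d) (Set.Icc s t) := by
    have : Integrable (Function.uncurry fun τ x => φ x ^ 2 * nsq (S.Du τ x)) (pm d s t) := by
      refine S.pm_dom hs0 hst hI ?_ (A ^ 2) fun τ hτ x => ?_
      · exact ((hφc.measurable.comp measurable_snd).pow_const 2).mul S.meas_nsqDu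
      · have n1 := nsq_nonneg (S.Du τ x)
        rw [abs_of_nonneg (by positivity)]
        have : φ x ^ 2 ≤ A ^ 2 := by rw [← sq_abs]; have := hA1 x; gcongr
        have := abs_nonneg (S.hb τ)
        gcongr; linarith
    exact this.integral_prod_left
  refine ⟨hi, ?_⟩
  have e := hid (fun x => φ x ^ 2) (fun _ => 0) hφ2 (Tst.const 0)
  unfold Idn at e
  have hqi := S.int_q hs0 hst hI hC hφ2 (Tst.const 0)
  have hqc : ∀ τ, Continuous (S.q (fun x => φ x ^ 2) (fun _ => 0) τ) := fun τ => by
    have h1 := S.F_cont τ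
    have h2 := S.Du_cont τ
    have h3 := S.u_cont τ
    have h4 := cont_pgrad hφ2.1
    have h5 := cont_pgrad (Tst.const (d := d) 0).1
    unfold q
    fun_prop
  have hle : Real.exp (-N) * S.c * ∫ τ in s..t, ∫ x, φ x ^ 2 * nsq (S.Du τ x) ∂muQ d
      ≤ ∫ τ in s..t, ((∫ x, S.q (fun x => φ x ^ 2) (fun _ => 0) τ x ∂muQ d) + B) := by
    rw [← intervalIntegral.integral_const_mul]
    refine intervalIntegral.integral_mono_on hst ?_ (hqi.add intervalIntegrable_const) ?_
    · exact ((intervalIntegrable_iff_integrableOn_Icc_of_le hst).2 hi).const_mul _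
    · intro τ hτ
      have h2 := S.Du_cont τ
      have e1 : (∫ x, S.q (fun x => φ x ^ 2) (fun _ => 0) τ x ∂muQ d) + B
          = ∫ x, (S.q (fun x => φ x ^ 2) (fun _ => 0) τ x + B) ∂muQ d := by
        rw [integral_add (cont_int (hqc τ)) (integrable_const _)]; simp
      rw [e1, ← integral_const_mul]
      exact integral_mono (cont_int (by fun_prop))
        ((cont_int (hqc τ)).add (integrable_const _)) fun x => hpt τ hτ x
  rw [intervalIntegral.integral_add hqi intervalIntegrable_const,
    intervalIntegral.integral_const, smul_eq_mul] at hle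
  have hts : (t - s) * B ≤ (b - a) * B := by gcongr
  have hΦ0 : 0 ≤ ∫ x, (φ x ^ 2 * S.u t x ^ 2 + 0 * S.u t x) ∂muQ d :=
    integral_nonneg fun x => by simp only [zero_mul, add_zero]; positivity
  have hΦ1 : ∫ x, (φ x ^ 2 * S.u s x ^ 2 + 0 * S.u s x) ∂muQ d ≤ A ^ 2 * N ^ 2 := by
    have : ∀ x, φ x ^ 2 * S.u s x ^ 2 + 0 * S.u s x ≤ A ^ 2 * N ^ 2 := by
      intro x
      rw [zero_mul, add_zero]
      by_cases h0 : φ x = 0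
      · rw [h0]; simp; positivity
      · have h1 := (hb x h0 s ⟨hs, hst.trans ht⟩).2
        have h2 : φ x ^ 2 ≤ A ^ 2 := by rw [← sq_abs]; have := hA1 x; gcongr
        have h3 : S.u s x ^ 2 ≤ N ^ 2 := by rw [← sq_abs]; gcongr
        gcongr
    have h3 := S.u_cont s
    refine (integral_mono (cont_int (by fun_prop)) (integrable_const (A ^ 2 * N ^ 2)) this).trans ?_
    simp
  linarith

lemma gap_hb {a b : ℝ} (ha : 0 ≤ a) (hab : a < b)
    (h : ∀ s t, a < s → s ≤ t → t < b → S.Id s t) : IntegrableOn S.hb (Set.Icc a b) := by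
  -- Baire category in the space variable
  set E : ℕ → Set (Fin d → ℝ) := fun N =>
    {x | ∀ τ ∈ Set.Icc a b, |S.l τ x| ≤ N ∧ |S.u τ x| ≤ N} with hE
  have hEc : ∀ N, IsClosed (E N) := fun N => by
    have : E N = ⋂ τ ∈ Set.Icc a b, ({x | |S.l τ x| ≤ N} ∩ {x | |S.u τ x| ≤ N}) := by
      ext x; simp [hE]
    rw [this]
    refine isClosed_biInter fun τ _ => IsClosed.inter ?_ ?_
    · exact isClosed_le (S.l_cont τ).abs continuous_const
    · exact isClosed_le (S.u_cont τ).abs continuous_const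
  have hEu : ⋃ N, E N = Set.univ := by
    refine Set.eq_univ_of_forall fun x => ?_
    obtain ⟨C1, h1⟩ := (isCompact_Icc (a := a) (b := b)).exists_bound_of_continuousOn
      (S.l_tcont x).continuousOn
    obtain ⟨C2, h2⟩ := (isCompact_Icc (a := a) (b := b)).exists_bound_of_continuousOn
      (S.u_tcont x).continuousOn
    obtain ⟨N, hN⟩ := exists_nat_ge (max C1 C2)
    refine Set.mem_iUnion.2 ⟨N, fun τ hτ => ⟨(h1 τ hτ).trans ((le_max_left _ _).trans hN),
      (h2 τ hτ).trans ((le_max_right _ _).trans hN)⟩⟩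
  have hdense := dense_iUnion_interior_of_closed hEc hEu
  set O : Set (Fin d → ℝ) := Set.pi Set.univ fun _ => Set.Ioo (0 : ℝ) 1 with hO
  have hOo : IsOpen O := isOpen_set_pi Set.finite_univ fun _ _ => isOpen_Ioo
  have hOn : O.Nonempty := ⟨fun _ => 1 / 2, fun i _ => by constructor <;> norm_num⟩
  have hOs : O ⊆ Set.Icc 0 1 := fun x hx =>
    ⟨fun i => (hx i trivial).1.le, fun i => (hx i trivial).2.le⟩
  obtain ⟨x1, hx1O, hx1⟩ := hdense.inter_open_nonempty O hOo hOn
  obtain ⟨N, hN⟩ := Set.mem_iUnion.1 hx1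
  obtain ⟨r, hr, hball⟩ := Metric.isOpen_iff.1 isOpen_interior x1 hN
  obtain ⟨φ, hφ, hφ1, hφs⟩ := cutoff x1 hr
  have hbd : ∀ x, φ x ≠ 0 → ∀ τ ∈ Set.Icc a b, |S.l τ x| ≤ N ∧ |S.u τ x| ≤ N := by
    intro x hx τ hτ
    obtain ⟨z, hz⟩ := hφs x hx
    have := interior_subset (hball hz) τ hτ
    rwa [S.l_per τ z x, S.u_per τ z x] at this
  obtain ⟨A, hA0, hA1, hA2⟩ := hφ.bdd
  set C := A ^ 2 * (N : ℝ) ^ 2 + Real.exp N * ((4 * S.K + S.c / 2) * A ^ 2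
        + 8 * (N : ℝ) ^ 2 * (S.K + 1) / S.c * A) * (b - a) with hC
  have hcpos : 0 < Real.exp (-(N : ℝ)) * S.c := mul_pos (Real.exp_pos _) S.hc
  set f : ℝ → ℝ := fun τ => ∫ x, φ x ^ 2 * nsq (S.Du τ x) ∂muQ d with hf
  have hf0 : ∀ τ, 0 ≤ f τ := fun τ => integral_nonneg fun x =>
    mul_nonneg (sq_nonneg _) (nsq_nonneg _)
  have hfi : IntegrableOn f (Set.Ioc a b) := by
    set δ : ℕ → ℝ := fun n => (b - a) / (n + 2) with hδ
    have hba : 0 < b - a := by linarith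
    have hδ0 : ∀ n, 0 < δ n := fun n => by simp only [hδ]; positivity
    have hδ1 : ∀ n, δ n ≤ (b - a) / 2 := fun n => by
      simp only [hδ]
      gcongr
      have : (0 : ℝ) ≤ n := Nat.cast_nonneg n
      linarith
    have hδt : Tendsto δ atTop (nhds 0) :=
      tendsto_const_nhds.div_atTop
        (tendsto_atTop_add_const_right _ _ tendsto_natCast_atTop_atTop)
    have key : ∀ n, _ := fun n => S.cacc_time (a := a) (b := b) (N := N) hφ hbd hA1 hA2
      (s := a + δ n) (t := b - δ n) (by have := hδ0 n; linarith) (by have := hδ0 n; linarith)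
      (by have := hδ1 n; linarith) (by have := hδ0 n; linarith)
      (h _ _ (by have := hδ0 n; linarith) (by have := hδ1 n; linarith)
        (by have := hδ0 n; linarith))
    refine integrableOn_Ioc_of_intervalIntegral_norm_bounded (l := atTop) (a := fun n => a + δ n)
      (b := fun n => b - δ n) (I := C / (Real.exp (-(N : ℝ)) * S.c)) ?_ ?_ ?_ ?_
    · exact fun n => (key n).1.mono_set Set.Ioc_subset_Icc_self
    · simpa using tendsto_const_nhds.add hδt
    · simpa using tendsto_const_nhds.sub hδt
    · refine Eventually.of_forall fun n => ?_
      have h1 := (key n).2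
      rw [intervalIntegral.integral_of_le (by have := hδ1 n; linarith)] at h1
      simp only [Real.norm_of_nonneg (hf0 _)]
      rw [le_div_iff₀ hcpos, mul_comm]
      exact h1
  have hfi' : IntegrableOn f (Set.Icc a b) := by rwa [integrableOn_Icc_iff_integrableOn_Ioc]
  have hm : Measurable (Function.uncurry fun τ x => φ x ^ 2 * nsq (S.Du τ x)) :=
    ((hφ.1.continuous.measurable.comp measurable_snd).pow_const 2).mul S.meas_nsqDu
  have hp : Integrable (Function.uncurry fun τ x => φ x ^ 2 * nsq (S.Du τ x)) (pm d a b) := by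
    refine (MeasureTheory.integrable_prod_iff hm.aestronglyMeasurable).2 ⟨?_, ?_⟩
    · refine Eventually.of_forall fun τ => cont_int ?_
      have h1 := S.Du_cont τ
      have h2 := hφ.1.continuous
      simp only [Function.uncurry]
      fun_prop
    · refine hfi'.congr (Eventually.of_forall fun τ => ?_)
      refine integral_congr_ae (Eventually.of_forall fun x => ?_)
      simp only [Function.uncurry]
      rw [Real.norm_of_nonneg (mul_nonneg (sq_nonneg _) (nsq_nonneg _))]
  have hae := hp.prod_left_ae
  set U := O ∩ {x | φ x ≠ 0} with hU
  have hUo : IsOpen U := hOo.inter (hφ.1.continuous.isOpen_preimage _ isOpen_ne)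
  have hUpos : volume U ≠ 0 := (hUo.measure_pos volume ⟨x1, hx1O, hφ1⟩).ne'
  have hae' : ∀ᵐ x ∂(volume.restrict U), Integrable (fun τ => φ x ^ 2 * nsq (S.Du τ x))
      (volume.restrict (Set.Icc a b)) :=
    ae_restrict_of_ae_restrict_of_subset (Set.inter_subset_left.trans hOs) hae
  obtain ⟨x0, hx0, hx0i⟩ := Measure.exists_mem_of_measure_ne_zero_of_ae hUpos hae'
  refine S.G1a ha hab.le x0 ?_
  have := hx0i.const_mul (φ x0 ^ 2)⁻¹
  refine this.congr (Eventually.of_forall fun τ => ?_)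
  have : φ x0 ≠ 0 := hx0.2
  simp only
  field_simp

end Sys

end partE2

section partE3

lemma ext_ident {f Q : ℝ → ℝ} {a b : ℝ} (hab : a < b) (hQ : IntervalIntegrable Q volume a b)
    (h : ∀ s t, a < s → s ≤ t → t < b → f t - f s = - ∫ τ in s..t, Q τ)
    {σ τ : ℕ → ℝ} (hσ : ∀ n, σ n ∈ Set.Ioo a b) (hσa : Tendsto σ atTop (nhds a))
    (hfa : Tendsto (fun n => f (σ n)) atTop (nhds (f a)))
    (hτ : ∀ n, τ n ∈ Set.Ioo a b) (hτb : Tendsto τ atTop (nhds b))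
    (hfb : Tendsto (fun n => f (τ n)) atTop (nhds (f b))) :
    ∀ s t, a ≤ s → s ≤ t → t ≤ b → f t - f s = - ∫ τ in s..t, Q τ := by
  set P : ℝ → ℝ := fun t => ∫ τ in a..t, Q τ with hP
  have hPc : ContinuousOn P (Set.Icc a b) := by
    have := intervalIntegral.continuousOn_primitive_interval' hQ Set.left_mem_uIcc
    rwa [Set.uIcc_of_le hab.le] at this
  have hsub : ∀ {s t}, s ∈ Set.Icc a b → t ∈ Set.Icc a b → IntervalIntegrable Q volume s t :=
    fun hs ht => hQ.mono_set (by
      rw [Set.uIcc_of_le hab.le]; exact Set.uIcc_subset_Icc hs ht)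
  have hPd : ∀ {s t}, s ∈ Set.Icc a b → t ∈ Set.Icc a b → ∫ τ in s..t, Q τ = P t - P s := by
    intro s t hs ht
    have ha : a ∈ Set.Icc a b := ⟨le_rfl, hab.le⟩
    simp only [hP]
    rw [intervalIntegral.integral_interval_sub_left (hsub ha ht) (hsub ha hs)]
  obtain ⟨c, hc⟩ := exists_between hab
  have hk : ∀ t ∈ Set.Ioo a b, f t + P t = f c + P c := by
    intro t ht
    rcases le_total t c with h1 | h1
    · have := h t c ht.1 h1 hc.2
      rw [hPd ⟨ht.1.le, ht.2.le⟩ ⟨hc.1.le, hc.2.le⟩] at this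
      linarith
    · have := h c t hc.1 h1 ht.2
      rw [hPd ⟨hc.1.le, hc.2.le⟩ ⟨ht.1.le, ht.2.le⟩] at this
      linarith
  have hend : ∀ {e : ℝ} {σ : ℕ → ℝ}, e ∈ Set.Icc a b → (∀ n, σ n ∈ Set.Ioo a b) →
      Tendsto σ atTop (nhds e) → Tendsto (fun n => f (σ n)) atTop (nhds (f e)) →
      f e + P e = f c + P c := by
    intro e σ he hσ hσe hf
    have h1 : Tendsto (fun n => P (σ n)) atTop (nhds (P e)) := by
      refine (hPc e he).tendsto.comp ?_
      exact tendsto_nhdsWithin_iff.2 ⟨hσe, Eventually.of_forall fun n => ⟨(hσ n).1.le, (hσ n).2.le⟩⟩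
    have h2 := hf.add h1
    simp only [hk _ (hσ _)] at h2
    exact tendsto_nhds_unique h2 tendsto_const_nhds
  have hall : ∀ t ∈ Set.Icc a b, f t + P t = f c + P c := by
    intro t ht
    rcases eq_or_lt_of_le ht.1 with h1 | h1
    · rw [← h1]; exact hend ⟨le_rfl, hab.le⟩ hσ hσa hfa
    rcases eq_or_lt_of_le ht.2 with h2 | h2
    · rw [h2]; exact hend ⟨hab.le, le_rfl⟩ hτ hτb hfb
    exact hk t ⟨h1, h2⟩
  intro s t hs hst ht
  have h1 := hall s ⟨hs, hst.trans ht⟩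
  have h2 := hall t ⟨hs.trans hst, ht⟩
  rw [hPd ⟨hs, hst.trans ht⟩ ⟨hs.trans hst, ht⟩]
  linarith

lemma exists_le_mean {f : ℝ → ℝ} {α β : ℝ} (hab : α < β) (hf : IntegrableOn f (Set.Icc α β)) :
    ∃ s ∈ Set.Ioo α β, (β - α) * f s ≤ ∫ τ in α..β, f τ := by
  have h1 : volume (Set.Ioo α β) ≠ 0 := by simp [hab]
  have h2 : volume (Set.Ioo α β) ≠ ⊤ := by simp
  obtain ⟨s, hs, h⟩ := exists_le_setAverage h1 h2 (hf.mono_set Set.Ioo_subset_Icc_self)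
  refine ⟨s, hs, ?_⟩
  rw [setAverage_eq, smul_eq_mul, Real.volume_real_Ioo_of_le hab.le, ← integral_Ioc_eq_integral_Ioo,
    ← intervalIntegral.integral_of_le hab.le] at h
  have hpos : 0 < β - α := by linarith
  have := mul_le_mul_of_nonneg_left h hpos.le
  rwa [← mul_assoc, mul_inv_cancel₀ hpos.ne', one_mul] at this

namespace Sys

variable {d : ℕ} (S : Sys d)

lemma q_cont {χ φ : (Fin d → ℝ) → ℝ} (hχ : Tst χ) (hφ : Tst φ) (τ : ℝ) :
    Continuous (S.q χ φ τ) := by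
  have h1 := S.F_cont τ
  have h2 := S.Du_cont τ
  have h3 := S.u_cont τ
  have h4 := cont_pgrad hχ.1
  have h5 := cont_pgrad hφ.1
  have h6 := hχ.1.continuous
  unfold q
  fun_prop

lemma int_F {a b : ℝ} (ha : 0 ≤ a) (hab : a ≤ b) (hI : IntegrableOn S.hb (Set.Icc a b)) :
    IntegrableOn (fun τ => ∫ x, nsq (S.F τ x) ∂muQ d) (Set.Icc a b) :=
  (S.pm_nsqF ha hab hI).integral_prod_left

lemma int_Du {a b : ℝ} (ha : 0 ≤ a) (hab : a ≤ b) (hI : IntegrableOn S.hb (Set.Icc a b)) :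
    IntegrableOn (fun τ => ∫ x, nsq (S.Du τ x) ∂muQ d) (Set.Icc a b) :=
  (S.pm_nsqDu ha hab hI).integral_prod_left

lemma cont_nsqF (τ : ℝ) : Continuous fun x => nsq (S.F τ x) := continuous_nsq.comp (S.F_cont τ)
lemma cont_nsqDu (τ : ℝ) : Continuous fun x => nsq (S.Du τ x) := continuous_nsq.comp (S.Du_cont τ)

/-- uniform L2 bound on a gap -/
lemma gap_l2 {a b : ℝ} (ha : 0 ≤ a) (hab : a < b) (hI : IntegrableOn S.hb (Set.Icc a b))
    (h : ∀ s t, a < s → s ≤ t → t < b → S.Id s t) :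
    ∃ C, ∀ τ ∈ Set.Icc a b, ∫ x, S.u τ x ^ 2 ∂muQ d ≤ C := by
  obtain ⟨c, hc⟩ := exists_between hab
  set J : ℝ → ℝ := fun τ => (∫ x, nsq (S.F τ x) ∂muQ d) + ∫ x, nsq (S.Du τ x) ∂muQ d with hJ
  have hJi : IntegrableOn J (Set.Icc a b) := (S.int_F ha hab.le hI).add (S.int_Du ha hab.le hI)
  have hJ0 : ∀ τ, 0 ≤ J τ := fun τ => add_nonneg (integral_nonneg fun x => nsq_nonneg _)
    (integral_nonneg fun x => nsq_nonneg _)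
  have hJii : IntervalIntegrable J volume a b :=
    (intervalIntegrable_iff_integrableOn_Icc_of_le hab.le).2 hJi
  set I := ∫ τ in a..b, J τ with hIJ
  have hb : ∀ s t, a < s → s ≤ t → t < b →
      |(∫ x, S.u t x ^ 2 ∂muQ d) - ∫ x, S.u s x ^ 2 ∂muQ d| ≤ I := by
    intro s t hs hst ht
    obtain ⟨i1, i2, i3⟩ := h s t hs hst ht
    have e := i3 (fun _ => 1) (fun _ => 0) (Tst.const 1) (Tst.const 0)
    unfold Idn at e
    simp only [one_mul, zero_mul, add_zero] at e
    rw [e, abs_neg]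
    have h1 : |∫ τ in s..t, ∫ x, S.q (fun _ => 1) (fun _ => 0) τ x ∂muQ d| ≤ ∫ τ in s..t, J τ := by
      rw [← Real.norm_eq_abs]
      refine intervalIntegral.norm_integral_le_of_norm_le hst (Eventually.of_forall fun τ hτ => ?_)
        (hJii.mono_set (by
          rw [Set.uIcc_of_le hst, Set.uIcc_of_le hab.le]; exact Set.Icc_subset_Icc hs.le ht.le))
      refine (norm_integral_le_integral_norm _).trans ?_
      simp only [hJ]
      rw [← integral_add (cont_int (S.cont_nsqF τ)) (cont_int (S.cont_nsqDu τ))]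
      refine integral_mono (cont_int (S.q_cont (Tst.const 1) (Tst.const 0) τ)).norm
        ((cont_int (S.cont_nsqF τ)).add (cont_int (S.cont_nsqDu τ))) fun x => ?_
      simp only [q, pgrad_const, smul_zero, add_zero, mul_one, dot_smul, Real.norm_eq_abs]
      rw [abs_mul, abs_of_pos (by norm_num : (0:ℝ) < 2)]
      have := dot_le_half (S.F τ x) (S.Du τ x)
      linarith
    refine h1.trans (intervalIntegral.integral_mono_interval hs.le hst ht.le
      (Eventually.of_forall hJ0) hJii)
  refine ⟨max (max (∫ x, S.u a x ^ 2 ∂muQ d) (∫ x, S.u b x ^ 2 ∂muQ d))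
    ((∫ x, S.u c x ^ 2 ∂muQ d) + I), fun τ hτ => ?_⟩
  rcases eq_or_lt_of_le hτ.1 with h1 | h1
  · rw [← h1]; exact (le_max_left _ _).trans (le_max_left _ _)
  rcases eq_or_lt_of_le hτ.2 with h2 | h2
  · rw [h2]; exact (le_max_right _ _).trans (le_max_left _ _)
  refine le_trans ?_ (le_max_right _ _)
  rcases le_total τ c with h3 | h3
  · have := abs_le.1 (hb τ c h1 h3 hc.2); linarith
  · have := abs_le.1 (hb c τ hc.1 h3 h2); linarith

lemma l1_conv {a b C : ℝ} (hC : ∀ τ ∈ Set.Icc a b, ∫ x, S.u τ x ^ 2 ∂muQ d ≤ C) {e : ℝ}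
    (he : e ∈ Set.Icc a b) {σ : ℕ → ℝ} (hσ : ∀ n, σ n ∈ Set.Icc a b)
    (hσe : Tendsto σ atTop (nhds e)) :
    Tendsto (fun n => ∫ x, |S.u (σ n) x - S.u e x| ∂muQ d) atTop (nhds 0) := by
  refine tendsto_L1_of_L2 (fun n => (S.u_cont _).sub (S.u_cont _)) (2 * C + 2 * C)
    (Eventually.of_forall fun n => ?_) fun x => ?_
  · have c1 := S.u_cont (σ n)
    have c2 := S.u_cont e
    have : ∫ x, (S.u (σ n) x - S.u e x) ^ 2 ∂muQ d
        ≤ ∫ x, (2 * S.u (σ n) x ^ 2 + 2 * S.u e x ^ 2) ∂muQ d := by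
      refine integral_mono (cont_int (by fun_prop)) (cont_int (by fun_prop)) fun x => ?_
      simp only
      nlinarith [sq_nonneg (S.u (σ n) x + S.u e x)]
    rw [integral_add (cont_int (by fun_prop)) (cont_int (by fun_prop)), integral_const_mul,
      integral_const_mul] at this
    have h1 := hC _ (hσ n)
    have h2 := hC e he
    linarith
  · have h1 : Tendsto (fun n => S.u (σ n) x) atTop (nhds (S.u e x)) :=
      ((S.u_tcont x).tendsto e).comp hσe
    simpa using h1.sub_const (S.u e x)

/-- convergence of quadratic functionals -/
lemma full_conv {χ φ : (Fin d → ℝ) → ℝ} (hχ : Tst χ) (hφ : Tst φ) {e : ℝ} {σ : ℕ → ℝ}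
    (h1 : Tendsto (fun n => ∫ x, |S.u (σ n) x - S.u e x| ∂muQ d) atTop (nhds 0))
    (h2 : (∀ x, χ x = 0) ∨
      Tendsto (fun n => ∫ x, (S.u (σ n) x - S.u e x) ^ 2 ∂muQ d) atTop (nhds 0)) :
    Tendsto (fun n => ∫ x, (χ x * S.u (σ n) x ^ 2 + φ x * S.u (σ n) x) ∂muQ d) atTop
      (nhds (∫ x, (χ x * S.u e x ^ 2 + φ x * S.u e x) ∂muQ d)) := by
  obtain ⟨A, hA0, hA1, -⟩ := hχ.bdd
  obtain ⟨B, hB0, hB1, -⟩ := hφ.bdd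
  obtain ⟨D, hD0, hD1, -⟩ := (S.tst_u e).bdd
  have cχ := hχ.1.continuous
  have cφ := hφ.1.continuous
  have ce := S.u_cont e
  have hb : ∃ A', 0 ≤ A' ∧ (∀ x, |χ x| ≤ A') ∧ Tendsto (fun n => A' * ∫ x, (S.u (σ n) x
      - S.u e x) ^ 2 ∂muQ d) atTop (nhds 0) := by
    rcases h2 with h2 | h2
    · exact ⟨0, le_rfl, fun x => by simp [h2 x], by simp⟩
    · exact ⟨A, hA0, hA1, by simpa using h2.const_mul A⟩
  obtain ⟨A', hA'0, hA'1, hlim⟩ := hb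
  have hlim2 : Tendsto (fun n => A' * (∫ x, (S.u (σ n) x - S.u e x) ^ 2 ∂muQ d)
      + (A' * (2 * D) + B) * ∫ x, |S.u (σ n) x - S.u e x| ∂muQ d) atTop (nhds 0) := by
    simpa using hlim.add (h1.const_mul (A' * (2 * D) + B))
  rw [tendsto_iff_norm_sub_tendsto_zero]
  refine squeeze_zero (fun n => norm_nonneg _) (fun n => ?_) hlim2
  have cn := S.u_cont (σ n)
  rw [← integral_sub (cont_int (by fun_prop)) (cont_int (by fun_prop)), ← integral_const_mul,
    ← integral_const_mul, ← integral_add (cont_int (by fun_prop)) (cont_int (by fun_prop))]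
  refine (norm_integral_le_integral_norm _).trans ?_
  refine integral_mono (cont_int (by fun_prop)) (cont_int (by fun_prop)) fun x => ?_
  simp only [Real.norm_eq_abs]
  set v := S.u (σ n) x - S.u e x with hv
  have e1 : χ x * S.u (σ n) x ^ 2 + φ x * S.u (σ n) x - (χ x * S.u e x ^ 2 + φ x * S.u e x)
      = χ x * v ^ 2 + χ x * (2 * S.u e x) * v + φ x * v := by rw [hv]; ring
  rw [e1]
  have t1 : |χ x * v ^ 2| ≤ A' * v ^ 2 := by
    rw [abs_mul, abs_of_nonneg (sq_nonneg v)]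
    have := hA'1 x
    gcongr
  have t2 : |χ x * (2 * S.u e x) * v| ≤ A' * (2 * D) * |v| := by
    rw [abs_mul, abs_mul, abs_mul, abs_of_pos (by norm_num : (0:ℝ) < 2)]
    have := hA'1 x
    have := hD1 x
    gcongr
  have t3 : |φ x * v| ≤ B * |v| := by
    rw [abs_mul]; have := hB1 x; gcongr
  have := abs_add_le (χ x * v ^ 2 + χ x * (2 * S.u e x) * v) (φ x * v)
  have := abs_add_le (χ x * v ^ 2) (χ x * (2 * S.u e x) * v)
  linarith

lemma weak_bd {α β : ℝ} (hα : 0 ≤ α) (hab : α ≤ β) (hI : IntegrableOn S.hb (Set.Icc α β))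
    {φ : (Fin d → ℝ) → ℝ} (hφ : Tst φ) {s t : ℝ} (hs : α ≤ s) (hst : s ≤ t) (ht : t ≤ β)
    (h : S.Idn s t (fun _ => 0) φ) :
    |(∫ x, φ x * S.u t x ∂muQ d) - ∫ x, φ x * S.u s x ∂muQ d| ≤
      (1 / 2) * (∫ τ in α..β, ∫ x, nsq (S.F τ x) ∂muQ d)
        + (1 / 2) * ((β - α) * ∫ x, nsq (pgrad φ x) ∂muQ d) := by
  unfold Idn at h
  simp only [zero_mul, zero_add] at h
  rw [h, abs_neg]
  set W := ∫ x, nsq (pgrad φ x) ∂muQ d with hW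
  have hW0 : 0 ≤ W := integral_nonneg fun x => nsq_nonneg _
  set J : ℝ → ℝ := fun τ => (1 / 2) * (∫ x, nsq (S.F τ x) ∂muQ d) + (1 / 2) * W with hJ
  have hFi : IntervalIntegrable (fun τ => ∫ x, nsq (S.F τ x) ∂muQ d) volume α β :=
    (intervalIntegrable_iff_integrableOn_Icc_of_le hab).2 (S.int_F hα hab hI)
  have hJi : IntervalIntegrable J volume α β := (hFi.const_mul _).add intervalIntegrable_const
  have hJ0 : ∀ τ, 0 ≤ J τ := fun τ => by
    have : 0 ≤ ∫ x, nsq (S.F τ x) ∂muQ d := integral_nonneg fun x => nsq_nonneg _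
    simp only [hJ]; positivity
  have c1 : Continuous fun x => nsq (pgrad φ x) := continuous_nsq.comp (cont_pgrad hφ.1)
  have h1 : |∫ τ in s..t, ∫ x, S.q (fun _ => 0) φ τ x ∂muQ d| ≤ ∫ τ in s..t, J τ := by
    rw [← Real.norm_eq_abs]
    refine intervalIntegral.norm_integral_le_of_norm_le hst (Eventually.of_forall fun τ hτ => ?_)
      (hJi.mono_set (by
        rw [Set.uIcc_of_le hst, Set.uIcc_of_le hab]; exact Set.Icc_subset_Icc hs ht))
    refine (norm_integral_le_integral_norm _).trans ?_
    simp only [hJ, hW]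
    rw [← integral_const_mul, ← integral_const_mul, ← integral_add
      ((cont_int (S.cont_nsqF τ)).const_mul _) ((cont_int c1).const_mul _)]
    refine integral_mono (cont_int (S.q_cont (Tst.const 0) hφ τ)).norm
      (((cont_int (S.cont_nsqF τ)).const_mul _).add ((cont_int c1).const_mul _)) fun x => ?_
    simp only [q, pgrad_const, smul_zero, add_zero, mul_zero, zero_smul, zero_add,
      Real.norm_eq_abs]
    have := dot_le_half (S.F τ x) (pgrad φ x)
    linarith
  refine h1.trans ((intervalIntegral.integral_mono_interval hs hst ht
    (Eventually.of_forall hJ0) hJi).trans (le_of_eq ?_))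
  simp only [hJ]
  rw [intervalIntegral.integral_add (hFi.const_mul _) intervalIntegrable_const,
    intervalIntegral.integral_const_mul, intervalIntegral.integral_const, smul_eq_mul]
  ring

lemma l2_pick {α β : ℝ} (hα : 0 ≤ α) (hab : α < β) (hI : IntegrableOn S.hb (Set.Icc α β))
    (h : ∀ s t, α ≤ s → s ≤ t → t ≤ β → ∀ φ, Tst φ → S.Idn s t (fun _ => 0) φ)
    {e : ℝ} (he : e ∈ Set.Icc α β) :
    ∃ s ∈ Set.Ioo α β, ∫ x, (S.u s x - S.u e x) ^ 2 ∂muQ d ≤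
      (1 / 2) * (∫ τ in α..β, ∫ x, nsq (S.F τ x) ∂muQ d)
        + (1 / 2) * (∫ τ in α..β, (2 * (∫ x, nsq (S.Du τ x) ∂muQ d)
          + 2 * ∫ x, nsq (S.Du e x) ∂muQ d)) := by
  obtain ⟨s, hs, hsm⟩ := exists_le_mean hab (f := fun τ => 2 * (∫ x, nsq (S.Du τ x) ∂muQ d)
          + 2 * ∫ x, nsq (S.Du e x) ∂muQ d) (by
    exact ((S.int_Du hα hab.le hI).const_mul 2).add continuous_const.integrableOn_Icc)
  refine ⟨s, hs, ?_⟩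
  have hφ : Tst fun x => S.u s x - S.u e x := (S.tst_u s).sub (S.tst_u e)
  have hg : ∫ x, nsq (pgrad (fun x => S.u s x - S.u e x) x) ∂muQ d ≤
      2 * (∫ x, nsq (S.Du s x) ∂muQ d) + 2 * ∫ x, nsq (S.Du e x) ∂muQ d := by
    rw [← integral_const_mul, ← integral_const_mul, ← integral_add
      ((cont_int (S.cont_nsqDu s)).const_mul _) ((cont_int (S.cont_nsqDu e)).const_mul _)]
    refine integral_mono (cont_int (continuous_nsq.comp (cont_pgrad hφ.1)))
      (((cont_int (S.cont_nsqDu s)).const_mul _).add ((cont_int (S.cont_nsqDu e)).const_mul _))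
      fun x => ?_
    simp only [pgrad_sub (S.u_C1 s) (S.u_C1 e)]
    exact nsq_sub_le _ _
  have c1 := S.u_cont s
  have c2 := S.u_cont e
  have e1 : ∫ x, (S.u s x - S.u e x) ^ 2 ∂muQ d = (∫ x, (S.u s x - S.u e x) * S.u s x ∂muQ d)
      - ∫ x, (S.u s x - S.u e x) * S.u e x ∂muQ d := by
    rw [← integral_sub (cont_int (by fun_prop)) (cont_int (by fun_prop))]
    refine integral_congr_ae (Eventually.of_forall fun x => ?_)
    simp only; ring
  have hbd : |(∫ x, (S.u s x - S.u e x) * S.u s x ∂muQ d)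
      - ∫ x, (S.u s x - S.u e x) * S.u e x ∂muQ d| ≤
      (1 / 2) * (∫ τ in α..β, ∫ x, nsq (S.F τ x) ∂muQ d)
        + (1 / 2) * ((β - α) * ∫ x, nsq (pgrad (fun x => S.u s x - S.u e x) x) ∂muQ d) := by
    rcases le_total s e with hse | hse
    · rw [abs_sub_comm]
      exact S.weak_bd hα hab.le hI hφ hs.1.le hse he.2 (h _ _ hs.1.le hse he.2 _ hφ)
    · exact S.weak_bd hα hab.le hI hφ he.1 hse hs.2.le (h _ _ he.1 hse hs.2.le _ hφ)
  rw [e1]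
  refine (le_abs_self _).trans (hbd.trans ?_)
  have : 0 < β - α := by linarith
  have h3 := mul_le_mul_of_nonneg_left hg this.le
  linarith

end Sys

end partE3

section partE4

lemma small_int {f : ℝ → ℝ} {a b e : ℝ} (hab : a ≤ b) (hf : IntegrableOn f (Set.Icc a b))
    (he : e ∈ Set.Icc a b) {α β : ℕ → ℝ} (hα : ∀ n, α n ∈ Set.Icc a b)
    (hβ : ∀ n, β n ∈ Set.Icc a b) (hαe : Tendsto α atTop (nhds e))
    (hβe : Tendsto β atTop (nhds e)) :
    Tendsto (fun n => ∫ τ in α n..β n, f τ) atTop (nhds 0) := by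
  have hQ : IntervalIntegrable f volume a b :=
    (intervalIntegrable_iff_integrableOn_Icc_of_le hab).2 hf
  set P : ℝ → ℝ := fun t => ∫ τ in a..t, f τ with hP
  have hPc : ContinuousOn P (Set.Icc a b) := by
    have := intervalIntegral.continuousOn_primitive_interval' hQ Set.left_mem_uIcc
    rwa [Set.uIcc_of_le hab] at this
  have hsub : ∀ {s t}, s ∈ Set.Icc a b → t ∈ Set.Icc a b → IntervalIntegrable f volume s t :=
    fun hs ht => hQ.mono_set (by
      rw [Set.uIcc_of_le hab]; exact Set.uIcc_subset_Icc hs ht)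
  have hPd : ∀ n, ∫ τ in α n..β n, f τ = P (β n) - P (α n) := by
    intro n
    have ha : a ∈ Set.Icc a b := ⟨le_rfl, hab⟩
    simp only [hP]
    rw [intervalIntegral.integral_interval_sub_left (hsub ha (hβ n)) (hsub ha (hα n))]
  simp only [hPd]
  have h1 : ∀ {σ : ℕ → ℝ}, (∀ n, σ n ∈ Set.Icc a b) → Tendsto σ atTop (nhds e) →
      Tendsto (fun n => P (σ n)) atTop (nhds (P e)) := fun h1 h2 =>
    (hPc e he).tendsto.comp (tendsto_nhdsWithin_iff.2 ⟨h2, Eventually.of_forall h1⟩)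
  simpa using (h1 hβ hβe).sub (h1 hα hαe)

lemma delta_seq {a b : ℝ} (hab : a < b) : ∃ δ : ℕ → ℝ, (∀ n, 0 < δ n) ∧ (∀ n, δ n < b - a) ∧
    Tendsto δ atTop (nhds 0) := by
  have hba : 0 < b - a := by linarith
  refine ⟨fun n => (b - a) / (n + 2), fun n => by positivity, fun n => ?_, ?_⟩
  · rw [div_lt_iff₀ (by positivity)]
    have : (0 : ℝ) ≤ n := Nat.cast_nonneg n
    nlinarith
  · exact tendsto_const_nhds.div_atTop
      (tendsto_atTop_add_const_right _ _ tendsto_natCast_atTop_atTop)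

namespace Sys

variable {d : ℕ} (S : Sys d)

lemma l2_seq {a b : ℝ} (ha : 0 ≤ a) (hab : a ≤ b) (hI : IntegrableOn S.hb (Set.Icc a b))
    (h : ∀ s t, a ≤ s → s ≤ t → t ≤ b → ∀ φ, Tst φ → S.Idn s t (fun _ => 0) φ)
    {e : ℝ} {α β : ℕ → ℝ} (hα : ∀ n, a ≤ α n) (hαβ : ∀ n, α n < β n) (hβ : ∀ n, β n ≤ b)
    (he : ∀ n, e ∈ Set.Icc (α n) (β n)) (hαe : Tendsto α atTop (nhds e))
    (hβe : Tendsto β atTop (nhds e)) :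
    ∃ σ : ℕ → ℝ, (∀ n, σ n ∈ Set.Ioo (α n) (β n)) ∧ Tendsto σ atTop (nhds e) ∧
      Tendsto (fun n => ∫ x, (S.u (σ n) x - S.u e x) ^ 2 ∂muQ d) atTop (nhds 0) := by
  have hp := fun n => S.l2_pick (ha.trans (hα n)) (hαβ n)
    (hI.mono_set (Set.Icc_subset_Icc (hα n) (hβ n)))
    (fun s t hs hst ht => h s t ((hα n).trans hs) hst (ht.trans (hβ n))) (he n)
  choose σ hσ hσb using hp
  refine ⟨σ, hσ, ?_, ?_⟩
  · exact tendsto_of_tendsto_of_tendsto_of_le_of_le hαe hβe (fun n => (hσ n).1.le)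
      fun n => (hσ n).2.le
  · have he' : e ∈ Set.Icc a b := ⟨(hα 0).trans (he 0).1, (he 0).2.trans (hβ 0)⟩
    have hα' : ∀ n, α n ∈ Set.Icc a b := fun n => ⟨hα n, (hαβ n).le.trans (hβ n)⟩
    have hβ' : ∀ n, β n ∈ Set.Icc a b := fun n => ⟨(hα n).trans (hαβ n).le, hβ n⟩
    have l1 := small_int hab (S.int_F ha hab hI) he' hα' hβ' hαe hβe
    have l2 := small_int hab (f := fun τ => 2 * (∫ x, nsq (S.Du τ x) ∂muQ d)
          + 2 * ∫ x, nsq (S.Du e x) ∂muQ d)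
      (((S.int_Du ha hab hI).const_mul 2).add continuous_const.integrableOn_Icc)
      he' hα' hβ' hαe hβe
    refine squeeze_zero (fun n => integral_nonneg fun x => sq_nonneg _) hσb ?_
    have := (l1.const_mul (1 / 2 : ℝ)).add (l2.const_mul (1 / 2 : ℝ))
    rw [mul_zero, add_zero] at this
    exact this

/-- The gap lemma. -/
lemma gap_good {a b : ℝ} (ha : 0 ≤ a) (hab : a < b)
    (h : ∀ s t, a < s → s ≤ t → t < b → S.Id s t) :
    ∀ s t, a ≤ s → s ≤ t → t ≤ b → S.Id s t := by
  have hI := S.gap_hb ha hab h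
  obtain ⟨C, hC⟩ := S.gap_l2 ha hab hI h
  obtain ⟨δ, hδ0, hδ1, hδt⟩ := delta_seq hab
  have hat : Tendsto (fun n => a + δ n) atTop (nhds a) := by simpa using hδt.const_add a
  have hbt : Tendsto (fun n => b - δ n) atTop (nhds b) := by simpa using hδt.const_sub b
  have hamem : a ∈ Set.Icc a b := ⟨le_rfl, hab.le⟩
  have hbmem : b ∈ Set.Icc a b := ⟨hab.le, le_rfl⟩
  have hweak : ∀ s t, a ≤ s → s ≤ t → t ≤ b → ∀ φ, Tst φ → S.Idn s t (fun _ => 0) φ := by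
    intro s t hs hst ht φ hφ
    have hz : Tst (fun _ : Fin d → ℝ => (0 : ℝ)) := Tst.const 0
    have hσ : ∀ n, a + δ n ∈ Set.Ioo a b := fun n => ⟨by linarith [hδ0 n], by linarith [hδ1 n]⟩
    have hτ : ∀ n, b - δ n ∈ Set.Ioo a b := fun n => ⟨by linarith [hδ1 n], by linarith [hδ0 n]⟩
    exact ext_ident hab (S.int_q ha hab.le hI ⟨C, hC⟩ hz hφ)
      (f := fun t => ∫ x, ((fun _ : Fin d → ℝ => (0 : ℝ)) x * S.u t x ^ 2 + φ x * S.u t x) ∂muQ d)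
      (fun s t hs hst ht => (h s t hs hst ht).2.2 _ φ hz hφ) hσ hat
      (S.full_conv hz hφ (S.l1_conv hC hamem (fun n => Set.Ioo_subset_Icc_self (hσ n)) hat)
        (Or.inl fun _ => rfl)) hτ hbt
      (S.full_conv hz hφ (S.l1_conv hC hbmem (fun n => Set.Ioo_subset_Icc_self (hτ n)) hbt)
        (Or.inl fun _ => rfl)) s t hs hst ht
  obtain ⟨σ, hσ, hσa, hσl⟩ := S.l2_seq ha hab.le hI hweak (e := a) (α := fun _ => a)
    (β := fun n => a + δ n) (fun n => le_rfl) (fun n => by linarith [hδ0 n])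
    (fun n => by linarith [hδ1 n]) (fun n => ⟨le_rfl, by linarith [hδ0 n]⟩)
    tendsto_const_nhds hat
  obtain ⟨τ, hτ, hτb, hτl⟩ := S.l2_seq ha hab.le hI hweak (e := b) (β := fun _ => b)
    (α := fun n => b - δ n) (fun n => by linarith [hδ1 n]) (fun n => by linarith [hδ0 n])
    (fun n => le_rfl) (fun n => ⟨by linarith [hδ0 n], le_rfl⟩) hbt
    tendsto_const_nhds
  have hσ' : ∀ n, σ n ∈ Set.Ioo a b := fun n => ⟨(hσ n).1, by linarith [(hσ n).2, hδ1 n]⟩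
  have hτ' : ∀ n, τ n ∈ Set.Ioo a b := fun n => ⟨by linarith [(hτ n).1, hδ1 n], (hτ n).2⟩
  intro s t hs hst ht
  refine ⟨hI.mono_set (Set.Icc_subset_Icc hs ht),
    ⟨C, fun τ hτ => hC τ ⟨hs.trans hτ.1, hτ.2.trans ht⟩⟩, fun χ φ hχ hφ => ?_⟩
  exact ext_ident hab (S.int_q ha hab.le hI ⟨C, hC⟩ hχ hφ)
    (f := fun t => ∫ x, (χ x * S.u t x ^ 2 + φ x * S.u t x) ∂muQ d)
    (fun s t hs hst ht => (h s t hs hst ht).2.2 _ φ hχ hφ) hσ' hσa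
    (S.full_conv hχ hφ (S.l1_conv hC hamem (fun n => Set.Ioo_subset_Icc_self (hσ' n)) hσa)
      (Or.inr hσl)) hτ' hτb
    (S.full_conv hχ hφ (S.l1_conv hC hbmem (fun n => Set.Ioo_subset_Icc_self (hτ' n)) hτb)
      (Or.inr hτl)) s t hs hst ht

end Sys

end partE4

section partF1

namespace Sys

variable {d : ℕ} (S : Sys d)

/-- a reference state -/
structure Ref (d : ℕ) where
  M : (Fin d → ℝ) → ℝ
  U : (Fin d → ℝ) → ℝ
  M_reg : ContDiff ℝ 1 M
  M_per : ZPeriodic M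
  M_pos : ∀ x, 0 < M x
  U_reg : ContDiff ℝ 2 U
  U_per : ZPeriodic U

noncomputable def refAt (a : ℝ) : Ref d :=
  ⟨S.m a, S.u a, S.m_reg a, S.m_per a, S.m_pos a, S.u_reg a, S.u_per a⟩

noncomputable def rF (R : Ref d) (x : Fin d → ℝ) : Fin d → ℝ := R.M x • S.b x (pgrad R.U x)
noncomputable def rg (R : Ref d) (x : Fin d → ℝ) : ℝ :=
  S.h x (pgrad R.U x) - S.κ * Real.log (R.M x)
noncomputable def Dfun (R : Ref d) (t : ℝ) : ℝ :=
  ∫ x, ((1 / 2) * (S.u t x - R.U x) ^ 2 + R.M x * (Real.log (R.M x) - S.l t x)) ∂muQ d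
noncomputable def rr (R : Ref d) (t : ℝ) : ℝ :=
  ∫ x, (- dot (S.F t x) (S.Du t x - pgrad R.U x) - R.M x * S.g t x) ∂muQ d
noncomputable def diss (R : Ref d) (t : ℝ) : ℝ :=
  ∫ x, (S.ρ / 2 * (R.M x * nsq (S.Du t x - pgrad R.U x)) + S.κ * breg (S.m t x) (R.M x)) ∂muQ d
noncomputable def rem (R : Ref d) (t : ℝ) : ℝ :=
  ∫ x, ((S.u t x - R.U x) * pdiv (S.rF R) x + (S.m t x - R.M x) * S.rg R x) ∂muQ d

lemma Ref.U_C1 (R : Ref d) : ContDiff ℝ 1 R.U := R.U_reg.of_le (by norm_num)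
lemma Ref.DU_C1 (R : Ref d) : ContDiff ℝ 1 (pgrad R.U) := by
  refine contDiff_pi.2 fun i => ?_
  have : ContDiff ℝ 1 (fderiv ℝ R.U) := R.U_reg.fderiv_right (by norm_num)
  exact this.clm_apply contDiff_const
lemma Ref.DU_cont (R : Ref d) : Continuous (pgrad R.U) := R.DU_C1.continuous
lemma Ref.U_cont (R : Ref d) : Continuous R.U := R.U_C1.continuous
lemma Ref.M_cont (R : Ref d) : Continuous R.M := R.M_reg.continuous
lemma Ref.L_cont (R : Ref d) : Continuous fun x => Real.log (R.M x) :=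
  R.M_cont.log fun x => (R.M_pos x).ne'
lemma rF_C1 (R : Ref d) : ContDiff ℝ 1 (S.rF R) :=
  R.M_reg.smul (S.b_C1.comp (contDiff_id.prodMk R.DU_C1))
lemma rF_per (R : Ref d) (z : Fin d → ℤ) (x : Fin d → ℝ) :
    S.rF R (x + fun i => (z i : ℝ)) = S.rF R x := by
  simp only [rF, R.M_per z x, per_pgrad R.U_per z x, S.b_per]
lemma rh_cont (R : Ref d) : Continuous fun x => S.h x (pgrad R.U x) :=
  S.h_cont.comp (continuous_id.prodMk R.DU_cont)
lemma rg_cont (R : Ref d) : Continuous (S.rg R) :=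
  (S.rh_cont R).sub (continuous_const.mul R.L_cont)
lemma g_cont (t : ℝ) : Continuous (S.g t) :=
  ((S.hh_cont t).sub continuous_const).sub (continuous_const.mul (S.l_cont t))

lemma rr_le (R : Ref d) (t : ℝ) (hmass : ∫ x, S.m t x ∂muQ d = ∫ x, R.M x ∂muQ d) :
    S.rr R t ≤ - S.diss R t + S.rem R t := by
  have c1 := S.F_cont t
  have c2 := S.Du_cont t
  have c3 := R.DU_cont
  have c4 := R.M_cont
  have c5 := S.g_cont t
  have c6 := S.m_cont t
  have c7 := S.u_cont t
  have c8 := R.U_cont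
  have c9 := cont_pdiv (S.rF_C1 R)
  have c10 := S.rg_cont R
  have c11 := (S.rF_C1 R).continuous
  have c12 := S.l_cont t
  have c13 := R.L_cont
  have cd1 : Continuous fun x => dot (S.F t x) (S.Du t x - pgrad R.U x) := c1.dot' (c2.sub c3)
  have cd2 : Continuous fun x => dot (S.rF R x) (S.Du t x - pgrad R.U x) := c11.dot' (c2.sub c3)
  have cn : Continuous fun x => nsq (S.Du t x - pgrad R.U x) := (c2.sub c3).nsq'
  have cb : Continuous fun x => breg (S.m t x) (R.M x) := by
    unfold breg
    exact (c6.sub c4).add (c4.mul (c13.sub c12))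
  have hv : Tst fun x => S.u t x - R.U x := (S.tst_u t).sub ⟨R.U_C1, R.U_per⟩
  have hib := ibp hv.2 hv.1 (S.rF_per R) (S.rF_C1 R)
  have hib' : ∫ x, (S.u t x - R.U x) * pdiv (S.rF R) x ∂muQ d
      = - ∫ x, dot (S.rF R x) (S.Du t x - pgrad R.U x) ∂muQ d := by
    rw [hib]; congr 1
    refine integral_congr_ae (ae_of_all _ fun x => ?_)
    change dot _ _ = dot _ _
    rw [pgrad_sub (S.u_C1 t) R.U_C1]; rfl
  have e1 : S.rr R t = S.rr R t + (∫ x, S.m t x * S.g t x ∂muQ d)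
      + S.hb t * ((∫ x, S.m t x ∂muQ d) - ∫ x, R.M x ∂muQ d) := by
    rw [S.int_mg t, hmass]; ring
  have e2 : S.rem R t = (∫ x, (S.m t x - R.M x) * S.rg R x ∂muQ d)
      - ∫ x, dot (S.rF R x) (S.Du t x - pgrad R.U x) ∂muQ d := by
    rw [rem, integral_add (cont_int (by fun_prop)) (cont_int (by fun_prop)), hib']; ring
  rw [e1, e2, rr, diss, ← integral_sub (cont_int c6) (cont_int c4), ← integral_const_mul,
    ← integral_add (cont_int (by fun_prop)) (cont_int (by fun_prop)),
    ← integral_add (cont_int (by fun_prop)) (cont_int (by fun_prop)),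
    ← integral_sub (cont_int (by fun_prop)) (cont_int (by fun_prop)), ← integral_neg,
    ← integral_add (cont_int (by fun_prop)) (cont_int (by fun_prop))]
  refine integral_mono (cont_int (by fun_prop)) (cont_int (by fun_prop)) fun x => ?_
  have hm := S.m_pos t x
  have hM := R.M_pos x
  have k1 := S.conv x (S.Du t x) (pgrad R.U x)
  have k2 := S.conv x (pgrad R.U x) (S.Du t x)
  have k3 := mul_le_mul_of_nonneg_left (breg_le hm hM) S.hκ.le
  have k4 : nsq (pgrad R.U x - S.Du t x) = nsq (S.Du t x - pgrad R.U x) := by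
    rw [← nsq_neg]; congr 1; abel
  have k5 : dot (S.b x (S.Du t x)) (pgrad R.U x - S.Du t x)
      = - dot (S.b x (S.Du t x)) (S.Du t x - pgrad R.U x) := by
    simp only [dot_sub]; ring
  have k6 : dot (S.F t x) (S.Du t x - pgrad R.U x)
      = S.m t x * dot (S.b x (S.Du t x)) (S.Du t x - pgrad R.U x) := smul_dot _ _ _
  have k7 : dot (S.rF R x) (S.Du t x - pgrad R.U x)
      = R.M x * dot (S.b x (pgrad R.U x)) (S.Du t x - pgrad R.U x) := smul_dot _ _ _
  rw [k4, k5] at k1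
  have k1' := mul_le_mul_of_nonneg_left k1 hm.le
  have k2' := mul_le_mul_of_nonneg_left k2 hM.le
  have k8 : 0 ≤ S.ρ / 2 * (S.m t x * nsq (S.Du t x - pgrad R.U x)) :=
    mul_nonneg (by have := S.hρ; positivity) (mul_nonneg hm.le (nsq_nonneg _))
  have hl : Real.log (S.m t x) = S.l t x := rfl
  simp only [rg, g, hh] at *
  rw [k6, k7]
  rw [hl] at k3
  nlinarith

lemma D_id (R : Ref d) {s t : ℝ} (hs : 0 ≤ s) (hst : s ≤ t) (h : S.Id s t) :
    IntervalIntegrable (S.rr R) volume s t ∧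
    S.Dfun R t - S.Dfun R s = ∫ τ in s..t, S.rr R τ := by
  obtain ⟨hI, hC, hid⟩ := h
  have hφ : Tst fun x => - R.U x := Tst.neg ⟨R.U_C1, R.U_per⟩
  have h1 := hid (fun _ => 1 / 2) (fun x => - R.U x) (Tst.const _) hφ
  have h2 := S.int_l hs hst hI R.M_cont R.M_per
  have i1 := S.int_q hs hst hI hC (Tst.const (1 / 2)) hφ
  have i2 : IntervalIntegrable (fun τ => ∫ x, R.M x * S.g τ x ∂muQ d) volume s t := by
    obtain ⟨A, hA⟩ := per_bdd R.M_per R.M_cont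
    have : Integrable (fun p : ℝ × (Fin d → ℝ) => R.M p.2 * S.g p.1 p.2) (pm d s t) :=
      (S.pm_g hs hst hI).bdd_mul (c := A)
        (R.M_cont.measurable.comp measurable_snd).aestronglyMeasurable
        (ae_of_all _ fun p => hA p.2)
    rw [intervalIntegrable_iff_integrableOn_Icc_of_le hst]
    exact this.integral_prod_left
  have er : ∀ τ, S.rr R τ = - (∫ x, S.q (fun _ => 1 / 2) (fun x => - R.U x) τ x ∂muQ d)
      - ∫ x, R.M x * S.g τ x ∂muQ d := by
    intro τ
    rw [← integral_neg, ← integral_sub]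
    · refine integral_congr_ae (ae_of_all _ fun x => ?_)
      simp only [q, pgrad_const, pgrad_neg, smul_zero, add_zero]
      norm_num
      rw [← sub_eq_add_neg]
    · exact (cont_int (S.q_cont (Tst.const _) hφ τ)).neg
    · exact cont_int (R.M_cont.mul (S.g_cont τ))
  have eD : ∀ τ, S.Dfun R τ = (∫ x, (1 / 2 * S.u τ x ^ 2 + (- R.U x) * S.u τ x) ∂muQ d)
      - (∫ x, R.M x * S.l τ x ∂muQ d)
      + ∫ x, (1 / 2 * R.U x ^ 2 + R.M x * Real.log (R.M x)) ∂muQ d := by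
    intro τ
    have c7 := S.u_cont τ
    have c8 := R.U_cont
    have c4 := R.M_cont
    have c12 := S.l_cont τ
    have c13 := R.L_cont
    rw [← integral_sub (cont_int (by fun_prop)) (cont_int (by fun_prop)),
      ← integral_add (cont_int (by fun_prop)) (cont_int (by fun_prop))]
    refine integral_congr_ae (ae_of_all _ fun x => ?_)
    ring
  refine ⟨?_, ?_⟩
  · refine (i1.neg.sub i2).congr ?_
    exact fun τ _ => (er τ).symm
  · simp only [er]
    have i1n : IntervalIntegrable
        (fun τ => - ∫ x, S.q (fun _ => 1 / 2) (fun x => - R.U x) τ x ∂muQ d) volume s t := i1.neg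
    rw [intervalIntegral.integral_sub i1n i2, intervalIntegral.integral_neg, ← h2, ← h1, eD, eD]
    ring

end Sys

end partF1

section partF2

namespace Sys

variable {d : ℕ} (S : Sys d)

/-- uniform bounds for the state at time `a` -/
structure Bd (C a : ℝ) : Prop where
  one : 1 ≤ C
  F : ∀ x, |pdiv (S.F a) x| ≤ C
  g : ∀ x, |S.hh a x - S.κ * S.l a x| ≤ C
  u : ∀ x, |S.u a x| ≤ C
  Du : ∀ x, nsq (S.Du a x) ≤ C
  mlow : ∀ x, 1 / C ≤ S.m a x
  mup : ∀ x, S.m a x ≤ C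

lemma Dfun_eq (R : Ref d) (t : ℝ) (hmass : ∫ x, S.m t x ∂muQ d = ∫ x, R.M x ∂muQ d) :
    S.Dfun R t = ∫ x, ((1 / 2) * (S.u t x - R.U x) ^ 2 + breg (S.m t x) (R.M x)) ∂muQ d := by
  have c4 := R.M_cont
  have c6 := S.m_cont t
  have c7 := S.u_cont t
  have c8 := R.U_cont
  have c12 := S.l_cont t
  have c13 := R.L_cont
  have cb : Continuous fun x => breg (S.m t x) (R.M x) := by
    unfold breg
    exact (c6.sub c4).add (c4.mul (c13.sub c12))
  have e : ∫ x, (S.m t x - R.M x) ∂muQ d = 0 := by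
    rw [integral_sub (cont_int c6) (cont_int c4), hmass, sub_self]
  rw [Dfun, ← add_zero (∫ x, _ ∂muQ d), ← e,
    ← integral_add (cont_int (by fun_prop)) (cont_int (by fun_prop))]
  refine integral_congr_ae (ae_of_all _ fun x => ?_)
  simp only [breg, l]; ring

lemma breg_cont (R : Ref d) (t : ℝ) : Continuous fun x => breg (S.m t x) (R.M x) := by
  unfold breg
  exact ((S.m_cont t).sub R.M_cont).add (R.M_cont.mul (R.L_cont.sub (S.l_cont t)))

lemma half_sq_le_D (R : Ref d) (t : ℝ) (hmass : ∫ x, S.m t x ∂muQ d = ∫ x, R.M x ∂muQ d) :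
    1 / 2 * ∫ x, (S.u t x - R.U x) ^ 2 ∂muQ d ≤ S.Dfun R t := by
  have c7 := S.u_cont t
  have c8 := R.U_cont
  have cb := S.breg_cont R t
  rw [S.Dfun_eq R t hmass, ← integral_const_mul]
  refine integral_mono (cont_int (by fun_prop)) (cont_int (by fun_prop)) fun x => ?_
  have := breg_nonneg (S.m_pos t x) (R.M_pos x)
  change _ ≤ _
  linarith

lemma D_nonneg (R : Ref d) (t : ℝ) (hmass : ∫ x, S.m t x ∂muQ d = ∫ x, R.M x ∂muQ d) :
    0 ≤ S.Dfun R t :=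
  le_trans (mul_nonneg (by norm_num) (integral_nonneg fun x => sq_nonneg _))
    (S.half_sq_le_D R t hmass)

lemma abs_le_sq {v θ : ℝ} (hθ : 0 < θ) : |v| ≤ θ / 2 + 1 / θ * (1 / 2 * v ^ 2) := by
  have h := sq_nonneg (|v| - θ)
  have h2 : |v| ^ 2 = v ^ 2 := sq_abs v
  have e : θ / 2 + 1 / θ * (1 / 2 * v ^ 2) = (θ ^ 2 + v ^ 2) / (2 * θ) := by field_simp
  rw [e, le_div_iff₀ (by positivity)]
  nlinarith

lemma rem_le {C a t θ : ℝ} (hB : S.Bd C a) (hθ : 0 < θ) (hθ1 : θ ≤ 1)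
    (hmass : ∫ x, S.m t x ∂muQ d = ∫ x, S.m a x ∂muQ d) :
    S.rem (S.refAt a) t ≤ 2 * C ^ 2 * (θ + S.Dfun (S.refAt a) t / θ) := by
  set R := S.refAt a with hR
  have c4 := R.M_cont
  have c6 := S.m_cont t
  have c7 := S.u_cont t
  have c8 := R.U_cont
  have c9 := cont_pdiv (S.rF_C1 R)
  have c10 := S.rg_cont R
  have cb := S.breg_cont R t
  have e : 2 * C ^ 2 * (θ + S.Dfun R t / θ) = ∫ x, (2 * C ^ 2 * θ + 2 * C ^ 2 / θ *
      ((1 / 2) * (S.u t x - R.U x) ^ 2 + breg (S.m t x) (R.M x))) ∂muQ d := by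
    rw [integral_add (cont_int (by fun_prop)) (cont_int (by fun_prop)),
      integral_const_mul (2 * C ^ 2 / θ), ← S.Dfun_eq R t hmass]
    simp only [integral_const, probReal_univ, one_smul]
    ring
  rw [e, rem]
  refine integral_mono (cont_int (by fun_prop)) (cont_int (by fun_prop)) fun x => ?_
  have hC := hB.one
  have b1 : |pdiv (S.rF R) x| ≤ C := hB.F x
  have b2 : |S.rg R x| ≤ C := hB.g x
  have b3 : R.M x ≤ C := hB.mup x
  have k1 := abs_le_sq (v := S.u t x - R.U x) hθ
  have k2 := abs_sub_le_breg (S.m_pos t x) (R.M_pos x) hθ hθ1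
  have k3 := breg_nonneg (S.m_pos t x) (R.M_pos x)
  have k4 : (S.u t x - R.U x) * pdiv (S.rF R) x ≤ C * |S.u t x - R.U x| := by
    refine (le_abs_self _).trans ?_
    rw [abs_mul, mul_comm]
    exact mul_le_mul_of_nonneg_right b1 (abs_nonneg _)
  have k5 : (S.m t x - R.M x) * S.rg R x ≤ C * |S.m t x - R.M x| := by
    refine (le_abs_self _).trans ?_
    rw [abs_mul, mul_comm]
    exact mul_le_mul_of_nonneg_right b2 (abs_nonneg _)
  have k6 := mul_le_mul_of_nonneg_left k1 (by linarith : (0 : ℝ) ≤ C)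
  have k7 := mul_le_mul_of_nonneg_left k2 (by linarith : (0 : ℝ) ≤ C)
  set A := 1 / 2 * (S.u t x - R.U x) ^ 2 with hA
  set B := breg (S.m t x) (R.M x) with hBB
  have hA0 : 0 ≤ A := by positivity
  set ι := 1 / θ with hι
  have hι0 : 0 ≤ ι := by positivity
  have e1 : 2 * C ^ 2 / θ = 2 * C ^ 2 * ι := by rw [hι]; ring
  have e2 : 2 / θ = 2 * ι := by rw [hι]; ring
  rw [e2] at k7
  change _ + _ ≤ 2 * C ^ 2 * θ + 2 * C ^ 2 / θ * (A + B)
  rw [e1]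
  have n1 : 0 ≤ C * (C - 1) * (ι * A) :=
    mul_nonneg (mul_nonneg (by linarith) (by linarith)) (mul_nonneg hι0 hA0)
  have n2 : 0 ≤ C * (C - 1) * (ι * B) :=
    mul_nonneg (mul_nonneg (by linarith) (by linarith)) (mul_nonneg hι0 k3)
  have n3 : 0 ≤ C * (ι * A) := mul_nonneg (by linarith) (mul_nonneg hι0 hA0)
  have n4 : C * (θ * R.M x) ≤ C * (θ * C) :=
    mul_le_mul_of_nonneg_left (mul_le_mul_of_nonneg_left b3 hθ.le) (by linarith)
  have n5 : 0 ≤ C * (C - 1) * θ :=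
    mul_nonneg (mul_nonneg (by linarith) (by linarith)) hθ.le
  have n6 : 0 ≤ C * θ := mul_nonneg (by linarith) hθ.le
  nlinarith

lemma diss_ge {C a : ℝ} (t : ℝ) (hB : S.Bd C a) :
    S.ρ / (4 * C) * (∫ x, nsq (S.Du t x) ∂muQ d) - S.ρ / 2 ≤ S.diss (S.refAt a) t := by
  set R := S.refAt a with hR
  have c4 := R.M_cont
  have cb := S.breg_cont R t
  have c2 := S.Du_cont t
  have c3 := R.DU_cont
  have cn : Continuous fun x => nsq (S.Du t x - pgrad R.U x) := (c2.sub c3).nsq'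
  have cm := S.cont_nsqDu t
  have e : S.ρ / (4 * C) * (∫ x, nsq (S.Du t x) ∂muQ d) - S.ρ / 2
      = ∫ x, (S.ρ / (4 * C) * nsq (S.Du t x) - S.ρ / 2) ∂muQ d := by
    rw [integral_sub (cont_int (by fun_prop)) (cont_int (by fun_prop)), integral_const_mul]
    simp
  rw [e, diss]
  refine integral_mono (cont_int (by fun_prop)) (cont_int (by fun_prop)) fun x => ?_
  have hC := hB.one
  have hρ := S.hρ
  have k1 := mul_nonneg S.hκ.le (breg_nonneg (S.m_pos t x) (R.M_pos x))
  have k2 : nsq (S.Du t x) ≤ 2 * nsq (S.Du t x - pgrad R.U x) + 2 * nsq (pgrad R.U x) := by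
    have := nsq_add_le (S.Du t x - pgrad R.U x) (pgrad R.U x)
    rwa [sub_add_cancel] at this
  have k3 : nsq (pgrad R.U x) ≤ C := hB.Du x
  have k4 : 1 / C ≤ R.M x := hB.mlow x
  have k5 := mul_le_mul_of_nonneg_right k4 (nsq_nonneg (S.Du t x - pgrad R.U x))
  have k6 : S.ρ / (4 * C) * nsq (S.Du t x)
      ≤ S.ρ / (4 * C) * (2 * nsq (S.Du t x - pgrad R.U x) + 2 * C) :=
    mul_le_mul_of_nonneg_left (by linarith) (by positivity)
  have k7 : S.ρ / (4 * C) * (2 * nsq (S.Du t x - pgrad R.U x) + 2 * C)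
      = S.ρ / 2 * (1 / C * nsq (S.Du t x - pgrad R.U x)) + S.ρ / 2 := by
    field_simp; ring
  have k8 := mul_le_mul_of_nonneg_left k5 (by positivity : 0 ≤ S.ρ / 2)
  change _ ≤ _
  linarith

/-- the frozen estimate -/
lemma frozen {C a b : ℝ} (hB : S.Bd C a) (ha : 0 ≤ a) (hab : a < b)
    (hh0 : 4 * C ^ 2 * (b - a) ≤ 1)
    (hid : ∀ τ, a ≤ τ → τ ≤ b → S.Id a τ) :
    ∫ x, |S.u b x - S.u a x| ∂muQ d ≤ (1 / 2 + 16 * C ^ 4) * (b - a) ∧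
    ∫ τ in Set.Icc a b, ∫ x, nsq (S.Du τ x) ∂muQ d
      ≤ 4 * C / S.ρ * (S.ρ / 2 + 4 * C ^ 2) * (b - a) ∧
    ∫ x, (S.u b x - S.u a x) ^ 2 ∂muQ d ≤ 2 := by
  set R := S.refAt a with hR
  set h := b - a with hh
  have hpos : 0 < h := sub_pos.2 hab
  have hC := hB.one
  have hρ := S.hρ
  set C1 := 2 * C ^ 2 with hC1
  have hC1p : 0 < C1 := by positivity
  set θ := 2 * C1 * h with hθ
  have hθp : 0 < θ := by positivity
  have hθ1 : θ ≤ 1 := by rw [hθ, hC1]; linarith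
  have hmass : ∀ τ, a ≤ τ → τ ≤ b → ∫ x, S.m τ x ∂muQ d = ∫ x, S.m a x ∂muQ d :=
    fun τ h1 h2 => S.mass_const ha h1 (hid τ h1 h2).1
  have hD0 : S.Dfun R a = 0 := by
    rw [S.Dfun_eq R a rfl]
    have : ∀ x, (1 / 2) * (S.u a x - R.U x) ^ 2 + breg (S.m a x) (R.M x) = 0 := by
      intro x
      change (1 / 2) * (S.u a x - S.u a x) ^ 2 + breg (S.m a x) (S.m a x) = 0
      simp [breg]
    simp only [this, integral_zero]
  have hD : ∀ τ, a ≤ τ → τ ≤ b → S.Dfun R τ = ∫ σ in a..τ, S.rr R σ := by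
    intro τ h1 h2
    have := (S.D_id R ha h1 (hid τ h1 h2)).2
    rw [hD0, sub_zero] at this
    exact this
  have hri := (S.D_id R ha hab.le (hid b hab.le le_rfl)).1
  have hcont : ContinuousOn (S.Dfun R) (Set.Icc a b) := by
    have := intervalIntegral.continuousOn_primitive_interval' hri Set.left_mem_uIcc
    rw [Set.uIcc_of_le hab.le] at this
    exact this.congr fun τ hτ => hD τ hτ.1 hτ.2
  obtain ⟨τ0, hτ0, hmax⟩ := isCompact_Icc.exists_isMaxOn ⟨a, le_rfl, hab.le⟩ hcont
  set Y := S.Dfun R τ0 with hY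
  have hY0 : 0 ≤ Y := S.D_nonneg R τ0 (hmass τ0 hτ0.1 hτ0.2)
  have hrem : ∀ τ ∈ Set.Icc a b, S.rem R τ ≤ C1 * (θ + Y / θ) := by
    intro τ hτ
    refine (S.rem_le hB hθp hθ1 (hmass τ hτ.1 hτ.2)).trans ?_
    have : S.Dfun R τ ≤ Y := hmax hτ
    gcongr
  have hrr : ∀ τ ∈ Set.Icc a b, S.rr R τ ≤ - S.diss R τ + C1 * (θ + Y / θ) := fun τ hτ =>
    (S.rr_le R τ (hmass τ hτ.1 hτ.2)).trans (by have := hrem τ hτ; linarith)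
  have hd0 : ∀ τ, 0 ≤ S.diss R τ := fun τ => integral_nonneg fun x =>
    add_nonneg (mul_nonneg (by positivity) (mul_nonneg (R.M_pos x).le (nsq_nonneg _)))
      (mul_nonneg S.hκ.le (breg_nonneg (S.m_pos τ x) (R.M_pos x)))
  have hE : h * (C1 * (θ + Y / θ)) = 2 * C1 ^ 2 * h ^ 2 + Y / 2 := by
    rw [hθ]; field_simp
  have hYle : Y ≤ 4 * C1 ^ 2 * h ^ 2 := by
    have h1 : Y ≤ ∫ σ in a..τ0, C1 * (θ + Y / θ) := by
      refine (hD τ0 hτ0.1 hτ0.2).le.trans ?_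
      refine intervalIntegral.integral_mono_on hτ0.1 ?_ intervalIntegrable_const fun σ hσ => ?_
      · exact hri.mono_set (by
          rw [Set.uIcc_of_le hτ0.1, Set.uIcc_of_le hab.le]
          exact Set.Icc_subset_Icc le_rfl hτ0.2)
      · have h2 := hrr σ ⟨hσ.1, hσ.2.trans hτ0.2⟩
        have h3 := hd0 σ
        linarith
    rw [intervalIntegral.integral_const, smul_eq_mul] at h1
    have h2 : (τ0 - a) * (C1 * (θ + Y / θ)) ≤ h * (C1 * (θ + Y / θ)) := by
      refine mul_le_mul_of_nonneg_right ?_ (by positivity)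
      have := hτ0.2
      linarith
    linarith
  have hC1h : C1 * h ≤ 1 / 2 := by rw [hC1]; linarith
  refine ⟨?_, ?_, ?_⟩
  · have hDb : S.Dfun R b ≤ Y := hmax ⟨hab.le, le_rfl⟩
    have h1 := S.half_sq_le_D R b (hmass b hab.le le_rfl)
    have c7 := S.u_cont b
    have c8 := S.u_cont a
    have h2 : ∫ x, |S.u b x - S.u a x| ∂muQ d
        ≤ ∫ x, (h / 2 + 1 / h * (1 / 2 * (S.u b x - S.u a x) ^ 2)) ∂muQ d :=
      integral_mono (cont_int (by fun_prop)) (cont_int (by fun_prop)) fun x => abs_le_sq hpos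
    rw [integral_add (cont_int (by fun_prop)) (cont_int (by fun_prop)), integral_const_mul,
      integral_const_mul] at h2
    simp only [integral_const, probReal_univ, one_smul] at h2
    have h3 : 1 / h * (1 / 2 * ∫ x, (S.u b x - S.u a x) ^ 2 ∂muQ d)
        ≤ 1 / h * (4 * C1 ^ 2 * h ^ 2) :=
      mul_le_mul_of_nonneg_left (h1.trans (hDb.trans hYle)) (by positivity)
    have h4 : 1 / h * (4 * C1 ^ 2 * h ^ 2) = 4 * C1 ^ 2 * h := by field_simp
    rw [h4] at h3
    have h5 : 4 * C1 ^ 2 = 16 * C ^ 4 := by rw [hC1]; ring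
    rw [h5] at h3
    linarith
  · have hIb := (hid b hab.le le_rfl).1
    have hDi : IntervalIntegrable (fun τ => ∫ x, nsq (S.Du τ x) ∂muQ d) volume a b := by
      rw [intervalIntegrable_iff_integrableOn_Icc_of_le hab.le]
      exact S.int_Du ha hab.le hIb
    have h1 : S.Dfun R b ≤ ∫ τ in a..b, (- (S.ρ / (4 * C)) * (∫ x, nsq (S.Du τ x) ∂muQ d)
        + (S.ρ / 2 + C1 * (θ + Y / θ))) := by
      rw [hD b hab.le le_rfl]
      refine intervalIntegral.integral_mono_on hab.le hri
        ((hDi.const_mul _).add intervalIntegrable_const) fun σ hσ => ?_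
      have h2 := hrr σ hσ
      have h3 := S.diss_ge σ hB
      linarith
    rw [intervalIntegral.integral_add (hDi.const_mul _) intervalIntegrable_const,
      intervalIntegral.integral_const_mul, intervalIntegral.integral_const, smul_eq_mul,
      intervalIntegral.integral_of_le hab.le, ← integral_Icc_eq_integral_Ioc] at h1
    have h0 := S.D_nonneg R b (hmass b hab.le le_rfl)
    set I := ∫ τ in Set.Icc a b, ∫ x, nsq (S.Du τ x) ∂muQ d
    have h2 : h * (C1 * (θ + Y / θ)) ≤ 2 * C1 * h := by
      rw [hE]
      have : C1 ^ 2 * h ^ 2 ≤ 1 / 2 * (C1 * h) := by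
        have e : C1 ^ 2 * h ^ 2 = (C1 * h) * (C1 * h) := by ring
        rw [e]; exact mul_le_mul_of_nonneg_right hC1h (by positivity)
      linarith
    have h3 : S.ρ / (4 * C) * I ≤ (S.ρ / 2 + 2 * C1) * h := by
      rw [← hh] at h1
      linarith
    have h4 := mul_le_mul_of_nonneg_left h3 (by positivity : 0 ≤ 4 * C / S.ρ)
    have e1 : 4 * C / S.ρ * (S.ρ / (4 * C) * I) = I := by field_simp
    rw [e1] at h4
    calc I ≤ _ := h4
      _ = _ := by rw [hC1]; ring
  · have hDb : S.Dfun R b ≤ Y := hmax ⟨hab.le, le_rfl⟩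
    have h1 : 1 / 2 * ∫ x, (S.u b x - S.u a x) ^ 2 ∂muQ d ≤ S.Dfun R b :=
      S.half_sq_le_D R b (hmass b hab.le le_rfl)
    have h2 : (C1 * h) * (C1 * h) ≤ 1 / 2 * (1 / 2) :=
      mul_le_mul hC1h hC1h (by positivity) (by norm_num)
    have h3 : C1 ^ 2 * h ^ 2 = (C1 * h) * (C1 * h) := by ring
    linarith

end Sys

end partF2

section partF3

namespace Sys

variable {d : ℕ} (S : Sys d)

/-- the closed exhausting sets of regular times -/
def TN (N : ℝ) : Set ℝ := {t | ∀ x, |S.u t x| ≤ N ∧ 1 / N ≤ S.m t x ∧ S.m t x ≤ N ∧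
  ∀ y, |S.u t (x + y) - S.u t x| ≤ N * ‖y‖ ∧ |S.m t (x + y) - S.m t x| ≤ N * ‖y‖ ∧
    ∀ z, |S.u t (x + y + z) - S.u t (x + z) - (S.u t (x + y) - S.u t x)| ≤ N * ‖y‖ * ‖z‖}

lemma TN_closed (N : ℝ) : IsClosed (S.TN N) := by
  have hu := S.u_tcont
  have hm := S.m_tcont
  have e : S.TN N = ⋂ x, ({t | |S.u t x| ≤ N} ∩ ({t | 1 / N ≤ S.m t x} ∩ ({t | S.m t x ≤ N} ∩
      ⋂ y, ({t | |S.u t (x + y) - S.u t x| ≤ N * ‖y‖} ∩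
        ({t | |S.m t (x + y) - S.m t x| ≤ N * ‖y‖} ∩
        ⋂ z, {t | |S.u t (x + y + z) - S.u t (x + z) - (S.u t (x + y) - S.u t x)|
          ≤ N * ‖y‖ * ‖z‖}))))) := by
    ext t; simp [TN]
  rw [e]
  refine isClosed_iInter fun x => ?_
  refine (isClosed_le (hu x).abs continuous_const).inter
    ((isClosed_le continuous_const (hm x)).inter ((isClosed_le (hm x) continuous_const).inter ?_))
  refine isClosed_iInter fun y => ?_
  refine (isClosed_le ((hu _).sub (hu _)).abs continuous_const).inter
    ((isClosed_le ((hm _).sub (hm _)).abs continuous_const).inter ?_)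
  exact isClosed_iInter fun z =>
    isClosed_le (((hu _).sub (hu _)).sub ((hu _).sub (hu _))).abs continuous_const

lemma fderiv_per {E : Type*} [NormedAddCommGroup E] [NormedSpace ℝ E] {f : (Fin d → ℝ) → E}
    (hf : ∀ (z : Fin d → ℤ) (x : Fin d → ℝ), f (x + fun i => (z i : ℝ)) = f x)
    (z : Fin d → ℤ) (x : Fin d → ℝ) :
    fderiv ℝ f (x + fun i => (z i : ℝ)) = fderiv ℝ f x := by
  rw [← fderiv_comp_add_right]
  congr 1
  ext y; exact hf z y

lemma fderiv_bdd {E : Type*} [NormedAddCommGroup E] [NormedSpace ℝ E] {f : (Fin d → ℝ) → E}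
    (hf : ∀ (z : Fin d → ℤ) (x : Fin d → ℝ), f (x + fun i => (z i : ℝ)) = f x)
    (hc : ContDiff ℝ 1 f) : ∃ C, 0 ≤ C ∧ (∀ x, ‖fderiv ℝ f x‖ ≤ C) ∧
      ∀ x y, ‖f (x + y) - f x‖ ≤ C * ‖y‖ := by
  obtain ⟨C, hC⟩ := per_bdd (f := fun x => ‖fderiv ℝ f x‖)
    (fun z x => by simp only [fderiv_per hf z x]) (hc.continuous_fderiv (by norm_num)).norm
  have hC' : ∀ x, ‖fderiv ℝ f x‖ ≤ C := fun x => (le_abs_self _).trans (hC x)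
  refine ⟨C, (norm_nonneg _).trans (hC' 0), hC', fun x y => ?_⟩
  have := Convex.norm_image_sub_le_of_norm_fderiv_le (𝕜 := ℝ) (f := f) (s := Set.univ) (x := x)
    (y := x + y) (fun x _ => hc.differentiable (by norm_num) x) (fun x _ => hC' x) convex_univ
    trivial trivial
  simpa using this

lemma shift_diff {f : (Fin d → ℝ) → ℝ} (hf : Differentiable ℝ f) (y w : Fin d → ℝ) :
    DifferentiableAt ℝ (fun v => f (v + y)) w :=
  (hf.comp (differentiable_id.add_const y)) w

lemma TN_cover (t : ℝ) : ∃ n : ℕ, t ∈ S.TN (n + 1) := by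
  obtain ⟨C1, h1⟩ := per_bdd (S.u_per t) (S.u_cont t)
  obtain ⟨C2, h2⟩ := per_bdd (S.m_per t) (S.m_cont t)
  obtain ⟨c, hc, h3⟩ := per_pos (S.m_per t) (S.m_cont t) (S.m_pos t)
  obtain ⟨C4, h40, h4, h4'⟩ := fderiv_bdd (S.u_per t) (S.u_C1 t)
  obtain ⟨C5, h50, -, h5⟩ := fderiv_bdd (S.m_per t) (S.m_reg t)
  have hD : ContDiff ℝ 1 (fderiv ℝ (S.u t)) := (S.u_reg t).fderiv_right (by norm_num)
  obtain ⟨C6, h60, -, h6⟩ := fderiv_bdd (f := fderiv ℝ (S.u t)) (fderiv_per (S.u_per t)) hD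
  obtain ⟨n, hn⟩ := exists_nat_ge (max C1 (max C2 (max (1 / c) (max C4 (max C5 C6)))))
  simp only [max_le_iff] at hn
  obtain ⟨n1, n2, n3, n4, n5, n6⟩ := hn
  refine ⟨n, fun x => ⟨(h1 x).trans (by linarith), ?_, ?_, fun y => ⟨?_, ?_, fun z => ?_⟩⟩⟩
  · refine le_trans ?_ (h3 x)
    rw [div_le_iff₀ hc] at n3
    rw [div_le_iff₀ (by positivity)]
    linarith
  · exact (le_abs_self _).trans ((h2 x).trans (by linarith))
  · refine (h4' x y).trans (mul_le_mul_of_nonneg_right (by linarith) (norm_nonneg _))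
  · refine (h5 x y).trans (mul_le_mul_of_nonneg_right (by linarith) (norm_nonneg _))
  · have hdu : Differentiable ℝ (S.u t) := (S.u_C1 t).differentiable (by norm_num)
    have key := Convex.norm_image_sub_le_of_norm_fderiv_le (𝕜 := ℝ)
      (f := fun w => S.u t (w + y) - S.u t w) (s := Set.univ) (x := x) (y := x + z)
      (C := C6 * ‖y‖)
      (fun w _ => (shift_diff hdu y w).sub (hdu w))
      (fun w _ => by
        rw [fderiv_fun_sub (shift_diff hdu y w) (hdu w), fderiv_comp_add_right]
        exact h6 w y) convex_univ trivial trivial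
    rw [Real.norm_eq_abs, add_sub_cancel_left] at key
    have e : x + z + y = x + y + z := by abel
    rw [e] at key
    refine key.trans ?_
    gcongr
    linarith

lemma TN_Bd (N : ℝ) : ∃ C, ∀ t ∈ S.TN N, S.Bd C t := by
  by_cases hN : 0 < N
  swap
  · refine ⟨1, fun t ht => ?_⟩
    have h1 := ((ht 0).2.2.1)
    have h2 := S.m_pos t 0
    exact absurd (h2.trans_le h1) hN
  -- bounds for b and its derivative
  have hcomp : IsCompact (Set.Icc (0 : Fin d → ℝ) 1 ×ˢ Metric.closedBall (0 : Fin d → ℝ) N) :=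
    isCompact_Icc.prod (isCompact_closedBall _ _)
  obtain ⟨B1, hB1⟩ := hcomp.exists_bound_of_continuousOn
    (S.b_C1.continuous_fderiv (by norm_num)).continuousOn
  obtain ⟨B0, hB0⟩ := hcomp.exists_bound_of_continuousOn S.b_C1.continuous.continuousOn
  have hB1' : ∀ x q, ‖q‖ ≤ N → ‖fderiv ℝ (Function.uncurry S.b) (x, q)‖ ≤ B1 := by
    intro x q hq
    obtain ⟨z, hz⟩ := per_exists_cube x
    have := hB1 (x + fun i => (z i : ℝ), q) ⟨hz, by simpa using hq⟩
    have e : (x + fun i => (z i : ℝ), q) = (x, q) + ((fun i => (z i : ℝ)), 0) := by simp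
    rw [e, ← fderiv_comp_add_right] at this
    have e2 : (fun p : (Fin d → ℝ) × (Fin d → ℝ) =>
        Function.uncurry S.b (p + ((fun i => (z i : ℝ)), 0))) = Function.uncurry S.b := by
      ext p i
      simp [Function.uncurry, S.b_per]
    rwa [e2] at this
  have hB0' : ∀ x q, ‖q‖ ≤ N → ‖S.b x q‖ ≤ B0 := by
    intro x q hq
    obtain ⟨z, hz⟩ := per_exists_cube x
    have := hB0 (x + fun i => (z i : ℝ), q) ⟨hz, by simpa using hq⟩
    simpa [Function.uncurry, S.b_per] using this
  have hB10 : 0 ≤ B1 := (norm_nonneg _).trans (hB1' 0 0 (by simpa using hN.le))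
  have hB00 : 0 ≤ B0 := (norm_nonneg _).trans (hB0' 0 0 (by simpa using hN.le))
  have hK := S.hK
  have hκ := S.hκ
  set LF := N * (B1 * max 1 N) + N * B0 with hLF
  set C := 1 + N + d * N ^ 2 + d * LF + (S.K * (1 + d * N ^ 2) + S.κ * N) with hC
  have hLF0 : 0 ≤ LF := by positivity
  have p1 : 0 ≤ (d : ℝ) * N ^ 2 := by positivity
  have p2 : 0 ≤ (d : ℝ) * LF := by positivity
  have p3 : 0 ≤ S.K * (1 + d * N ^ 2) + S.κ * N := by positivity
  refine ⟨C, fun t ht => ?_⟩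
  have hdu : Differentiable ℝ (S.u t) := (S.u_C1 t).differentiable (by norm_num)
  have hfu : ∀ x, ‖fderiv ℝ (S.u t) x‖ ≤ N := fun x =>
    norm_fderiv_le_of_lip' ℝ hN.le (Eventually.of_forall fun y => by
      have := ((ht x).2.2.2 (y - x)).1
      rwa [add_sub_cancel] at this)
  have hfm : ∀ x, ‖fderiv ℝ (S.m t) x‖ ≤ N := fun x =>
    norm_fderiv_le_of_lip' ℝ hN.le (Eventually.of_forall fun y => by
      have := ((ht x).2.2.2 (y - x)).2.1
      rwa [add_sub_cancel] at this)
  have hsingle : ∀ i : Fin d, ‖(Pi.single i 1 : Fin d → ℝ)‖ = 1 := fun i => by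
    rw [Pi.norm_single, norm_one]
  have hDu : ∀ x, ‖S.Du t x‖ ≤ N := by
    intro x
    refine (pi_norm_le_iff_of_nonneg hN.le).2 fun i => ?_
    refine ((fderiv ℝ (S.u t) x).le_opNorm _).trans ?_
    rw [hsingle, mul_one]; exact hfu x
  have hDuL : ∀ x y, ‖S.Du t (x + y) - S.Du t x‖ ≤ N * ‖y‖ := by
    intro x y
    refine (pi_norm_le_iff_of_nonneg (by positivity)).2 fun i => ?_
    have h1 : ‖fderiv ℝ (fun w => S.u t (w + y) - S.u t w) x‖ ≤ N * ‖y‖ := by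
      refine norm_fderiv_le_of_lip' ℝ (by positivity) (Eventually.of_forall fun w => ?_)
      have := ((ht x).2.2.2 y).2.2 (w - x)
      have e : x + y + (w - x) = w + y := by abel
      rwa [e, add_sub_cancel] at this
    rw [fderiv_fun_sub (shift_diff hdu y x) (hdu x), fderiv_comp_add_right] at h1
    refine ((fderiv ℝ (S.u t) (x + y) - fderiv ℝ (S.u t) x).le_opNorm (Pi.single i 1)).trans ?_
    rw [hsingle, mul_one]; exact h1
  have hfDu : ∀ x, ‖fderiv ℝ (S.Du t) x‖ ≤ N := fun x =>
    norm_fderiv_le_of_lip' ℝ hN.le (Eventually.of_forall fun y => by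
      have := hDuL x (y - x)
      rwa [add_sub_cancel] at this)
  have hnsq : ∀ x, nsq (S.Du t x) ≤ d * N ^ 2 := fun x => (nsq_le_norm_sq _).trans (by
    have := hDu x
    gcongr)
  have hl : ∀ x, |S.l t x| ≤ N := by
    intro x
    have hm := S.m_pos t x
    have h1 : Real.log (S.m t x) ≤ S.m t x - 1 := Real.log_le_sub_one_of_pos hm
    have h2 : Real.log (S.m t x)⁻¹ ≤ (S.m t x)⁻¹ - 1 := Real.log_le_sub_one_of_pos (inv_pos.2 hm)
    rw [Real.log_inv] at h2
    have h3 : (S.m t x)⁻¹ ≤ N := by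
      have := (ht x).2.1
      rw [inv_le_comm₀ hm hN]; rwa [one_div] at this
    have h4 := (ht x).2.2.1
    rw [abs_le, l]
    constructor <;> linarith
  refine ⟨by rw [hC]; linarith, fun x => ?_, fun x => ?_, fun x => ?_, fun x => ?_, fun x => ?_,
    fun x => ?_⟩
  · have hFd : ‖fderiv ℝ (S.F t) x‖ ≤ LF := by
      have d1 : HasFDerivAt (S.m t) (fderiv ℝ (S.m t) x) x :=
        ((S.m_reg t).differentiable (by norm_num) x).hasFDerivAt
      have d2 : HasFDerivAt (S.Du t) (fderiv ℝ (S.Du t) x) x :=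
        ((S.Du_C1 t).differentiable (by norm_num) x).hasFDerivAt
      have d3 : HasFDerivAt (Function.uncurry S.b) (fderiv ℝ (Function.uncurry S.b) (x, S.Du t x))
          (x, S.Du t x) := (S.b_C1.differentiable (by norm_num) _).hasFDerivAt
      have d4 := d3.comp x ((hasFDerivAt_id x).prodMk d2)
      have d5 := (d1.smul d4).fderiv
      have e : S.F t = fun y => S.m t y • (Function.uncurry S.b ∘ fun y => (id y, S.Du t y)) y := rfl
      rw [e]
      have d5' : fderiv ℝ (fun y => S.m t y • (Function.uncurry S.b ∘ fun y => (id y, S.Du t y)) y) x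
        = _ := d5
      rw [d5']
      refine (norm_add_le _ _).trans (add_le_add ?_ ?_)
      · rw [norm_smul]
        refine mul_le_mul ?_ ?_ (norm_nonneg _) hN.le
        · rw [Real.norm_eq_abs, abs_of_pos (S.m_pos t x)]; exact (ht x).2.2.1
        · refine (ContinuousLinearMap.opNorm_comp_le _ _).trans ?_
          refine mul_le_mul (hB1' x _ (hDu x)) ?_ (norm_nonneg _) hB10
          rw [ContinuousLinearMap.opNorm_prod]
          exact max_le_max ContinuousLinearMap.norm_id_le (hfDu x)
      · rw [ContinuousLinearMap.norm_smulRight_apply]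
        exact mul_le_mul (hfm x) (hB0' x _ (hDu x)) (norm_nonneg _) hN.le
    have hd := ((S.F_C1 t).differentiable (by norm_num) x).hasFDerivAt
    have h1 : |pdiv (S.F t) x| ≤ ∑ _i : Fin d, LF := by
      refine (Finset.abs_sum_le_sum_abs _ _).trans (Finset.sum_le_sum fun i _ => ?_)
      have e : fderiv ℝ (fun y => S.F t y i) x (Pi.single i 1)
          = (fderiv ℝ (S.F t) x (Pi.single i 1)) i := by
        rw [(hasFDerivAt_pi'.1 hd i).fderiv]; rfl
      rw [e]
      refine (norm_le_pi_norm (fderiv ℝ (S.F t) x (Pi.single i 1)) i).trans ?_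
      refine ((fderiv ℝ (S.F t) x).le_opNorm _).trans ?_
      rw [hsingle, mul_one]; exact hFd
    rw [Finset.sum_const, Finset.card_univ, Fintype.card_fin, nsmul_eq_mul] at h1
    linarith
  · refine (abs_sub _ _).trans ?_
    have h1 := S.hh_abs t x
    have h2 : S.K * (1 + nsq (S.Du t x)) ≤ S.K * (1 + d * N ^ 2) :=
      mul_le_mul_of_nonneg_left (by linarith [hnsq x]) hK
    have h3 : |S.κ * S.l t x| ≤ S.κ * N := by
      rw [abs_mul, abs_of_pos hκ]; exact mul_le_mul_of_nonneg_left (hl x) hκ.le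
    linarith
  · have := (ht x).1
    linarith
  · have := hnsq x
    linarith
  · refine le_trans ?_ (ht x).2.1
    exact one_div_le_one_div_of_le hN (by linarith)
  · have := (ht x).2.2.1
    linarith

end Sys

end partF3

section partF4

namespace Sys

variable {d : ℕ} (S : Sys d)

lemma pgrad_test {χ φ v : (Fin d → ℝ) → ℝ} (hχ : ContDiff ℝ 1 χ) (hφ : ContDiff ℝ 1 φ)
    (hv : ContDiff ℝ 1 v) (x : Fin d → ℝ) :
    pgrad (fun x => 2 * χ x * v x + φ x) x
      = (2 * χ x) • pgrad v x + (2 * v x) • pgrad χ x + pgrad φ x := by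
  have h1 := (hχ.differentiable (by norm_num) x).hasFDerivAt
  have h2 := (hφ.differentiable (by norm_num) x).hasFDerivAt
  have h3 := (hv.differentiable (by norm_num) x).hasFDerivAt
  have h := (((h1.const_mul 2).mul h3).add h2).fderiv
  have h' : fderiv ℝ (fun x => 2 * χ x * v x + φ x) x = _ := h
  ext i
  simp only [pgrad, h', Pi.add_apply, Pi.smul_apply, smul_eq_mul, ContinuousLinearMap.add_apply,
    ContinuousLinearMap.smul_apply]
  ring

lemma slice {χ φ : (Fin d → ℝ) → ℝ} (hχ : Tst χ) (hφ : Tst φ) (τ : ℝ) :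
    ∫ x, (2 * χ x * S.u τ x + φ x) * pdiv (S.F τ) x ∂muQ d = - ∫ x, S.q χ φ τ x ∂muQ d := by
  have hc : ContDiff ℝ 1 fun x => 2 * χ x * S.u τ x + φ x :=
    ((contDiff_const.mul hχ.1).mul (S.u_C1 τ)).add hφ.1
  have hp : ZPeriodic fun x => 2 * χ x * S.u τ x + φ x := fun z x => by
    simp only [hχ.2 z x, hφ.2 z x, S.u_per τ z x]
  rw [ibp hp hc (S.F_per τ) (S.F_C1 τ)]
  congr 1
  refine integral_congr_ae (ae_of_all _ fun x => ?_)
  simp only [q, pgrad_test hχ.1 hφ.1 (S.u_C1 τ)]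
  rfl

lemma pdiv_lim {t : ℝ} (ht : 0 ≤ t) (x : Fin d → ℝ) :
    Tendsto (fun n : ℕ => ((n : ℝ) + 1) * (S.u (t + ((n : ℝ) + 1)⁻¹) x - S.u t x)) atTop
      (nhds (pdiv (S.F t) x)) := by
  have h := (hasDerivWithinAt_iff_tendsto_slope' (by simp)).1 (S.u_der' ht x)
  have hs : Tendsto (fun n : ℕ => t + ((n : ℝ) + 1)⁻¹) atTop (nhdsWithin t (Set.Ioi t)) := by
    refine tendsto_nhdsWithin_iff.2 ⟨?_, Eventually.of_forall fun n => ?_⟩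
    · have : Tendsto (fun n : ℕ => ((n : ℝ) + 1)⁻¹) atTop (nhds 0) := by
        simpa using tendsto_one_div_add_atTop_nhds_zero_nat (𝕜 := ℝ)
      simpa using tendsto_const_nhds.add this
    · have : (0 : ℝ) < ((n : ℝ) + 1)⁻¹ := by positivity
      simpa using this
  refine (h.comp hs).congr fun n => ?_
  simp [slope_def_field, div_eq_mul_inv, mul_comm]

lemma ae_meas_pdiv {Z : Set ℝ} (hZ : MeasurableSet Z) (h0 : ∀ t ∈ Z, 0 ≤ t) :
    AEStronglyMeasurable (fun p : ℝ × (Fin d → ℝ) => pdiv (S.F p.1) p.2)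
      ((volume.restrict Z).prod (muQ d)) := by
  refine aestronglyMeasurable_of_tendsto_ae atTop
    (f := fun (n : ℕ) (p : ℝ × (Fin d → ℝ)) =>
      ((n : ℝ) + 1) * (S.u (p.1 + ((n : ℝ) + 1)⁻¹) p.2 - S.u p.1 p.2)) (fun n => ?_) ?_
  · have h1 : Measurable fun p : ℝ × (Fin d → ℝ) => S.u (p.1 + ((n : ℝ) + 1)⁻¹) p.2 :=
      S.meas_u.comp ((measurable_fst.add_const _).prodMk measurable_snd)
    exact ((h1.sub S.meas_u).const_mul _).aestronglyMeasurable
  · filter_upwards [Measure.quasiMeasurePreserving_fst.ae (ae_restrict_mem hZ)] with p hp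
    exact S.pdiv_lim (h0 _ hp) p.2

lemma comb {Z : Set ℝ} (hZ : IsClosed Z) {s t C : ℝ} (hs : s ∈ Z) (ht : t ∈ Z) (h0 : 0 ≤ s)
    (hst : s ≤ t) (hB : ∀ τ ∈ Z, τ ∈ Set.Icc s t → S.Bd C τ) (hsm : 4 * C ^ 2 * (t - s) ≤ 1)
    (hg : ∀ a ∈ gapA Z s t, ∀ σ τ, a ≤ σ → σ ≤ τ → τ ≤ gapB Z a → S.Id σ τ) : S.Id s t := by
  have hC := (hB s hs ⟨le_rfl, hst⟩).one
  have hρ := S.hρ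
  have hZm : MeasurableSet (Z ∩ Set.Icc s t) := hZ.measurableSet.inter measurableSet_Icc
  -- frozen estimate on gaps
  have hfr : ∀ a ∈ gapA Z s t, ∀ τ, a < τ → τ ≤ gapB Z a →
      ∫ x, |S.u τ x - S.u a x| ∂muQ d ≤ (1 / 2 + 16 * C ^ 4) * (τ - a) ∧
      ∫ τ in Set.Icc a τ, ∫ x, nsq (S.Du τ x) ∂muQ d
        ≤ 4 * C / S.ρ * (S.ρ / 2 + 4 * C ^ 2) * (τ - a) ∧
      ∫ x, (S.u τ x - S.u a x) ^ 2 ∂muQ d ≤ 2 := by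
    intro a ha τ h1 h2
    have hb := gapB_spec ha
    refine S.frozen (hB a ha.1 ⟨ha.2.1, hb.2.1.le.trans hb.2.2.1⟩) (h0.trans ha.2.1) h1 ?_
      fun σ h3 h4 => hg a ha a σ le_rfl h3 (h4.trans h2)
    refine le_trans (mul_le_mul_of_nonneg_left ?_ (by positivity)) hsm
    have := ha.2.1
    linarith [hb.2.2.1]
  have hmeasI : AEStronglyMeasurable (fun τ => ∫ x, nsq (S.Du τ x) ∂muQ d)
      (volume : Measure ℝ) :=
    (S.meas_nsqDu.stronglyMeasurable.integral_prod_right).aestronglyMeasurable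
  -- time integrability
  have hI1 : IntegrableOn (fun τ => ∫ x, nsq (S.Du τ x) ∂muQ d) (Set.Icc s t) := by
    have := (gapA_countable Z s t).to_subtype
    have e : Set.Icc s t = (Z ∩ Set.Icc s t) ∪ (Set.Icc s t \ Z) := by
      ext τ
      simp only [Set.mem_union, Set.mem_inter_iff, Set.mem_sdiff]
      tauto
    rw [e]
    refine IntegrableOn.union ?_ ?_
    · refine IntegrableOn.of_bound (C := C) ?_ hmeasI.restrict ?_
      · exact (measure_mono Set.inter_subset_right).trans_lt (by simp)
      · filter_upwards [ae_restrict_mem hZm] with τ hτ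
        rw [Real.norm_eq_abs, abs_of_nonneg (integral_nonneg fun x => nsq_nonneg _)]
        have h1 := integral_mono (cont_int (S.cont_nsqDu τ)) (cont_int (d := d) continuous_const)
          (hB τ hτ.1 hτ.2).Du
        simpa using h1
    · rw [gap_union hZ hs ht]
      refine integrableOn_iUnion_of_summable_integral_norm (fun a => ?_) ?_
      · have hb := gapB_spec a.2
        exact (S.int_Du (h0.trans a.2.2.1) hb.2.1.le (hg a a.2 _ _ le_rfl hb.2.1.le le_rfl).1).mono_set
          Set.Ioo_subset_Icc_self
      · refine Summable.of_nonneg_of_le (fun a => integral_nonneg fun x => norm_nonneg _)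
          (fun a => ?_) ((gap_summable hZ hs ht).mul_left (4 * C / S.ρ * (S.ρ / 2 + 4 * C ^ 2)))
        have hb := gapB_spec a.2
        refine le_trans ?_ (hfr a a.2 _ hb.2.1 le_rfl).2.1
        rw [← integral_Icc_eq_integral_Ioo]
        refine le_of_eq (integral_congr_ae (ae_of_all _ fun τ => ?_))
        exact abs_of_nonneg (integral_nonneg fun x => nsq_nonneg _)
  have hI2 : Integrable (Function.uncurry fun t x => nsq (S.Du t x)) (pm d s t) := by
    refine (integrable_prod_iff S.meas_nsqDu.aestronglyMeasurable).2 ⟨ae_of_all _ fun τ => ?_, ?_⟩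
    · exact cont_int (S.cont_nsqDu τ)
    · refine hI1.congr (ae_of_all _ fun τ => ?_)
      refine integral_congr_ae (ae_of_all _ fun x => ?_)
      exact (abs_of_nonneg (nsq_nonneg _)).symm
  obtain ⟨x0, hx0⟩ := hI2.prod_left_ae.exists
  have hI : IntegrableOn S.hb (Set.Icc s t) := S.G1a h0 hst x0 hx0
  have hL2 : ∃ C', ∀ τ ∈ Set.Icc s t, ∫ x, S.u τ x ^ 2 ∂muQ d ≤ C' := by
    have hZb : ∀ τ ∈ Z, τ ∈ Set.Icc s t → ∫ x, S.u τ x ^ 2 ∂muQ d ≤ C ^ 2 := by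
      intro τ h1 h2
      have c := S.u_cont τ
      have h3 := integral_mono (cont_int (c.pow 2)) (cont_int (d := d) continuous_const)
          (g := fun _ => C ^ 2) (fun x => by
            have := (hB τ h1 h2).u x
            change S.u τ x ^ 2 ≤ C ^ 2
            rw [← sq_abs]
            gcongr)
      simpa using h3
    refine ⟨2 * 2 + 2 * C ^ 2, fun τ hτ => ?_⟩
    by_cases hτZ : τ ∈ Z
    · have := hZb τ hτZ hτ
      nlinarith [sq_nonneg C]
    · obtain ⟨a, ha, h1⟩ := gap_cover hZ hs ht hτ hτZ
      have hb := gapB_spec ha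
      have h2 := (hfr a ha τ h1.1 h1.2.le).2.2
      have h3 := hZb a ha.1 ⟨ha.2.1, hb.2.1.le.trans hb.2.2.1⟩
      have c1 := S.u_cont τ
      have c2 := S.u_cont a
      have h4 : ∫ x, S.u τ x ^ 2 ∂muQ d ≤ ∫ x, (2 * (S.u τ x - S.u a x) ^ 2 + 2 * S.u a x ^ 2) ∂muQ d :=
        integral_mono (cont_int (by fun_prop)) (cont_int (by fun_prop)) fun x => by
          change S.u τ x ^ 2 ≤ _
          nlinarith [sq_nonneg (S.u τ x - 2 * S.u a x)]
      rw [integral_add (cont_int (by fun_prop)) (cont_int (by fun_prop)), integral_const_mul,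
        integral_const_mul] at h4
      linarith
  refine ⟨hI, hL2, fun χ φ hχ hφ => ?_⟩
  obtain ⟨A1, hA10, hA1, -⟩ := hχ.bdd
  obtain ⟨A2, hA20, hA2, -⟩ := hφ.bdd
  have key := LM (d := d) hZ hs ht hst (G := fun τ x => χ x * S.u τ x ^ 2 + φ x * S.u τ x)
    (g := fun τ x => (2 * χ x * S.u τ x + φ x) * pdiv (S.F τ) x)
    (Qf := fun τ => - ∫ x, S.q χ φ τ x ∂muQ d) ?_ ?_ ?_ ?_
    ((A1 * (2 * C) + A2) * (1 / 2 + 16 * C ^ 4)) ?_ ?_ ?_ ?_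
  · rw [intervalIntegral.integral_neg] at key
    exact key
  · intro x
    have := S.u_tcont x
    fun_prop
  · intro τ _ _
    have c1 := S.u_cont τ
    have c2 := hχ.1.continuous
    have c3 := hφ.1.continuous
    exact cont_int (by fun_prop)
  · intro τ _ hτ x
    have h1 := S.u_der' (h0.trans hτ.1) x
    have h2 := ((h1.pow 2).const_mul (χ x)).add (h1.const_mul (φ x))
    refine h2.congr_deriv ?_
    norm_num
    ring
  · have hm : AEStronglyMeasurable (Function.uncurry fun τ x =>
        (2 * χ x * S.u τ x + φ x) * pdiv (S.F τ) x)
        ((volume.restrict (Z ∩ Set.Icc s t)).prod (muQ d)) := by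
      refine AEStronglyMeasurable.mul ?_ (S.ae_meas_pdiv hZm fun τ hτ => h0.trans hτ.2.1)
      have c2 : Measurable fun p : ℝ × (Fin d → ℝ) => χ p.2 :=
        hχ.1.continuous.measurable.comp measurable_snd
      have c3 : Measurable fun p : ℝ × (Fin d → ℝ) => φ p.2 :=
        hφ.1.continuous.measurable.comp measurable_snd
      exact (((c2.const_mul 2).mul S.meas_u).add c3).aestronglyMeasurable
    have : IsFiniteMeasure (volume.restrict (Z ∩ Set.Icc s t)) :=
      ⟨by
        rw [Measure.restrict_apply_univ]
        exact (measure_mono Set.inter_subset_right).trans_lt (by simp)⟩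
    refine Integrable.of_bound hm ((2 * A1 * C + A2) * C) ?_
    filter_upwards [Measure.quasiMeasurePreserving_fst.ae (ae_restrict_mem hZm)] with p hp
    have hb := hB p.1 hp.1 hp.2
    have h1 := hA1 p.2
    have h2 := hA2 p.2
    have h3 := hb.u p.2
    have h4 := hb.F p.2
    change |(2 * χ p.2 * S.u p.1 p.2 + φ p.2) * pdiv (S.F p.1) p.2| ≤ _
    rw [abs_mul]
    refine mul_le_mul ((abs_add_le _ _).trans (add_le_add ?_ h2)) h4 (abs_nonneg _) (by positivity)
    rw [abs_mul, abs_mul, abs_two]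
    gcongr
  · intro a ha
    have hb := gapB_spec ha
    have h1 := (hfr a ha _ hb.2.1 le_rfl).1
    have u1 := (hB a ha.1 ⟨ha.2.1, hb.2.1.le.trans hb.2.2.1⟩).u
    have u2 := (hB _ hb.1 ⟨ha.2.1.trans hb.2.1.le, hb.2.2.1⟩).u
    have c1 := S.u_cont a
    have c4 := S.u_cont (gapB Z a)
    have c2 := hχ.1.continuous
    have c3 := hφ.1.continuous
    rw [mul_assoc]
    refine le_trans ?_ (mul_le_mul_of_nonneg_left h1 (by positivity))
    rw [← integral_const_mul]
    refine integral_mono (cont_int (by fun_prop)) (cont_int (by fun_prop)) fun x => ?_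
    have e : χ x * S.u (gapB Z a) x ^ 2 + φ x * S.u (gapB Z a) x
        - (χ x * S.u a x ^ 2 + φ x * S.u a x)
        = (χ x * (S.u (gapB Z a) x + S.u a x) + φ x) * (S.u (gapB Z a) x - S.u a x) := by ring
    change |_| ≤ _
    rw [e, abs_mul]
    refine mul_le_mul_of_nonneg_right ((abs_add_le _ _).trans (add_le_add ?_ (hA2 x)))
      (abs_nonneg _)
    rw [abs_mul]
    refine mul_le_mul (hA1 x) ((abs_add_le _ _).trans ?_) (abs_nonneg _) hA10
    have := u1 x
    have := u2 x
    linarith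
  · exact (S.int_q h0 hst hI hL2 hχ hφ).neg
  · intro τ _ _
    exact S.slice hχ hφ τ
  · intro a ha
    have hb := gapB_spec ha
    have h1 := (hg a ha _ _ le_rfl hb.2.1.le le_rfl).2.2 χ φ hχ hφ
    have c1 := S.u_cont a
    have c4 := S.u_cont (gapB Z a)
    have c2 := hχ.1.continuous
    have c3 := hφ.1.continuous
    rw [intervalIntegral.integral_neg, ← h1]
    exact integral_sub (cont_int (by fun_prop)) (cont_int (by fun_prop))

end Sys

end partF4

section partF5

namespace Sys

variable {d : ℕ} (S : Sys d)

/-- local validity of the integral identities near `τ` -/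
def Gd (τ : ℝ) : Prop :=
  ∃ ε, 0 < ε ∧ ∀ s t, 0 ≤ s → s ≤ t → τ - ε < s → t < τ + ε → S.Id s t

lemma Gd_open : IsOpen {τ | S.Gd τ} := by
  rw [Metric.isOpen_iff]
  rintro τ ⟨ε, hε, h⟩
  refine ⟨ε / 2, by positivity, fun σ hσ => ⟨ε / 2, by positivity, fun s t h0 hst h1 h2 => ?_⟩⟩
  rw [Metric.mem_ball, Real.dist_eq, abs_lt] at hσ
  exact h s t h0 hst (by linarith [hσ.1]) (by linarith [hσ.2])

lemma loc_glob {s t : ℝ} (hs : 0 ≤ s) (hst : s ≤ t) (h : ∀ τ, s ≤ τ → τ ≤ t → S.Gd τ) :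
    S.Id s t := by
  choose! ε hε he using h
  obtain ⟨T, T0, Tm, ⟨N, TN⟩, Tc⟩ := exists_monotone_Icc_subset_open_cover_Icc hst
    (c := fun i : Set.Icc s t => {y : Set.Icc s t | (i : ℝ) - ε i < y ∧ (y : ℝ) < i + ε i})
    (fun i => (isOpen_lt continuous_const continuous_subtype_val).inter
      (isOpen_lt continuous_subtype_val continuous_const))
    (fun x _ => Set.mem_iUnion.2 ⟨x, by
      have := hε x x.2.1 x.2.2
      exact ⟨by linarith, by linarith⟩⟩)
  have step : ∀ n, S.Id (T n) (T (n + 1)) := by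
    intro n
    obtain ⟨i, hi⟩ := Tc n
    have hm := Tm (Nat.le_succ n)
    have a1 := hi (Set.left_mem_Icc.2 hm)
    have a2 := hi (Set.right_mem_Icc.2 hm)
    exact he i i.2.1 i.2.2 _ _ (hs.trans (T n).2.1) hm a1.1 a2.2
  have all : ∀ n, S.Id s (T (n + 1)) := by
    intro n
    induction n with
    | zero => have := step 0; rwa [T0] at this
    | succ n ih =>
      exact Id.concat S hs (T (n + 1)).2.1 (Tm (Nat.le_succ _)) ih (step _)
  have := all N
  rwa [TN _ (Nat.le_succ N)] at this

lemma glob_Gd {τ : ℝ} (hτ : 0 ≤ τ) : S.Gd τ := by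
  by_contra hbad
  let Z : Set ℝ := {τ | S.Gd τ}ᶜ ∩ Set.Ici 0
  have hZc : IsClosed Z := S.Gd_open.isClosed_compl.inter isClosed_Ici
  have hgd : ∀ σ, 0 ≤ σ → σ ∉ Z → S.Gd σ := fun σ h0 h => by
    by_contra hh
    exact h ⟨hh, h0⟩
  haveI : Nonempty Z := ⟨⟨τ, hbad, hτ⟩⟩
  haveI : CompleteSpace Z := hZc.completeSpace_coe
  obtain ⟨n, z, hz⟩ := nonempty_interior_of_iUnion_of_closed
    (f := fun n : ℕ => {z : Z | (z : ℝ) ∈ S.TN (n + 1)})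
    (fun n => (S.TN_closed _).preimage continuous_subtype_val)
    (Set.eq_univ_of_forall fun z => Set.mem_iUnion.2 (S.TN_cover z))
  rw [mem_interior_iff_mem_nhds, Metric.mem_nhds_iff] at hz
  obtain ⟨δ, hδ, hball⟩ := hz
  obtain ⟨C, hC⟩ := S.TN_Bd (n + 1)
  have hBd : ∀ σ ∈ Z, (z : ℝ) - δ < σ → σ < z + δ → S.Bd C σ := by
    intro σ hσ h1 h2
    refine hC σ (hball (show (⟨σ, hσ⟩ : Z) ∈ Metric.ball z δ from ?_))
    rw [Metric.mem_ball, Subtype.dist_eq, Real.dist_eq, abs_lt]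
    exact ⟨by simp only; linarith, by simp only; linarith⟩
  -- good gaps
  have gap : ∀ a b, 0 ≤ a → a < b → (∀ y ∈ Z, ¬ (a < y ∧ y < b)) →
      ∀ σ τ, a ≤ σ → σ ≤ τ → τ ≤ b → S.Id σ τ := by
    intro a b ha hab hno
    refine S.gap_good ha hab fun σ τ h1 h2 h3 => ?_
    refine S.loc_glob (ha.trans h1.le) h2 fun y hy1 hy2 => ?_
    exact hgd y (ha.trans (h1.le.trans hy1)) fun hy => hno y hy ⟨h1.trans_le hy1, hy2.trans_lt h3⟩
  refine z.2.1 ?_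
  let ε := min δ (1 / (8 * C ^ 2 + 1))
  have hε : 0 < ε := lt_min hδ (by positivity)
  have hεδ : ε ≤ δ := min_le_left _ _
  have hεC : 4 * C ^ 2 * (2 * ε) ≤ 1 := by
    have h1 : ε ≤ 1 / (8 * C ^ 2 + 1) := min_le_right _ _
    rw [le_div_iff₀ (by positivity)] at h1
    nlinarith
  refine ⟨ε, hε, fun s t h0 hst h1 h2 => ?_⟩
  by_cases hne : (Z ∩ Set.Icc s t).Nonempty
  swap
  · refine S.loc_glob h0 hst fun y hy1 hy2 => hgd y (h0.trans hy1) fun hy => hne ⟨y, hy, hy1, hy2⟩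
  have hK : IsCompact (Z ∩ Set.Icc s t) := isCompact_Icc.inter_left hZc
  obtain ⟨s1, hs1, hs1m⟩ := hK.exists_isLeast hne
  obtain ⟨t1, ht1, ht1m⟩ := hK.exists_isGreatest hne
  have hst1 : s1 ≤ t1 := hs1m ht1
  have h01 : 0 ≤ s1 := h0.trans hs1.2.1
  have mid : S.Id s1 t1 := by
    refine S.comb hZc hs1.1 ht1.1 h01 hst1 (C := C) (fun τ hτ hτ' => ?_) ?_ ?_
    · exact hBd τ hτ (by linarith [hτ'.1, hs1.2.1]) (by linarith [hτ'.2, ht1.2.2])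
    · refine le_trans ?_ hεC
      have : t1 - s1 ≤ 2 * ε := by linarith [hs1.2.1, ht1.2.2]
      gcongr
    · intro a ha
      obtain ⟨g1, g2, g3, g4⟩ := gapB_spec ha
      exact gap a (gapB Z a) (h01.trans ha.2.1) g2 g4
  have left : S.Id s s1 ∨ s = s1 := by
    rcases hs1.2.1.eq_or_lt with h | h
    · exact Or.inr h
    · refine Or.inl (gap s s1 h0 h (fun y hy hh => ?_) s s1 le_rfl h.le le_rfl)
      exact absurd (hs1m ⟨hy, hh.1.le, hh.2.le.trans hs1.2.2⟩) (not_le.2 hh.2)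
  have right : S.Id t1 t ∨ t1 = t := by
    rcases ht1.2.2.eq_or_lt with h | h
    · exact Or.inr h
    · refine Or.inl (gap t1 t (h0.trans ht1.2.1) h (fun y hy hh => ?_) t1 t le_rfl h.le le_rfl)
      exact absurd (ht1m ⟨hy, ht1.2.1.trans hh.1.le, hh.2.le⟩) (not_le.2 hh.1)
  have mid2 : S.Id s t1 := by
    rcases left with h | h
    · exact Id.concat S h0 hs1.2.1 hst1 h mid
    · rw [h]; exact mid
  rcases right with h | h
  · exact Id.concat S h0 ht1.2.1 ht1.2.2 mid2 h
  · rw [← h]; exact mid2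

lemma glob_Id {s t : ℝ} (hs : 0 ≤ s) (hst : s ≤ t) : S.Id s t :=
  S.loc_glob hs hst fun _ h _ => S.glob_Gd (hs.trans h)

end Sys

end partF5

section partG1

namespace Sys

variable {d : ℕ} (S : Sys d)

lemma mass_eq {t : ℝ} (ht : 0 ≤ t) : ∫ x, S.m t x ∂muQ d = ∫ x, S.m 0 x ∂muQ d :=
  S.mass_const le_rfl ht (S.glob_Id le_rfl ht).1

lemma mean_eq {t : ℝ} (ht : 0 ≤ t) : ∫ x, S.u t x ∂muQ d = ∫ x, S.u 0 x ∂muQ d := by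
  have h := (S.glob_Id le_rfl ht).2.2 _ _ (Tst.const 0) (Tst.const 1)
  have hq : ∀ τ x, S.q (fun _ => 0) (fun _ => 1) τ x = 0 := by
    intro τ x
    simp [q, pgrad_const, dot]
  simp only [Idn, hq, zero_mul, one_mul, zero_add, integral_zero, intervalIntegral.integral_zero,
    neg_zero] at h
  linarith

theorem main (R : Ref d) (hM1 : ∫ x, R.M x ∂muQ d = 1) (hU0 : ∫ x, R.U x ∂muQ d = 0)
    (hm0 : ∫ x, S.m 0 x ∂muQ d = 1) (hu0 : ∫ x, S.u 0 x ∂muQ d = 0)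
    (h1 : ∀ x, pdiv (S.rF R) x = 0) (lam : ℝ) (h2 : ∀ x, S.rg R x = lam) :
    (∃ ts : ℕ → ℝ, (∀ n, 0 ≤ ts n) ∧ Tendsto ts atTop atTop ∧
      Tendsto (fun n => ∫ x, ((S.u (ts n) x - R.U x) ^ 2
          + nsq (S.Du (ts n) x - pgrad R.U x)) ∂muQ d) atTop (nhds 0)) ∧
    Tendsto (fun t => ∫ x, (S.u t x - R.U x) ^ 2 ∂muQ d) atTop (nhds 0) ∧
    Tendsto (fun t => ∫ x, |S.m t x - R.M x| ∂muQ d) atTop (nhds 0) := by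
  have hρ := S.hρ
  have hκ := S.hκ
  have cM := R.M_cont
  have cU := R.U_cont
  have cDU := R.DU_cont
  have cm := S.m_cont
  have cu := S.u_cont
  have cDu := S.Du_cont
  have cb := S.breg_cont R
  have hmass : ∀ t, 0 ≤ t → ∫ x, S.m t x ∂muQ d = ∫ x, R.M x ∂muQ d := fun t ht => by
    rw [S.mass_eq ht, hm0, hM1]
  obtain ⟨c0, hc0, hc⟩ := per_pos R.M_per R.M_cont R.M_pos
  let w : ℝ → ℝ := fun t => ∫ x, (S.u t x - R.U x) ^ 2 ∂muQ d
  let A : ℝ → ℝ := fun t => ∫ x, nsq (S.Du t x - pgrad R.U x) ∂muQ d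
  let B : ℝ → ℝ := fun t => ∫ x, breg (S.m t x) (R.M x) ∂muQ d
  have cnsq : ∀ t, Continuous fun x => nsq (S.Du t x - pgrad R.U x) := fun t =>
    ((cDu t).sub cDU).nsq'
  have hB0 : ∀ t, 0 ≤ B t := fun t =>
    integral_nonneg fun x => breg_nonneg (S.m_pos t x) (R.M_pos x)
  have hw0 : ∀ t, 0 ≤ w t := fun t => integral_nonneg fun x => sq_nonneg _
  have hA0 : ∀ t, 0 ≤ A t := fun t => integral_nonneg fun x => nsq_nonneg _
  have hD : ∀ t, 0 ≤ t → S.Dfun R t = 1 / 2 * w t + B t := fun t ht => by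
    rw [S.Dfun_eq R t (hmass t ht), integral_add (cont_int (by fun_prop)) (cont_int (cb t)),
      integral_const_mul]
  have hpoin : ∀ t, 0 ≤ t → w t ≤ d * A t := by
    intro t ht
    have h := poincare (f := fun x => S.u t x - R.U x)
      (fun z x => by simp only [S.u_per t z x, R.U_per z x])
      ((S.u_C1 t).sub R.U_C1)
      (by rw [integral_sub (cont_int (cu t)) (cont_int cU), S.mean_eq ht, hu0, hU0, sub_zero])
    have e : ∀ x, pgrad (fun x => S.u t x - R.U x) x = S.Du t x - pgrad R.U x := fun x =>
      pgrad_sub (S.u_C1 t) R.U_C1 x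
    simp only [e] at h
    exact h
  have hdiss : ∀ t, S.ρ / 2 * c0 * A t + S.κ * B t ≤ S.diss R t := by
    intro t
    have e1 : S.ρ / 2 * c0 * A t + S.κ * B t = ∫ x, (S.ρ / 2 * c0 * nsq (S.Du t x - pgrad R.U x)
        + S.κ * breg (S.m t x) (R.M x)) ∂muQ d := by
      rw [integral_add ((cont_int (cnsq t)).const_mul _)
        ((cont_int (cb t)).const_mul _), integral_const_mul, integral_const_mul]
    rw [e1]
    refine integral_mono (cont_int ((continuous_const.mul (cnsq t)).add
      (continuous_const.mul (cb t)))) (cont_int ((continuous_const.mul (cM.mul (cnsq t))).add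
      (continuous_const.mul (cb t)))) fun x => ?_
    change _ ≤ _
    have a1 := mul_le_mul_of_nonneg_right (hc x) (nsq_nonneg (S.Du t x - pgrad R.U x))
    have a2 := mul_le_mul_of_nonneg_left a1 (half_pos hρ).le
    linarith
  have hrem : ∀ t, 0 ≤ t → S.rem R t = 0 := by
    intro t ht
    unfold rem
    simp only [h1, h2, mul_zero, zero_add]
    rw [integral_mul_const, integral_sub (cont_int (cm t)) (cont_int cM), hmass t ht]
    simp
  have hrr : ∀ t, 0 ≤ t → S.diss R t ≤ - S.rr R t := by
    intro t ht
    have := S.rr_le R t (hmass t ht)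
    rw [hrem t ht] at this
    linarith
  let κ' := min (S.ρ * c0 / (d + 1)) S.κ
  have hκ' : 0 < κ' := lt_min (by positivity) hκ
  have hκd : κ' * d ≤ S.ρ * c0 := by
    have a : κ' ≤ S.ρ * c0 / (d + 1) := min_le_left _ _
    rw [le_div_iff₀ (by positivity)] at a
    nlinarith
  have hκκ : κ' ≤ S.κ := min_le_right _ _
  have hDd : ∀ t, 0 ≤ t → κ' * S.Dfun R t ≤ S.diss R t := by
    intro t ht
    refine le_trans ?_ (hdiss t)
    rw [hD t ht]
    have a1 := mul_le_mul_of_nonneg_left (hpoin t ht) hκ'.le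
    have a2 := mul_le_mul_of_nonneg_right hκd (hA0 t)
    have a3 := mul_le_mul_of_nonneg_right hκκ (hB0 t)
    nlinarith
  have hD0 : ∀ t, 0 ≤ t → 0 ≤ S.Dfun R t := fun t ht => S.D_nonneg R t (hmass t ht)
  have hdec : ∀ s t, 0 ≤ s → s ≤ t → S.Dfun R t ≤ S.Dfun R s := by
    intro s t hs hst
    obtain ⟨i1, i2⟩ := S.D_id R hs hst (S.glob_Id hs hst)
    have i3 : ∫ τ in s..t, S.rr R τ ≤ ∫ τ in s..t, (0 : ℝ) :=
      intervalIntegral.integral_mono_on hst i1 (by simp) fun τ hτ => by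
        have h0 := hs.trans hτ.1
        have := hrr τ h0
        have := hDd τ h0
        have := mul_nonneg hκ'.le (hD0 τ h0)
        linarith
    simp only [intervalIntegral.integral_zero] at i3
    linarith
  have hrate : ∀ t, 0 ≤ t → S.Dfun R t ≤ S.Dfun R 0 / (1 + κ' * t) := by
    intro t ht
    obtain ⟨i1, i2⟩ := S.D_id R le_rfl ht (S.glob_Id le_rfl ht)
    have i3 : ∫ τ in (0 : ℝ)..t, S.rr R τ ≤ ∫ τ in (0 : ℝ)..t, (- (κ' * S.Dfun R t)) :=
      intervalIntegral.integral_mono_on ht i1 (by simp) fun τ hτ => by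
        have h0 := hτ.1
        have := hrr τ h0
        have := hDd τ h0
        have := mul_le_mul_of_nonneg_left (hdec τ t h0 hτ.2) hκ'.le
        linarith
    rw [intervalIntegral.integral_const, smul_eq_mul] at i3
    rw [le_div_iff₀ (by positivity)]
    linarith
  have hDlim : Tendsto (S.Dfun R) atTop (nhds 0) := by
    refine squeeze_zero' (g := fun t => S.Dfun R 0 / (1 + κ' * t)) ?_ ?_ ?_
    · filter_upwards [eventually_ge_atTop 0] with t ht using hD0 t ht
    · filter_upwards [eventually_ge_atTop 0] with t ht using hrate t ht
    · exact Tendsto.const_div_atTop (tendsto_atTop_add_const_left _ _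
        (tendsto_id.const_mul_atTop hκ')) _
  refine ⟨?_, ?_, ?_⟩
  · have hex : ∀ n : ℕ, ∃ s ∈ Set.Ioo (n : ℝ) (n + 1), - S.rr R s ≤ S.Dfun R n := by
      intro n
      have hn : (0 : ℝ) ≤ n := Nat.cast_nonneg n
      have hn1 : (n : ℝ) ≤ n + 1 := by linarith
      obtain ⟨i1, i2⟩ := S.D_id R hn hn1 (S.glob_Id hn hn1)
      obtain ⟨s, hs, h⟩ := exists_le_mean (f := fun τ => - S.rr R τ) (lt_add_one (n : ℝ))
        ((intervalIntegrable_iff_integrableOn_Icc_of_le hn1).1 i1).neg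
      refine ⟨s, hs, ?_⟩
      rw [intervalIntegral.integral_neg, ← i2] at h
      have := hD0 (n + 1) (by linarith)
      linarith
    choose ts hts hr using hex
    have h0 : ∀ n, 0 ≤ ts n := fun n => (Nat.cast_nonneg n).trans (hts n).1.le
    refine ⟨ts, h0, tendsto_atTop_mono (fun n => (hts n).1.le) tendsto_natCast_atTop_atTop, ?_⟩
    have hl : Tendsto (fun n : ℕ => (2 + 2 / (S.ρ * c0)) * S.Dfun R n) atTop (nhds 0) := by
      simpa using (hDlim.comp tendsto_natCast_atTop_atTop).const_mul (2 + 2 / (S.ρ * c0))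
    refine squeeze_zero (fun n => integral_nonneg fun x =>
      add_nonneg (sq_nonneg _) (nsq_nonneg _)) (fun n => ?_) hl
    have e : ∫ x, ((S.u (ts n) x - R.U x) ^ 2 + nsq (S.Du (ts n) x - pgrad R.U x)) ∂muQ d
        = w (ts n) + A (ts n) := integral_add (cont_int (by fun_prop)) (cont_int (cnsq _))
    rw [e]
    have a1 := hD _ (h0 n)
    have a2 := hdec n (ts n) (Nat.cast_nonneg n) (hts n).1.le
    have a3 := hdiss (ts n)
    have a4 := hrr _ (h0 n)
    have a5 := hr n
    have a6 := hB0 (ts n)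
    have a7 := mul_nonneg hκ.le a6
    have a8 : A (ts n) ≤ 2 / (S.ρ * c0) * S.Dfun R n := by
      rw [div_mul_eq_mul_div, le_div_iff₀ (by positivity)]
      linarith
    linarith
  · have hl : Tendsto (fun t => 2 * S.Dfun R t) atTop (nhds 0) := by
      simpa using hDlim.const_mul 2
    refine squeeze_zero' (Eventually.of_forall hw0) ?_ hl
    filter_upwards [eventually_ge_atTop 0] with t ht
    have := hD t ht
    have := hB0 t
    change w t ≤ _
    linarith
  · rw [Metric.tendsto_nhds]
    intro ε hε
    let θ := min 1 (ε / 2)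
    have hθ : 0 < θ := lt_min one_pos (by positivity)
    have hθε : θ ≤ ε / 2 := min_le_right _ _
    have hl : Tendsto (fun t => 2 / θ * S.Dfun R t) atTop (nhds 0) := by
      simpa using hDlim.const_mul (2 / θ)
    filter_upwards [eventually_ge_atTop 0, hl.eventually_lt_const (half_pos hε)] with t ht h
    rw [Real.dist_eq, sub_zero, abs_of_nonneg (integral_nonneg fun x => abs_nonneg _)]
    have a1 : ∫ x, |S.m t x - R.M x| ∂muQ d ≤ ∫ x, (θ * R.M x
        + 2 / θ * breg (S.m t x) (R.M x)) ∂muQ d :=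
      integral_mono (cont_int (by fun_prop)) (cont_int ((continuous_const.mul cM).add
        (continuous_const.mul (cb t)))) fun x =>
        abs_sub_le_breg (S.m_pos t x) (R.M_pos x) hθ (min_le_left _ _)
    rw [integral_add ((cont_int cM).const_mul _) ((cont_int (cb t)).const_mul _),
      integral_const_mul, integral_const_mul, hM1] at a1
    have a2 : B t ≤ S.Dfun R t := by
      rw [hD t ht]; linarith [hw0 t]
    have a3 : 2 / θ * B t ≤ 2 / θ * S.Dfun R t := by gcongr
    change _ ≤ θ * 1 + 2 / θ * B t at a1
    linarith

end Sys

end partG1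

section partG2

lemma ham_fderiv {d : ℕ} {H : (Fin d → ℝ) → (Fin d → ℝ) → ℝ}
    (hH : ContDiff ℝ 2 (fun q : (Fin d → ℝ) × (Fin d → ℝ) => H q.1 q.2)) (x p : Fin d → ℝ) :
    fderiv ℝ (H x) p = (fderiv ℝ (fun q : (Fin d → ℝ) × (Fin d → ℝ) => H q.1 q.2) (x, p)).comp
      (ContinuousLinearMap.inr ℝ (Fin d → ℝ) (Fin d → ℝ)) := by
  have h1 := (hH.differentiable (by norm_num) (x, p)).hasFDerivAt
  have h2 : HasFDerivAt (fun p : Fin d → ℝ => (x, p))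
      (ContinuousLinearMap.inr ℝ (Fin d → ℝ) (Fin d → ℝ)) p := hasFDerivAt_prodMk_right x p
  exact (HasFDerivAt.comp p h1 h2).fderiv

lemma ham_C2 {d : ℕ} {H : (Fin d → ℝ) → (Fin d → ℝ) → ℝ}
    (hH : ContDiff ℝ 2 (fun q : (Fin d → ℝ) × (Fin d → ℝ) => H q.1 q.2)) (x : Fin d → ℝ) :
    ContDiff ℝ 2 (H x) :=
  hH.comp (contDiff_const.prodMk contDiff_id : ContDiff ℝ 2 fun p : Fin d → ℝ => (x, p))

lemma ham_b_C1 {d : ℕ} {H : (Fin d → ℝ) → (Fin d → ℝ) → ℝ}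
    (hH : ContDiff ℝ 2 (fun q : (Fin d → ℝ) × (Fin d → ℝ) => H q.1 q.2)) (P : Fin d → ℝ) :
    ContDiff ℝ 1 (Function.uncurry fun x q => pgrad (H x) (P + q)) := by
  refine contDiff_pi.2 fun i => ?_
  have h1 : ContDiff ℝ 1 (fderiv ℝ (fun q : (Fin d → ℝ) × (Fin d → ℝ) => H q.1 q.2)) :=
    hH.fderiv_right (by norm_num)
  have h2 : ContDiff ℝ 1 fun z : (Fin d → ℝ) × (Fin d → ℝ) => (z.1, P + z.2) := by fun_prop
  have h3 := (h1.comp h2).clm_apply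
    (contDiff_const (c := ((0 : Fin d → ℝ), (Pi.single i 1 : Fin d → ℝ))))
  have e : (fun z : (Fin d → ℝ) × (Fin d → ℝ) =>
      Function.uncurry (fun x q => pgrad (H x) (P + q)) z i) = fun z =>
      (fderiv ℝ (fun q : (Fin d → ℝ) × (Fin d → ℝ) => H q.1 q.2) (z.1, P + z.2))
        ((0 : Fin d → ℝ), (Pi.single i 1 : Fin d → ℝ)) := by
    funext z
    simp only [Function.uncurry, pgrad, ham_fderiv hH, ContinuousLinearMap.comp_apply,
      ContinuousLinearMap.inr_apply]
  rw [e]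
  exact h3

lemma ham_conv {d : ℕ} {f : (Fin d → ℝ) → ℝ} (hf : ContDiff ℝ 2 f) {ρ : ℝ}
    (hA : ∀ p ξ : Fin d → ℝ, ρ * ∑ i, ξ i ^ 2 ≤ fderiv ℝ (fun q => fderiv ℝ f q ξ) p ξ)
    (p q : Fin d → ℝ) : f p + dot (pgrad f p) (q - p) + ρ / 2 * nsq (q - p) ≤ f q := by
  set v := q - p with hv
  have hl : ∀ s : ℝ, HasDerivAt (fun s : ℝ => p + s • v) v s := fun s => by
    simpa using ((hasDerivAt_id s).smul_const v).const_add p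
  have h1 : ∀ s : ℝ, HasDerivAt (fun s : ℝ => f (p + s • v)) (fderiv ℝ f (p + s • v) v) s :=
    fun s => (hf.differentiable (by norm_num) _).hasFDerivAt.comp_hasDerivAt s (hl s)
  have hf1 : ContDiff ℝ 1 fun q => fderiv ℝ f q v :=
    (hf.fderiv_right (m := 1) (by norm_num)).clm_apply contDiff_const
  have h2 : ∀ s : ℝ, HasDerivAt (fun s : ℝ => fderiv ℝ f (p + s • v) v)
      (fderiv ℝ (fun q => fderiv ℝ f q v) (p + s • v) v) s := fun s =>
    HasFDerivAt.comp_hasDerivAt (f := fun s : ℝ => p + s • v) (l := fun q => fderiv ℝ f q v) s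
      (hf1.differentiable (by norm_num) _).hasFDerivAt (hl s)
  have m1 : Monotone fun s : ℝ => fderiv ℝ f (p + s • v) v - s * (ρ * nsq v) := by
    have hd : ∀ s : ℝ, HasDerivAt (fun s : ℝ => fderiv ℝ f (p + s • v) v - s * (ρ * nsq v))
        (fderiv ℝ (fun q => fderiv ℝ f q v) (p + s • v) v - 1 * (ρ * nsq v)) s := fun s =>
      (h2 s).sub ((hasDerivAt_id s).mul_const _)
    refine monotone_of_deriv_nonneg (fun s => (hd s).differentiableAt) fun s => ?_
    rw [(hd s).deriv]
    have := hA (p + s • v) v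
    unfold nsq
    linarith
  have hd : ∀ s : ℝ, HasDerivAt (fun s : ℝ => f (p + s • v) - s * fderiv ℝ f p v
      - s ^ 2 * (ρ / 2 * nsq v)) (fderiv ℝ f (p + s • v) v - 1 * fderiv ℝ f p v
      - (2 * s) * (ρ / 2 * nsq v)) s := fun s => by
    have := ((h1 s).sub ((hasDerivAt_id s).mul_const (fderiv ℝ f p v))).sub
      (((hasDerivAt_id s).pow 2).mul_const (ρ / 2 * nsq v))
    refine this.congr_deriv ?_
    simp
  have m2 : MonotoneOn (fun s : ℝ => f (p + s • v) - s * fderiv ℝ f p v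
      - s ^ 2 * (ρ / 2 * nsq v)) (Set.Icc 0 1) := by
    refine monotoneOn_of_deriv_nonneg (convex_Icc 0 1)
      (fun s _ => (hd s).continuousAt.continuousWithinAt)
      (fun s _ => (hd s).differentiableAt.differentiableWithinAt) fun s hs => ?_
    rw [interior_Icc] at hs
    rw [(hd s).deriv]
    have := m1 hs.1.le
    simp only [zero_smul, add_zero, zero_mul, sub_zero] at this
    linarith
  have h := m2 (Set.left_mem_Icc.2 zero_le_one) (Set.right_mem_Icc.2 zero_le_one) zero_le_one
  simp only [zero_smul, add_zero, zero_mul, sub_zero, one_smul, one_mul, one_pow] at h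
  have e : p + v = q := by rw [hv]; abel
  rw [e] at h
  rw [← fderiv_eq_dot]
  norm_num at h
  linarith

lemma ham_bounds {d : ℕ} {H : (Fin d → ℝ) → (Fin d → ℝ) → ℝ} (P : Fin d → ℝ)
    (hH : ContDiff ℝ 2 (fun q : (Fin d → ℝ) × (Fin d → ℝ) => H q.1 q.2))
    (hHper : ∀ (z : Fin d → ℤ) (x p : Fin d → ℝ), H (x + fun i => (z i : ℝ)) p = H x p)
    {ρ : ℝ} (hρ : 0 < ρ)
    (hconv : ∀ x p q : Fin d → ℝ, H x (P + p) + dot (pgrad (H x) (P + p)) (q - p)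
      + ρ / 2 * nsq (q - p) ≤ H x (P + q))
    {C₀ : ℝ} (hC₀ : 0 < C₀)
    (hA2pp : ∀ x p : Fin d → ℝ, ‖fderiv ℝ (fun q => fderiv ℝ (H x) q) p‖ ≤ C₀) :
    ∃ K, 0 ≤ K ∧ (∀ x q, ρ / 4 * nsq q - K ≤ H x (P + q)) ∧
      (∀ x q, H x (P + q) ≤ K * (1 + nsq q)) ∧
      ∀ x q, nsq (pgrad (H x) (P + q)) ≤ K * (1 + nsq q) := by
  have hHx : ∀ (z : Fin d → ℤ) (x : Fin d → ℝ), H (x + fun i => (z i : ℝ)) = H x :=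
    fun z x => funext fun p => hHper z x p
  obtain ⟨K0, hK0⟩ := per_bdd (f := fun x => H x P) (fun z x => hHper z x P)
    (hH.continuous.comp (continuous_id.prodMk continuous_const))
  obtain ⟨K1, hK1⟩ := per_bdd (f := fun x => ‖fderiv ℝ (H x) P‖)
    (fun z x => by simp only [hHx]) (by
      simp only [ham_fderiv hH]
      have h1 := hH.continuous_fderiv (by norm_num)
      have h2 : Continuous fun x : Fin d → ℝ => (x, P) := by fun_prop
      exact ((h1.comp h2).clm_comp continuous_const).norm)
  have hK0' : 0 ≤ K0 := (abs_nonneg _).trans (hK0 0)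
  have hK1' : 0 ≤ K1 := (abs_nonneg _).trans (hK1 0)
  have hD : ∀ x q, ‖fderiv ℝ (H x) (P + q)‖ ≤ K1 + C₀ * ‖q‖ := by
    intro x q
    have h1 : ContDiff ℝ 1 (fderiv ℝ (H x)) := (ham_C2 hH x).fderiv_right (by norm_num)
    have h2 := Convex.norm_image_sub_le_of_norm_fderiv_le (𝕜 := ℝ) (f := fderiv ℝ (H x))
      (C := C₀) (s := Set.univ) (x := P) (y := P + q)
      (fun y _ => h1.differentiable (by norm_num) y) (fun y _ => hA2pp x y) convex_univ
      (Set.mem_univ _) (Set.mem_univ _)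
    rw [add_sub_cancel_left] at h2
    have h3 := hK1 x
    rw [abs_of_nonneg (norm_nonneg _)] at h3
    have h4 := norm_le_norm_add_norm_sub' (fderiv ℝ (H x) (P + q)) (fderiv ℝ (H x) P)
    linarith
  have hbn : ∀ x q, ‖pgrad (H x) (P + q)‖ ≤ K1 + C₀ * ‖q‖ := by
    intro x q
    refine (pi_norm_le_iff_of_nonneg (by positivity)).2 fun i => ?_
    refine (ContinuousLinearMap.le_opNorm _ _).trans ?_
    rw [Pi.norm_single, norm_one, mul_one]
    exact hD x q
  let Kb := d * (2 * K1 ^ 2 + 2 * C₀ ^ 2)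
  have hKb : 0 ≤ Kb := by positivity
  have hb : ∀ x q, nsq (pgrad (H x) (P + q)) ≤ Kb * (1 + nsq q) := by
    intro x q
    have h1 := nsq_le_norm_sq (pgrad (H x) (P + q))
    have h2 : ‖pgrad (H x) (P + q)‖ ^ 2 ≤ (K1 + C₀ * ‖q‖) ^ 2 :=
      pow_le_pow_left₀ (norm_nonneg _) (hbn x q) 2
    have h3 := norm_sq_le_nsq q
    have h4 : (K1 + C₀ * ‖q‖) ^ 2 ≤ (2 * K1 ^ 2 + 2 * C₀ ^ 2) * (1 + nsq q) := by
      have a1 := sq_nonneg (K1 - C₀ * ‖q‖)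
      have a2 := mul_le_mul_of_nonneg_left h3 (sq_nonneg C₀)
      have a3 := mul_nonneg (sq_nonneg K1) (nsq_nonneg q)
      nlinarith [sq_nonneg C₀]
    calc nsq (pgrad (H x) (P + q)) ≤ d * ‖pgrad (H x) (P + q)‖ ^ 2 := h1
      _ ≤ d * ((2 * K1 ^ 2 + 2 * C₀ ^ 2) * (1 + nsq q)) :=
        mul_le_mul_of_nonneg_left (h2.trans h4) (Nat.cast_nonneg d)
      _ = Kb * (1 + nsq q) := by simp only [Kb]; ring
  have nsq0 : nsq (0 : Fin d → ℝ) = 0 := by simp [nsq]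
  refine ⟨K0 + Kb / ρ + Kb + 1, by positivity, ?_, ?_, ?_⟩
  · intro x q
    have h1 := hconv x 0 q
    have h2 := hb x 0
    simp only [add_zero, sub_zero, nsq0, mul_one] at h1 h2
    have h3 := (abs_le.1 (hK0 x)).1
    have h4 := (abs_le.1 (dot_le_half ((2 / ρ) • pgrad (H x) P) q)).1
    rw [smul_dot, nsq_smul] at h4
    have h5 : -(nsq (pgrad (H x) P) / ρ + ρ / 4 * nsq q) ≤ dot (pgrad (H x) P) q := by
      have := mul_le_mul_of_nonneg_left h4 (half_pos hρ).le
      have e1 : ρ / 2 * (2 / ρ * dot (pgrad (H x) P) q) = dot (pgrad (H x) P) q := by field_simp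
      have e2 : ρ / 2 * (-(((2 / ρ) ^ 2 * nsq (pgrad (H x) P) + nsq q) / 2))
          = -(nsq (pgrad (H x) P) / ρ + ρ / 4 * nsq q) := by field_simp; ring
      rwa [e1, e2] at this
    have h6 : nsq (pgrad (H x) P) / ρ ≤ Kb / ρ := by gcongr
    linarith
  · intro x q
    have h1 := hconv x q 0
    have h2 := hb x q
    have h3 := (abs_le.1 (hK0 x)).2
    have h4 := (abs_le.1 (dot_le_half (pgrad (H x) (P + q)) (0 - q))).1
    have h5 : nsq (0 - q) = nsq q := by rw [zero_sub, nsq_neg]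
    rw [h5] at h1 h4
    rw [add_zero] at h1
    have a0 := nsq_nonneg q
    have a1 : 0 ≤ Kb / ρ := by positivity
    have a2 := mul_nonneg a1 a0
    have a3 := mul_nonneg hK0' a0
    have a4 := mul_nonneg hρ.le a0
    have a5 := mul_nonneg hKb a0
    nlinarith
  · intro x q
    refine (hb x q).trans ?_
    have a0 := nsq_nonneg q
    have a1 : 0 ≤ Kb / ρ := by positivity
    refine mul_le_mul_of_nonneg_right ?_ (by linarith)
    linarith

end partG2

/-- convergence of the entropy-penalized Hessian Riemannian flow. Under
Assumptions A1 (uniform convexity) and A2 (growth bounds) on `H`, if `(m,u)` is a positive,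
periodic, regular solution of the entropy-penalized Hessian Riemannian flow with unit
initial mass and zero initial mean, and `(m*,u*,H̄*)` is a smooth, positive, periodic
solution of the entropy-penalized stationary system of unit mass and zero mean, then
`u(t_i) → u*` in `W^{1,2}` along some sequence `t_i → ∞`, `u(t) → u*` in `L²` and
`m(t) → m*` in `L¹` as `t → ∞`. -/
theorem entropy_penalized_HRF_convergence
    (d : ℕ) (hd : 1 ≤ d) (P : Fin d → ℝ) (k : ℝ) (hk : 0 < k)
    (H : (Fin d → ℝ) → (Fin d → ℝ) → ℝ)
    (hHC2 : ContDiff ℝ 2 (fun q : (Fin d → ℝ) × (Fin d → ℝ) => H q.1 q.2))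
    (hHper : ∀ (z : Fin d → ℤ) (x p : Fin d → ℝ), H (x + fun i => (z i : ℝ)) p = H x p)
    -- Assumption A1: uniform convexity of `H` in `p`.
    (ρ : ℝ) (hρ : 0 < ρ)
    (hA1 : ∀ x p ξ : Fin d → ℝ,
      ρ * ∑ i, ξ i ^ 2 ≤ fderiv ℝ (fun q => fderiv ℝ (H x) q ξ) p ξ)
    -- Assumption A2: growth bounds on the second derivatives of `H`.
    (C₀ : ℝ) (hC₀ : 0 < C₀)
    (hA2pp : ∀ x p : Fin d → ℝ, ‖fderiv ℝ (fun q => fderiv ℝ (H x) q) p‖ ≤ C₀)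
    (hA2xp : ∀ x p : Fin d → ℝ,
      ‖fderiv ℝ (fun y => fderiv ℝ (H y) p) x‖
        ≤ C₀ * (1 + Real.sqrt (∑ i, p i ^ 2)))
    (hA2xx : ∀ x p : Fin d → ℝ,
      ‖fderiv ℝ (fun y => fderiv ℝ (fun y' => H y' p) y) x‖
        ≤ C₀ * (1 + ∑ i, p i ^ 2))
    -- The solution of the entropy-penalized Hessian Riemannian flow.
    (m u : ℝ → (Fin d → ℝ) → ℝ)
    (hmreg : ∀ t, 0 ≤ t → ContDiff ℝ 1 (m t) ∧ ZPeriodic (m t) ∧ ∀ x, 0 < m t x)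
    (hureg : ∀ t, 0 ≤ t → ContDiff ℝ 2 (u t) ∧ ZPeriodic (u t))
    (hflow : ∀ t, 0 ≤ t → ∀ x,
      HasDerivAt (fun s => m s x)
        (m t x * (H x (P + pgrad (u t) x)
          - (∫ y in Set.Icc (0 : Fin d → ℝ) 1,
              (m t y * H y (P + pgrad (u t) y) - (1 / k) * (m t y * Real.log (m t y))))
            / (∫ y in Set.Icc (0 : Fin d → ℝ) 1, m t y)
          - (1 / k) * Real.log (m t x))) t ∧
      HasDerivAt (fun s => u s x)
        (pdiv (fun y i => m t y * pgrad (H y) (P + pgrad (u t) y) i) x) t)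
    (hmass0 : ∫ x in Set.Icc (0 : Fin d → ℝ) 1, m 0 x = 1)
    (humean0 : ∫ x in Set.Icc (0 : Fin d → ℝ) 1, u 0 x = 0)
    -- The smooth solution of the entropy-penalized stationary system.
    (mstar ustar : (Fin d → ℝ) → ℝ) (Hstar : ℝ)
    (hmstar : ContDiff ℝ (⊤ : ℕ∞) mstar) (hmstarper : ZPeriodic mstar)
    (hmstarpos : ∀ x, 0 < mstar x)
    (hustar : ContDiff ℝ (⊤ : ℕ∞) ustar) (hustarper : ZPeriodic ustar)
    (hmstarmass : ∫ x in Set.Icc (0 : Fin d → ℝ) 1, mstar x = 1)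
    (hustarmean : ∫ x in Set.Icc (0 : Fin d → ℝ) 1, ustar x = 0)
    (hstar1 : ∀ x, H x (P + pgrad ustar x) = Hstar + (1 / k) * Real.log (mstar x))
    (hstar2 : ∀ x, pdiv (fun y i => mstar y * pgrad (H y) (P + pgrad ustar y) i) x = 0) :
    (∃ ts : ℕ → ℝ, Tendsto ts atTop atTop ∧
      Tendsto (fun n =>
          ∫ x in Set.Icc (0 : Fin d → ℝ) 1,
            ((u (ts n) x - ustar x) ^ 2
              + ∑ i, (pgrad (u (ts n)) x i - pgrad ustar x i) ^ 2))
        atTop (nhds 0)) ∧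
    Tendsto (fun t => ∫ x in Set.Icc (0 : Fin d → ℝ) 1, (u t x - ustar x) ^ 2)
      atTop (nhds 0) ∧
    Tendsto (fun t => ∫ x in Set.Icc (0 : Fin d → ℝ) 1, |m t x - mstar x|)
      atTop (nhds 0) := by
  have hconv : ∀ x p q : Fin d → ℝ, H x (P + p) + dot (pgrad (H x) (P + p)) (q - p)
      + ρ / 2 * nsq (q - p) ≤ H x (P + q) := by
    intro x p q
    have := ham_conv (ham_C2 hHC2 x) (hA1 x) (P + p) (P + q)
    rwa [add_sub_add_left_eq_sub] at this
  obtain ⟨K, hK, hlow, hup, hbup⟩ := ham_bounds P hHC2 hHper hρ hconv hC₀ hA2pp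
  have hHx : ∀ (z : Fin d → ℤ) (x : Fin d → ℝ), H (x + fun i => (z i : ℝ)) = H x :=
    fun z x => funext fun p => hHper z x p
  have h0 : ∀ t : ℝ, 0 ≤ max t 0 := fun t => le_max_right t 0
  let S : Sys d :=
    { κ := 1 / k
      hκ := by positivity
      ρ := ρ
      hρ := hρ
      h := fun x q => H x (P + q)
      b := fun x q => pgrad (H x) (P + q)
      m := fun t => m (max t 0)
      u := fun t => u (max t 0)
      hb := fun t => (∫ y, m (max t 0) y * (H y (P + pgrad (u (max t 0)) y)
        - 1 / k * Real.log (m (max t 0) y)) ∂muQ d) / ∫ y, m (max t 0) y ∂muQ d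
      h_cont := by
        have h2 : Continuous fun z : (Fin d → ℝ) × (Fin d → ℝ) => (z.1, P + z.2) := by fun_prop
        exact hHC2.continuous.comp h2
      b_C1 := ham_b_C1 hHC2 P
      h_per := fun z x q => hHper z x (P + q)
      b_per := fun z x q => by simp only [hHx]
      conv := hconv
      c := ρ / 4
      hc := by positivity
      K := K
      hK := hK
      h_low := hlow
      h_up := hup
      b_up := hbup
      m_reg := fun t => (hmreg _ (h0 t)).1
      m_per := fun t => (hmreg _ (h0 t)).2.1
      m_pos := fun t => (hmreg _ (h0 t)).2.2
      u_reg := fun t => (hureg _ (h0 t)).1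
      u_per := fun t => (hureg _ (h0 t)).2
      m_tcont := fun x => continuous_iff_continuousAt.2 fun t =>
        ContinuousAt.comp (g := fun s => m s x) (f := fun t : ℝ => max t 0)
          (hflow _ (h0 t) x).1.continuousAt (by fun_prop)
      u_tcont := fun x => continuous_iff_continuousAt.2 fun t =>
        ContinuousAt.comp (g := fun s => u s x) (f := fun t : ℝ => max t 0)
          (hflow _ (h0 t) x).2.continuousAt (by fun_prop)
      m_der := by
        intro t ht x
        have h := (hflow t ht x).1.hasDerivWithinAt (s := Set.Ioi t)
        have e : max t 0 = t := max_eq_left ht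
        have h' := h.congr (f₁ := fun s => m (max s 0) x)
          (fun s hs => by rw [max_eq_left (ht.trans (le_of_lt hs))]) (by rw [e])
        refine h'.congr_deriv ?_
        rw [e]
        congr 4
        refine integral_congr_ae (Eventually.of_forall fun y => ?_)
        change _ = _
        ring
      u_der := by
        intro t ht x
        have h := (hflow t ht x).2.hasDerivWithinAt (s := Set.Ioi t)
        have e : max t 0 = t := max_eq_left ht
        have h' := h.congr (f₁ := fun s => u (max s 0) x)
          (fun s hs => by rw [max_eq_left (ht.trans (le_of_lt hs))]) (by rw [e])
        refine h'.congr_deriv ?_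
        rw [e]
        rfl
      hb_eq := fun t => rfl }
  let R : Sys.Ref d :=
    { M := mstar
      U := ustar
      M_reg := hmstar.of_le (by exact_mod_cast le_top)
      M_per := hmstarper
      M_pos := hmstarpos
      U_reg := contDiff_infty.1 hustar 2
      U_per := hustarper }
  have e0 : max (0 : ℝ) 0 = 0 := max_self 0
  obtain ⟨⟨ts, t0, t1, t2⟩, t3, t4⟩ := S.main R hmstarmass hustarmean
    (by
      change ∫ x, m (max 0 0) x ∂muQ d = 1
      rw [e0]
      exact hmass0)
    (by
      change ∫ x, u (max 0 0) x ∂muQ d = 0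
      rw [e0]
      exact humean0)
    hstar2 Hstar
    (fun x => by
      change H x (P + pgrad ustar x) - 1 / k * Real.log (mstar x) = Hstar
      rw [hstar1 x]
      ring)
  refine ⟨⟨ts, t1, ?_⟩, ?_, ?_⟩
  · refine t2.congr fun n => ?_
    change ∫ x, ((u (max (ts n) 0) x - ustar x) ^ 2
      + ∑ i, (pgrad (u (max (ts n) 0)) x i - pgrad ustar x i) ^ 2) ∂muQ d = _
    rw [max_eq_left (t0 n)]
    rfl
  · refine t3.congr' ?_
    filter_upwards [eventually_ge_atTop 0] with t ht
    change ∫ x, (u (max t 0) x - ustar x) ^ 2 ∂muQ d = _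
    rw [max_eq_left ht]
    rfl
  · refine t4.congr' ?_
    filter_upwards [eventually_ge_atTop 0] with t ht
    change ∫ x, |m (max t 0) x - mstar x| ∂muQ d = _
    rw [max_eq_left ht]
    rfl
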